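/- arXiv:2406.06892 — 3 statements merged into one kernel-verified Lean document; each statement's English description precedes it below -/
import Mathlib

section
/- For every ε > 0 there exists a constant C > 0 such that for every integer b ≥ 1, every integer k, and every real x ≥ 1 with |k| < b·x^{2/3}, the number of sporadic solutions n ≤ x to the congruence b·σ(n) ≡ k (mod n) is at most C · b² · x^{2/3 + ε}. -/
/-- `sigma1 n` is the sum of the positive divisors of `n`. -/
noncomputable def sigma1 (n : ℕ) : ℕ := ArithmeticFunction.sigma 1 n

/-- `n` is a solution of the congruence `b·σ(n) ≡ k (mod n)`. -/
def IsCongSolution (b : ℕ) (k : ℤ) (n : ℕ) : Prop :=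
  (n : ℤ) ∣ ((b : ℤ) * (sigma1 n : ℤ) - k)

/-- `n` is a regular solution of `b·σ(n) ≡ k (mod n)`: `b ∣ k` and `n = p·m` with `p` prime,
`p ∤ m`, `m ∣ b·σ(m)` and `σ(m) = k/b` (i.e. `b·σ(m) = k`). -/
def IsRegularSolution (b : ℕ) (k : ℤ) (n : ℕ) : Prop :=
  (b : ℤ) ∣ k ∧ ∃ p m : ℕ, p.Prime ∧ n = p * m ∧ ¬ p ∣ m ∧
    m ∣ b * sigma1 m ∧ (b : ℤ) * (sigma1 m : ℤ) = k

/-- `n` is a sporadic solution of `b·σ(n) ≡ k (mod n)`. -/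
def IsSporadicSolution (b : ℕ) (k : ℤ) (n : ℕ) : Prop :=
  IsCongSolution b k n ∧ ¬ IsRegularSolution b k n


lemma prod_ite_le (s : Finset ℕ) (P : ℕ) (K : ℝ) (hK : 1 ≤ K) :
    ∏ p ∈ s, (if p < P then K else 1) ≤ K ^ P := by
  rw [Finset.prod_ite, Finset.prod_const_one, mul_one, Finset.prod_const]
  apply pow_le_pow_right₀ hK
  calc (s.filter (fun p => p < P)).card ≤ (Finset.range P).card := by
        apply Finset.card_le_card
        intro p hp
        simp at hp ⊢
        exact hp.2
    _ = P := by simp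

lemma divisor_bound (ε : ℝ) (hε : 0 < ε) :
    ∃ C : ℝ, 1 ≤ C ∧ ∀ n : ℕ, 1 ≤ n → (n.divisors.card : ℝ) ≤ C * (n : ℝ) ^ ε := by
  obtain ⟨P, hP⟩ := exists_nat_ge ((2 : ℝ) ^ (1 / ε))
  have hl2 : 0 < Real.log 2 := Real.log_pos (by norm_num)
  set K : ℝ := max 1 (1 / (ε * Real.log 2)) with hKdef
  have hK1 : 1 ≤ K := le_max_left _ _
  have hK2 : 1 ≤ K * (ε * Real.log 2) := by
    have : 1 / (ε * Real.log 2) ≤ K := le_max_right _ _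
    rwa [div_le_iff₀ (by positivity)] at this
  refine ⟨K ^ P, one_le_pow₀ hK1, ?_⟩
  intro n hn
  have hn0 : n ≠ 0 := by omega
  rw [Nat.card_divisors hn0]
  have hnn : ((n : ℝ)) ^ ε = ∏ p ∈ n.primeFactors, ((p : ℝ) ^ ε) ^ (n.factorization p) := by
    conv_lhs => rw [← Nat.prod_factorization_pow_eq_self hn0]
    rw [Finsupp.prod, Nat.support_factorization]
    push_cast
    rw [← Real.finsetProd_rpow _ _ (fun i _ => by positivity)]
    apply Finset.prod_congr rfl
    intro p _
    rw [← Real.rpow_natCast, ← Real.rpow_mul (by positivity), ← Real.rpow_natCast,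
      ← Real.rpow_mul (by positivity), mul_comm]
  rw [hnn]
  push_cast
  calc ∏ p ∈ n.primeFactors, ((n.factorization p : ℝ) + 1)
      ≤ ∏ p ∈ n.primeFactors, ((if p < P then K else 1) * ((p : ℝ) ^ ε) ^ (n.factorization p)) := by
        apply Finset.prod_le_prod
        · intro i _; positivity
        · intro p hp
          have hp2 : (2 : ℝ) ≤ p := by
            exact_mod_cast (Nat.prime_of_mem_primeFactors hp).two_le
          set v := n.factorization p
          split_ifs with h
          · have h1 : 1 + (v : ℝ) * (ε * Real.log 2) ≤ ((p : ℝ) ^ ε) ^ v := by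
              calc 1 + (v : ℝ) * (ε * Real.log 2) ≤ Real.exp ((v : ℝ) * (ε * Real.log 2)) := by
                    linarith [Real.add_one_le_exp ((v : ℝ) * (ε * Real.log 2))]
                _ = ((2 : ℝ) ^ ε) ^ v := by
                    rw [Real.exp_nat_mul, Real.rpow_def_of_pos (by norm_num), mul_comm ε]
                _ ≤ _ := by gcongr
            have hv : (0 : ℝ) ≤ v := by positivity
            calc (v : ℝ) + 1 ≤ K * (1 + (v : ℝ) * (ε * Real.log 2)) := by nlinarith
              _ ≤ _ := by gcongr
          · have h2 : (2 : ℝ) ≤ (p : ℝ) ^ ε := by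
              have hpP : (2 : ℝ) ^ (1 / ε) ≤ p := hP.trans (by exact_mod_cast not_lt.mp h)
              calc (2 : ℝ) = ((2 : ℝ) ^ (1 / ε)) ^ ε := by
                    rw [← Real.rpow_mul (by norm_num)]; field_simp; simp
                _ ≤ _ := by gcongr
            rw [one_mul]
            calc (v : ℝ) + 1 ≤ 2 ^ v := by
                  exact_mod_cast (Nat.lt_two_pow_self : v < 2 ^ v)
              _ ≤ _ := by gcongr
    _ = (∏ p ∈ n.primeFactors, (if p < P then K else 1)) *
          ∏ p ∈ n.primeFactors, ((p : ℝ) ^ ε) ^ (n.factorization p) := Finset.prod_mul_distrib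
    _ ≤ _ := by
        gcongr
        exact prod_ite_le _ _ _ hK1

/-- Rankin bound for smooth numbers. -/
lemma smooth_bound (δ : ℝ) (hδ : 0 < δ) :
    ∃ C : ℝ, 1 ≤ C ∧ ∀ N : ℕ, ∀ x : ℝ, 0 ≤ x → ∀ s : Finset ℕ,
      (∀ a ∈ s, a ∈ N.smoothNumbers ∧ (a : ℝ) ≤ x) →
      (s.card : ℝ) ≤ C * Real.exp (δ * N) * x ^ ((2 : ℝ) / 3) := by
  have hlim : Filter.Tendsto (fun p : ℕ => (1 - (p : ℝ) ^ (-(2 / 3 : ℝ)))⁻¹) Filter.atTop (nhds 1) := by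
    have h0 : Filter.Tendsto (fun p : ℕ => (p : ℝ) ^ (-(2 / 3 : ℝ))) Filter.atTop (nhds 0) :=
      (tendsto_rpow_neg_atTop (by norm_num)).comp tendsto_natCast_atTop_atTop
    have := ((tendsto_const_nhds (x := (1 : ℝ))).sub h0).inv₀ (by norm_num)
    simpa using this
  have hev := hlim.eventually (ge_mem_nhds (show (1 : ℝ) < Real.exp δ from Real.one_lt_exp_iff.mpr hδ))
  obtain ⟨P, hP⟩ := Filter.eventually_atTop.mp hev
  set K : ℝ := (1 - (2 : ℝ) ^ (-(2 / 3 : ℝ)))⁻¹ with hK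
  have h2lt : (2 : ℝ) ^ (-(2 / 3 : ℝ)) < 1 :=
    Real.rpow_lt_one_of_one_lt_of_neg (by norm_num) (by norm_num)
  have h2pos : 0 < (2 : ℝ) ^ (-(2 / 3 : ℝ)) := by positivity
  have hK1 : 1 ≤ K := by
    rw [hK]
    apply (one_le_inv₀ (by linarith)).mpr; linarith
  refine ⟨K ^ P, one_le_pow₀ hK1, ?_⟩
  intro N x hx s hs
  let f : ℕ →* ℝ :=
    { toFun := fun n => (n : ℝ) ^ (-(2 / 3 : ℝ))
      map_one' := by simp
      map_mul' := by
        intro a b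
        push_cast
        exact Real.mul_rpow (by positivity) (by positivity) }
  have hfa : ∀ n : ℕ, f n = (n : ℝ) ^ (-(2 / 3 : ℝ)) := fun n => rfl
  have hplt : ∀ p : ℕ, 2 ≤ p → f p ≤ (2 : ℝ) ^ (-(2 / 3 : ℝ)) := by
    intro p hp
    rw [hfa]
    apply Real.rpow_le_rpow_of_nonpos (by norm_num) (by exact_mod_cast hp) (by norm_num)
  have hf0 : ∀ n, 0 ≤ f n := fun n => by rw [hfa]; positivity
  have hE := (EulerProduct.summable_and_hasSum_smoothNumbers_prod_primesBelow_geometric (f := f)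
    (by
      intro p hp
      rw [Real.norm_of_nonneg (hf0 p)]
      exact (hplt p hp.two_le).trans_lt h2lt) N).2
  have hprod : ∏ p ∈ N.primesBelow, (1 - f p)⁻¹ ≤ K ^ P * Real.exp (δ * N) := by
    calc ∏ p ∈ N.primesBelow, (1 - f p)⁻¹
        ≤ ∏ p ∈ N.primesBelow, ((if p < P then K else 1) * Real.exp δ) := by
          apply Finset.prod_le_prod
          · intro p hp
            have := hplt p (Nat.prime_of_mem_primesBelow hp).two_le
            apply inv_nonneg.mpr; linarith
          · intro p hp
            have h2 := hplt p (Nat.prime_of_mem_primesBelow hp).two_le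
            split_ifs with h
            · calc (1 - f p)⁻¹ ≤ K := by
                    rw [hK]; apply inv_anti₀ <;> linarith
                _ ≤ K * Real.exp δ := le_mul_of_one_le_right (by linarith) (Real.one_le_exp hδ.le)
            · rw [one_mul]; exact hP p (not_lt.mp h)
      _ = (∏ p ∈ N.primesBelow, (if p < P then K else 1)) * Real.exp δ ^ (N.primesBelow.card) := by
          rw [Finset.prod_mul_distrib, Finset.prod_const]
      _ ≤ K ^ P * Real.exp (δ * N) := by
          gcongr
          · exact prod_ite_le _ _ _ hK1
          · rw [mul_comm δ, Real.exp_nat_mul]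
            apply pow_le_pow_right₀ (Real.one_le_exp hδ.le)
            calc N.primesBelow.card ≤ (Finset.range N).card := Finset.card_le_card (Finset.filter_subset _ _)
              _ = N := by simp
  have hsum : ∑ a ∈ s, f a ≤ K ^ P * Real.exp (δ * N) := by
    refine le_trans ?_ hprod
    rw [← hE.tsum_eq]
    have := hE.summable.sum_le_tsum (s.subtype (fun a => a ∈ N.smoothNumbers)) (fun i _ => hf0 i)
    refine le_trans (le_of_eq ?_) this
    rw [Finset.sum_subtype_of_mem (fun a => f a) (fun a ha => (hs a ha).1)]
  calc (s.card : ℝ) = ∑ a ∈ s, (1 : ℝ) := by simp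
    _ ≤ ∑ a ∈ s, f a * x ^ ((2 : ℝ) / 3) := by
        apply Finset.sum_le_sum
        intro a ha
        have ha0 : (0 : ℝ) < a := by
          exact_mod_cast Nat.pos_of_ne_zero (Nat.ne_zero_of_mem_smoothNumbers (hs a ha).1)
        rw [hfa, Real.rpow_neg ha0.le, ← div_eq_inv_mul, ← Real.div_rpow hx ha0.le]
        apply Real.one_le_rpow _ (by norm_num)
        rw [le_div_iff₀ ha0]; linarith [(hs a ha).2]
    _ = (∑ a ∈ s, f a) * x ^ ((2 : ℝ) / 3) := by rw [Finset.sum_mul]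
    _ ≤ _ := by gcongr

lemma sigma1_mul {a b : ℕ} (h : a.Coprime b) : sigma1 (a * b) = sigma1 a * sigma1 b :=
  ArithmeticFunction.isMultiplicative_sigma.map_mul_of_coprime h

lemma sigma1_pos {n : ℕ} (h : 1 ≤ n) : 1 ≤ sigma1 n :=
  ArithmeticFunction.sigma_pos 1 n (by omega)

lemma le_sigma1 {n : ℕ} (h : 1 ≤ n) : n ≤ sigma1 n := by
  rw [sigma1, ArithmeticFunction.sigma_one_apply]
  exact Finset.single_le_sum (f := fun d => d) (fun i _ => Nat.zero_le _)
    (Nat.mem_divisors_self n (by omega))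

lemma lt_sigma1 {n : ℕ} (h : 2 ≤ n) : n < sigma1 n := by
  rw [sigma1, ArithmeticFunction.sigma_one_apply]
  have hsub : ({1, n} : Finset ℕ) ⊆ n.divisors := by
    intro d hd
    simp at hd
    rcases hd with rfl | rfl <;> simp <;> omega
  have := Finset.sum_le_sum_of_subset (f := fun d => d) hsub
  rw [Finset.sum_pair (by omega)] at this
  omega

lemma sigma1_le (n : ℕ) : sigma1 n ≤ n * n.divisors.card := by
  rw [sigma1, ArithmeticFunction.sigma_one_apply]
  calc ∑ d ∈ n.divisors, d ≤ ∑ d ∈ n.divisors, n :=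
        Finset.sum_le_sum (fun d hd => Nat.divisor_le hd)
    _ = _ := by simp [mul_comm]

lemma sigma1_rough (N : ℕ) (hN : 2 ≤ N) (B : ℕ) (hB : 1 ≤ B)
    (hr : ∀ p : ℕ, p.Prime → p ∣ B → N ≤ p) :
    (sigma1 B : ℝ) * (1 - 1 / (N : ℝ)) ^ B.primeFactors.card ≤ B := by
  have hN0 : (2 : ℝ) ≤ N := by exact_mod_cast hN
  have hc : 0 ≤ 1 - 1 / (N : ℝ) := by
    rw [sub_nonneg, div_le_one (by linarith)]; linarith
  induction B using Nat.recOnPosPrimePosCoprime with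
  | prime_pow p a hp ha =>
    rw [Nat.primeFactors_prime_pow (by omega) hp, Finset.card_singleton, pow_one]
    have hNp : (N : ℝ) ≤ p := by exact_mod_cast hr p hp (dvd_pow_self p (by omega))
    have h1 : (sigma1 (p ^ a) : ℝ) * ((p : ℝ) - 1) = (p : ℝ) ^ (a + 1) - 1 := by
      rw [sigma1, ArithmeticFunction.sigma_one_apply_prime_pow hp]
      push_cast
      exact geom_sum_mul (p : ℝ) (a + 1)
    have hp0 : (0 : ℝ) < p := by linarith
    calc (sigma1 (p ^ a) : ℝ) * (1 - 1 / (N : ℝ)) ≤ (sigma1 (p ^ a) : ℝ) * (1 - 1 / (p : ℝ)) := by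
          gcongr
      _ = (sigma1 (p ^ a) : ℝ) * ((p : ℝ) - 1) / p := by field_simp
      _ = ((p : ℝ) ^ (a + 1) - 1) / p := by rw [h1]
      _ ≤ (p : ℝ) ^ (a + 1) / p := by gcongr; linarith
      _ = ((p ^ a : ℕ) : ℝ) := by push_cast; field_simp; ring
  | zero => omega
  | one => simp [sigma1]
  | coprime a b ha hb hab iha ihb =>
    rw [sigma1_mul hab, hab.primeFactors_mul, Finset.card_union_of_disjoint hab.disjoint_primeFactors,
      pow_add]
    push_cast
    have h1 := iha (by omega) (fun p hp hpa => hr p hp (hpa.mul_right b))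
    have h2 := ihb (by omega) (fun p hp hpa => hr p hp (hpa.mul_left a))
    calc _ = ((sigma1 a : ℝ) * (1 - 1 / (N : ℝ)) ^ a.primeFactors.card) *
        ((sigma1 b : ℝ) * (1 - 1 / (N : ℝ)) ^ b.primeFactors.card) := by ring
      _ ≤ _ := by gcongr

lemma card_primeFactors_le_log {B : ℕ} (hB : 1 ≤ B) : B.primeFactors.card ≤ Nat.log 2 B := by
  apply Nat.le_log_of_pow_le (by norm_num)
  calc 2 ^ B.primeFactors.card = ∏ p ∈ B.primeFactors, 2 := by simp
    _ ≤ ∏ p ∈ B.primeFactors, p :=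
        Finset.prod_le_prod' (fun p hp => (Nat.prime_of_mem_primeFactors hp).two_le)
    _ ≤ B := Nat.le_of_dvd (by omega) (Nat.prod_primeFactors_dvd B)

lemma sigma1_rough_lt (N X : ℕ) (hN : 2 * Nat.log 2 X + 2 ≤ N) (B : ℕ) (hB : 1 ≤ B) (hBX : B ≤ X)
    (hr : ∀ p : ℕ, p.Prime → p ∣ B → N ≤ p) : sigma1 B < 2 * B := by
  have h := sigma1_rough N (by omega) B hB hr
  have hw : B.primeFactors.card ≤ Nat.log 2 X :=
    (card_primeFactors_le_log hB).trans (Nat.log_mono_right hBX)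
  set w := B.primeFactors.card
  have hN0 : (2 : ℝ) ≤ N := by exact_mod_cast (by omega : 2 ≤ N)
  have hNw : 2 * (w : ℝ) + 2 ≤ N := by exact_mod_cast (by omega : 2 * w + 2 ≤ N)
  have hinv : 1 / (N : ℝ) ≤ 1 := by rw [div_le_one (by linarith)]; linarith
  have hb : 1 + (w : ℝ) * (-(1 / (N : ℝ))) ≤ (1 + (-(1 / (N : ℝ)))) ^ w :=
    one_add_mul_le_pow (by linarith) w
  rw [← sub_eq_add_neg] at hb
  have hhalf : 1 / 2 < 1 + (w : ℝ) * (-(1 / (N : ℝ))) := by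
    have : (w : ℝ) * (1 / (N : ℝ)) < 1 / 2 := by
      rw [mul_one_div, div_lt_div_iff₀ (by linarith) (by norm_num)]; linarith
    linarith
  have hs : (0 : ℝ) < sigma1 B := by exact_mod_cast sigma1_pos hB
  have : (sigma1 B : ℝ) < 2 * B := by
    have : (sigma1 B : ℝ) * (1 / 2) < B := by
      refine lt_of_lt_of_le ?_ h
      exact mul_lt_mul_of_pos_left (lt_of_lt_of_le hhalf hb) hs
    linarith
  exact_mod_cast this

lemma geom_le_one (r : ℝ) (hr : 0 ≤ r) (hr2 : r ≤ 1 / 2) (M : ℕ) :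
    ∑ a ∈ Finset.Icc 1 M, r ^ a ≤ 1 := by
  have : ∑ a ∈ Finset.Icc 1 M, r ^ a ≤ 1 - (1 / 2) ^ M := by
    induction M with
    | zero => simp
    | succ n ih =>
      rw [Finset.sum_Icc_succ_top (by omega)]
      have h1 : r ^ (n + 1) ≤ (1 / 2 : ℝ) ^ (n + 1) := by gcongr
      have h2 : (1 / 2 : ℝ) ^ n = 2 * (1 / 2) ^ (n + 1) := by rw [pow_succ]; ring
      linarith
  have h3 : (0 : ℝ) ≤ (1 / 2) ^ M := by positivity
  linarith

/-- Wirsing-type count. -/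
lemma rough_weighted (N X : ℕ) (hN : 2 * Nat.log 2 X + 2 ≤ N) (δ : ℝ)
    (hδN : ∀ p : ℕ, N ≤ p → 2 ≤ (p : ℝ) ^ δ) :
    ∀ M : ℕ, M ≤ X → ∀ β γ : ℕ, 1 ≤ β → 1 ≤ γ → ∀ s : Finset ℕ,
      (∀ B ∈ s, 1 ≤ B ∧ B ≤ M ∧ (∀ p : ℕ, p.Prime → p ∣ B → N ≤ p) ∧ β * sigma1 B = γ * B) →
      ∑ B ∈ s, ((B : ℝ) ^ δ)⁻¹ ≤ 1 := by
  intro M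
  induction M using Nat.strong_induction_on with
  | _ M ih =>
  intro hMX β γ hβ hγ s hs
  rcases s.eq_empty_or_nonempty with rfl | ⟨B0, hB0⟩
  · simp
  obtain ⟨g, β', γ', hg, hcop, rfl, rfl⟩ := Nat.exists_coprime' (m := β) (n := γ) (Nat.gcd_pos_of_pos_left _ hβ)
  have hs' : ∀ B ∈ s, β' * sigma1 B = γ' * B := by
    intro B hB
    have := (hs B hB).2.2.2
    apply Nat.eq_of_mul_eq_mul_right hg
    linarith
  have hdvd : ∀ B ∈ s, β' ∣ B := fun B hB =>
    hcop.dvd_of_dvd_mul_left (Dvd.intro _ (hs' B hB))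
  by_cases hb1 : β' = 1
  · have hone : ∀ B ∈ s, B = 1 := by
      intro B hB
      obtain ⟨h1, h2, h3, _⟩ := hs B hB
      have hlt := sigma1_rough_lt N X hN B h1 (h2.trans hMX) h3
      have he := hs' B hB
      rw [hb1, one_mul] at he
      by_contra hne
      have hgt := lt_sigma1 (n := B) (by omega)
      rw [he] at hlt hgt
      have h4 : γ' < 2 := lt_of_mul_lt_mul_right hlt (Nat.zero_le B)
      have h5 : 1 < γ' := by
        by_contra hh
        have : γ' * B ≤ 1 * B := Nat.mul_le_mul_right B (by omega)
        omega
      omega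
    have hsub : s ⊆ {1} := fun B hB => by simp [hone B hB]
    calc ∑ B ∈ s, ((B : ℝ) ^ δ)⁻¹ ≤ ∑ B ∈ ({1} : Finset ℕ), ((B : ℝ) ^ δ)⁻¹ :=
          Finset.sum_le_sum_of_subset_of_nonneg hsub (fun i _ _ => by positivity)
      _ = 1 := by simp
  · set p := β'.minFac with hpdef
    have hp : p.Prime := Nat.minFac_prime hb1
    have hpB : ∀ B ∈ s, p ∣ B := fun B hB => (Nat.minFac_dvd β').trans (hdvd B hB)
    have hNp : N ≤ p := (hs B0 hB0).2.2.1 p hp (hpB B0 hB0)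
    have hp2 := hδN p hNp
    have hmaps : ∀ B ∈ s, B.factorization p ∈ Finset.Icc 1 M := by
      intro B hB
      obtain ⟨h1, h2, _, _⟩ := hs B hB
      rw [Finset.mem_Icc]
      exact ⟨hp.factorization_pos_of_dvd (by omega) (hpB B hB),
        (Nat.factorization_lt p (by omega)).le.trans h2⟩
    rw [← Finset.sum_fiberwise_of_maps_to hmaps]
    calc ∑ a ∈ Finset.Icc 1 M, ∑ B ∈ s with B.factorization p = a, ((B : ℝ) ^ δ)⁻¹
        ≤ ∑ a ∈ Finset.Icc 1 M, (((p : ℝ) ^ δ)⁻¹) ^ a := by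
          apply Finset.sum_le_sum
          intro a ha
          rw [Finset.mem_Icc] at ha
          set t := s.filter (fun B => B.factorization p = a) with ht
          have hdec : ∀ B ∈ t, p ^ a * (B / p ^ a) = B := by
            intro B hB
            rw [ht, Finset.mem_filter] at hB
            have := Nat.ordProj_mul_ordCompl_eq_self B p
            rwa [hB.2] at this
          have hinj : Set.InjOn (fun B => B / p ^ a) (t : Set ℕ) := by
            intro B hB B' hB' he
            have e1 := hdec B hB
            have e2 := hdec B' hB'
            simp only at he
            rw [← e1, ← e2, he]
          have key := ih (M / 2) (by
              have := (hs B0 hB0); omega) (by omega) (β' * sigma1 (p ^ a)) (γ' * p ^ a)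
            (Nat.mul_pos (by
              rcases Nat.eq_zero_or_pos β' with h | h
              · simp [h] at hβ
              · exact h) (sigma1_pos (Nat.pos_of_ne_zero (pow_ne_zero _ hp.ne_zero))))
            (Nat.mul_pos (by
              rcases Nat.eq_zero_or_pos γ' with h | h
              · simp [h] at hγ
              · exact h) (Nat.pos_of_ne_zero (pow_ne_zero _ hp.ne_zero)))
            (t.image (fun B => B / p ^ a)) (by
              intro B' hB'
              rw [Finset.mem_image] at hB'
              obtain ⟨B, hBt, rfl⟩ := hB'
              have e1 := hdec B hBt
              rw [ht, Finset.mem_filter] at hBt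
              obtain ⟨hBs, hBa⟩ := hBt
              obtain ⟨h1, h2, h3, _⟩ := hs B hBs
              have hcp : (p ^ a).Coprime (B / p ^ a) := by
                have := Nat.coprime_ordCompl hp (n := B) (by omega)
                rw [hBa] at this
                exact this.pow_left a
              have hpa2 : 2 ≤ p ^ a := hp.two_le.trans (Nat.le_self_pow (by omega) p)
              refine ⟨?_, ?_, ?_, ?_⟩
              · rcases Nat.eq_zero_or_pos (B / p ^ a) with h | h
                · rw [h] at e1; omega
                · exact h
              · calc B / p ^ a ≤ B / 2 := Nat.div_le_div_left hpa2 (by norm_num)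
                  _ ≤ M / 2 := Nat.div_le_div_right h2
              · intro r hr hrd
                exact h3 r hr (e1 ▸ hrd.mul_left _)
              · have := hs' B hBs
                rw [← e1, sigma1_mul hcp] at this
                rw [mul_assoc, this, mul_assoc])
          rw [Finset.sum_image hinj] at key
          calc ∑ B ∈ t, ((B : ℝ) ^ δ)⁻¹
              = ∑ B ∈ t, (((p : ℝ) ^ δ)⁻¹) ^ a * ((((B / p ^ a : ℕ) : ℝ)) ^ δ)⁻¹ := by
                apply Finset.sum_congr rfl
                intro B hB
                conv_lhs => rw [← hdec B hB]
                push_cast [Nat.cast_mul]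
                rw [Real.mul_rpow (by positivity) (by positivity), mul_inv, inv_pow,
                  ← Real.rpow_natCast, ← Real.rpow_natCast, ← Real.rpow_mul (by positivity),
                  ← Real.rpow_mul (by positivity), mul_comm δ]
            _ = (((p : ℝ) ^ δ)⁻¹) ^ a * ∑ B ∈ t, ((((B / p ^ a : ℕ) : ℝ)) ^ δ)⁻¹ := by
                rw [Finset.mul_sum]
            _ ≤ (((p : ℝ) ^ δ)⁻¹) ^ a * 1 := by gcongr
            _ = _ := mul_one _
      _ ≤ 1 := by
          apply geom_le_one _ (by positivity)
          rw [one_div]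
          exact inv_anti₀ (by norm_num) hp2

lemma rough_count (N X : ℕ) (hN : 2 * Nat.log 2 X + 2 ≤ N) (δ : ℝ) (hδ : 0 < δ)
    (hδN : ∀ p : ℕ, N ≤ p → 2 ≤ (p : ℝ) ^ δ) (β γ : ℕ) (hβ : 1 ≤ β) (hγ : 1 ≤ γ) (s : Finset ℕ)
    (hs : ∀ B ∈ s, 1 ≤ B ∧ B ≤ X ∧ (∀ p : ℕ, p.Prime → p ∣ B → N ≤ p) ∧ β * sigma1 B = γ * B) :
    (s.card : ℝ) ≤ (X : ℝ) ^ δ := by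
  have h := rough_weighted N X hN δ hδN X le_rfl β γ hβ hγ s hs
  calc (s.card : ℝ) = ∑ B ∈ s, (1 : ℝ) := by simp
    _ ≤ ∑ B ∈ s, (X : ℝ) ^ δ * ((B : ℝ) ^ δ)⁻¹ := by
        apply Finset.sum_le_sum
        intro B hB
        obtain ⟨h1, h2, _⟩ := hs B hB
        have hB1 : (0 : ℝ) < B := by exact_mod_cast h1
        rw [← div_eq_mul_inv, le_div_iff₀ (by positivity), one_mul]
        have : (B : ℝ) ≤ X := by exact_mod_cast h2
        gcongr
    _ = (X : ℝ) ^ δ * ∑ B ∈ s, ((B : ℝ) ^ δ)⁻¹ := by rw [Finset.mul_sum]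
    _ ≤ (X : ℝ) ^ δ * 1 := by gcongr
    _ = _ := mul_one _

lemma smooth_rough_decomp (N n : ℕ) (hn : 1 ≤ n) :
    ∃ A B : ℕ, n = A * B ∧ A.Coprime B ∧ A ∈ N.smoothNumbers ∧
      (∀ p : ℕ, p.Prime → p ∣ B → N ≤ p) := by
  induction n using Nat.recOnPosPrimePosCoprime with
  | prime_pow p a hp ha =>
    by_cases h : p < N
    · refine ⟨p ^ a, 1, by simp, by simp, ?_, ?_⟩
      · rw [Nat.mem_smoothNumbers']
        intro q hq hqp
        rwa [(Nat.prime_dvd_prime_iff_eq hq hp).mp (hq.dvd_of_dvd_pow hqp)]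
      · intro q hq hq1
        exact absurd (Nat.dvd_one.mp hq1) hq.ne_one
    · refine ⟨1, p ^ a, by simp, by simp, ?_, ?_⟩
      · rw [Nat.mem_smoothNumbers']
        intro q hq hq1
        exact absurd (Nat.dvd_one.mp hq1) hq.ne_one
      · intro q hq hqp
        rw [(Nat.prime_dvd_prime_iff_eq hq hp).mp (hq.dvd_of_dvd_pow hqp)]
        omega
  | zero => omega
  | one =>
    refine ⟨1, 1, by simp, by simp, ?_, ?_⟩
    · rw [Nat.mem_smoothNumbers']
      intro q hq hq1
      exact absurd (Nat.dvd_one.mp hq1) hq.ne_one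
    · intro q hq hq1
      exact absurd (Nat.dvd_one.mp hq1) hq.ne_one
  | coprime a b ha hb hab iha ihb =>
    obtain ⟨A, B, h1, h2, h3, h4⟩ := iha (by omega)
    obtain ⟨A', B', h1', h2', h3', h4'⟩ := ihb (by omega)
    refine ⟨A * A', B * B', ?_, ?_, Nat.mul_mem_smoothNumbers h3 h3', ?_⟩
    · rw [h1, h1']; ring
    · subst h1 h1'
      apply Nat.Coprime.mul_right
      · apply Nat.Coprime.mul_left h2
        exact (hab.coprime_mul_left.coprime_mul_right_right).symm
      · apply Nat.Coprime.mul_left _ h2'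
        exact hab.coprime_mul_right.coprime_mul_left_right
    · intro p hp hpd
      rcases hp.dvd_mul.mp hpd with h | h
      · exact h4 p hp h
      · exact h4' p hp h

lemma zero_case (ε : ℝ) (hε : 0 < ε) :
    ∃ C : ℝ, 1 ≤ C ∧ ∀ b : ℕ, 1 ≤ b → ∀ x : ℝ, 1 ≤ x → ∀ s : Finset ℕ,
      (∀ n ∈ s, 1 ≤ n ∧ (n : ℝ) ≤ x ∧ n ∣ b * sigma1 n) →
      (s.card : ℝ) ≤ C * b * x ^ ((2 : ℝ) / 3 + ε) := by
  set δ : ℝ := ε / 3 with hδdef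
  have hδ : 0 < δ := by positivity
  obtain ⟨C1, hC1, hdiv⟩ := divisor_bound δ hδ
  obtain ⟨C2, hC2, hsm⟩ := smooth_bound (δ / 4) (by positivity)
  obtain ⟨P, hP⟩ := exists_nat_ge ((2 : ℝ) ^ (1 / δ))
  refine ⟨C1 * (C2 * Real.exp (δ / 4 * ((2 + P : ℕ) : ℝ))), ?_, ?_⟩
  · have : 1 ≤ Real.exp (δ / 4 * ((2 + P : ℕ) : ℝ)) := Real.one_le_exp (by positivity)
    exact one_le_mul_of_one_le_of_one_le hC1 (one_le_mul_of_one_le_of_one_le hC2 this)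
  intro b hb x hx s hs
  have hx0 : 0 < x := by linarith
  set X := ⌊x⌋₊ with hX
  have hX1 : 1 ≤ X := Nat.one_le_floor_iff x |>.mpr hx
  have hXx : (X : ℝ) ≤ x := Nat.floor_le hx0.le
  set N := 2 * Nat.log 2 X + (2 + P) with hN
  set Q : ℕ := ⌊(b : ℝ) * (C1 * x ^ δ)⌋₊ with hQ
  have hδN : ∀ p : ℕ, N ≤ p → 2 ≤ (p : ℝ) ^ δ := by
    intro p hp
    have hpP : (2 : ℝ) ^ (1 / δ) ≤ p := hP.trans (by exact_mod_cast (by omega : P ≤ p))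
    calc (2 : ℝ) = ((2 : ℝ) ^ (1 / δ)) ^ δ := by
          rw [← Real.rpow_mul (by norm_num)]; field_simp; simp
      _ ≤ _ := by gcongr
  classical
  set SA := (Finset.Icc 1 X).filter (fun a => a ∈ N.smoothNumbers) with hSA
  let F : ℕ → ℕ → Finset ℕ := fun q A => (Finset.Icc 1 X).filter (fun B =>
    (∀ p : ℕ, p.Prime → p ∣ B → N ≤ p) ∧ (b * sigma1 A) * sigma1 B = (q * A) * B)
  have hcover : s ⊆ (Finset.Icc 1 Q ×ˢ SA).biUnion
      (fun qa => (F qa.1 qa.2).image (fun B => qa.2 * B)) := by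
    intro n hn
    obtain ⟨h1, h2, q, hq⟩ := hs n hn
    obtain ⟨A, B, hAB, hcop, hA, hB⟩ := smooth_rough_decomp N n h1
    have hnX : n ≤ X := Nat.le_floor h2
    have hApos : 1 ≤ A := by
      rcases Nat.eq_zero_or_pos A with h | h
      · rw [h] at hAB; omega
      · exact h
    have hBpos : 1 ≤ B := by
      rcases Nat.eq_zero_or_pos B with h | h
      · rw [h] at hAB; omega
      · exact h
    have hAn : A ≤ n := Nat.le_of_dvd h1 ⟨B, hAB⟩
    have hBn : B ≤ n := Nat.le_of_dvd h1 ⟨A, by rw [hAB, mul_comm]⟩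
    have hq1 : 1 ≤ q := by
      rcases Nat.eq_zero_or_pos q with h | h
      · rw [h] at hq
        have : 0 < b * sigma1 n := Nat.mul_pos hb (sigma1_pos h1)
        omega
      · exact h
    have hqQ : q ≤ Q := by
      apply Nat.le_floor
      have hn0 : (0 : ℝ) < n := by exact_mod_cast h1
      have e1 : (n : ℝ) * q ≤ n * (b * (C1 * x ^ δ)) := by
        calc (n : ℝ) * q = b * sigma1 n := by exact_mod_cast hq.symm
          _ ≤ b * (n * (n.divisors.card : ℝ)) := by
              gcongr; exact_mod_cast sigma1_le n
          _ ≤ b * (n * (C1 * (n : ℝ) ^ δ)) := by gcongr; exact hdiv n h1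
          _ ≤ b * (n * (C1 * x ^ δ)) := by gcongr
          _ = _ := by ring
      exact le_of_mul_le_mul_left e1 hn0
    rw [Finset.mem_biUnion]
    refine ⟨(q, A), ?_, ?_⟩
    · simp only [Finset.mem_product, Finset.mem_Icc, hSA, Finset.mem_filter]
      exact ⟨⟨hq1, hqQ⟩, ⟨hApos, by omega⟩, hA⟩
    · rw [Finset.mem_image]
      refine ⟨B, ?_, hAB.symm⟩
      simp only [F, Finset.mem_filter, Finset.mem_Icc]
      refine ⟨⟨hBpos, by omega⟩, hB, ?_⟩
      rw [hAB, sigma1_mul hcop] at hq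
      linarith
  have hF : ∀ qa ∈ Finset.Icc 1 Q ×ˢ SA,
      (((F qa.1 qa.2).image (fun B => qa.2 * B)).card : ℝ) ≤ x ^ δ := by
    intro qa hqa
    simp only [Finset.mem_product, Finset.mem_Icc, hSA, Finset.mem_filter] at hqa
    calc (((F qa.1 qa.2).image (fun B => qa.2 * B)).card : ℝ) ≤ (F qa.1 qa.2).card := by
          exact_mod_cast Finset.card_image_le
      _ ≤ (X : ℝ) ^ δ := by
          apply rough_count N X (by omega) δ hδ hδN (b * sigma1 qa.2) (qa.1 * qa.2)
            (Nat.mul_pos hb (sigma1_pos hqa.2.1.1)) (Nat.mul_pos hqa.1.1 hqa.2.1.1)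
          intro B hB
          simp only [F, Finset.mem_filter, Finset.mem_Icc] at hB
          exact ⟨hB.1.1, hB.1.2, hB.2.1, hB.2.2⟩
      _ ≤ x ^ δ := by gcongr
  have hSAcard : (SA.card : ℝ) ≤ C2 * Real.exp (δ / 4 * N) * x ^ ((2 : ℝ) / 3) := by
    apply hsm N x hx0.le SA
    intro a ha
    simp only [hSA, Finset.mem_filter, Finset.mem_Icc] at ha
    exact ⟨ha.2, le_trans (by exact_mod_cast ha.1.2) hXx⟩
  have hexp : Real.exp (δ / 4 * N) ≤ Real.exp (δ / 4 * ((2 + P : ℕ) : ℝ)) * x ^ δ := by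
    rw [Real.rpow_def_of_pos hx0, ← Real.exp_add]
    apply Real.exp_le_exp.mpr
    have hlog : (Nat.log 2 X : ℝ) ≤ 2 * Real.log x := by
      have h1 : (2 : ℝ) ^ (Nat.log 2 X) ≤ x :=
        le_trans (by exact_mod_cast Nat.pow_log_le_self 2 (by omega)) hXx
      have h2 := Real.log_le_log (by positivity) h1
      rw [Real.log_pow] at h2
      have h3 := Real.log_two_gt_d9
      have h4 : (0 : ℝ) ≤ Nat.log 2 X := by positivity
      nlinarith
    rw [hN]
    push_cast
    nlinarith
  calc (s.card : ℝ) ≤ (((Finset.Icc 1 Q ×ˢ SA).biUnion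
      (fun qa => (F qa.1 qa.2).image (fun B => qa.2 * B))).card : ℝ) := by
        exact_mod_cast Finset.card_le_card hcover
    _ ≤ ∑ qa ∈ Finset.Icc 1 Q ×ˢ SA, (((F qa.1 qa.2).image (fun B => qa.2 * B)).card : ℝ) := by
        exact_mod_cast Finset.card_biUnion_le
    _ ≤ ∑ qa ∈ Finset.Icc 1 Q ×ˢ SA, x ^ δ := Finset.sum_le_sum hF
    _ = (Q : ℝ) * SA.card * x ^ δ := by
        rw [Finset.sum_const, Finset.card_product, Nat.card_Icc]; simp
    _ ≤ ((b : ℝ) * (C1 * x ^ δ)) * (C2 * (Real.exp (δ / 4 * ((2 + P : ℕ) : ℝ)) * x ^ δ) * x ^ ((2 : ℝ) / 3)) * x ^ δ := by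
        gcongr
        · exact Nat.floor_le (by positivity)
        · refine hSAcard.trans ?_
          gcongr
    _ = C1 * (C2 * Real.exp (δ / 4 * ((2 + P : ℕ) : ℝ))) * b * (x ^ δ * x ^ δ * x ^ δ * x ^ ((2 : ℝ) / 3)) := by ring
    _ = _ := by
        rw [← Real.rpow_add hx0, ← Real.rpow_add hx0, ← Real.rpow_add hx0]
        congr 2
        rw [hδdef]; ring

lemma inv_sq_sum (J : ℝ) (hJ : 0 < J) (s : Finset ℕ) (hs : ∀ j ∈ s, J < (j : ℝ)) :
    ∑ j ∈ s, ((j : ℝ) ^ 2)⁻¹ ≤ 2 / J := by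
  have hsub : s ⊆ Finset.Ioo ⌊J⌋₊ (s.sup id + 1) := by
    intro j hj
    rw [Finset.mem_Ioo]
    refine ⟨(Nat.floor_lt hJ.le).mpr (hs j hj), ?_⟩
    have : id j ≤ s.sup id := Finset.le_sup hj
    simp at this
    omega
  calc ∑ j ∈ s, ((j : ℝ) ^ 2)⁻¹ ≤ ∑ j ∈ Finset.Ioo ⌊J⌋₊ (s.sup id + 1), ((j : ℝ) ^ 2)⁻¹ :=
        Finset.sum_le_sum_of_subset_of_nonneg hsub (fun i _ _ => by positivity)
    _ ≤ 2 / ((⌊J⌋₊ : ℝ) + 1) := sum_Ioo_inv_sq_le _ _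
    _ ≤ 2 / J := by
        gcongr
        exact (Nat.lt_floor_add_one J).le

lemma gcd_sum (z : ℝ) (hz : 0 < z) (D K : Finset ℕ) (G : ℕ → ℕ)
    (h : ∀ d ∈ D, z < (d : ℝ) ∧ G d ∣ d ∧ G d ∈ K) :
    ∑ d ∈ D, (G d : ℝ) * ((d : ℝ) ^ 2)⁻¹ ≤ K.card * (2 / z) := by
  rw [← Finset.sum_fiberwise_of_maps_to (fun d hd => (h d hd).2.2)]
  rw [← nsmul_eq_mul]
  apply Finset.sum_le_card_nsmul
  intro g hg
  set t := D.filter (fun d => G d = g) with ht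
  rcases Nat.eq_zero_or_pos g with hg0 | hg0
  · have : ∑ d ∈ t, (G d : ℝ) * ((d : ℝ) ^ 2)⁻¹ = 0 := by
      apply Finset.sum_eq_zero
      intro d hd
      rw [ht, Finset.mem_filter] at hd
      rw [hd.2, hg0]; simp
    rw [this]; positivity
  have hgr : (0 : ℝ) < g := by exact_mod_cast hg0
  have hdec : ∀ d ∈ t, g * (d / g) = d := by
    intro d hd
    rw [ht, Finset.mem_filter] at hd
    exact Nat.mul_div_cancel' (hd.2 ▸ (h d hd.1).2.1)
  have hinj : Set.InjOn (fun d => d / g) (t : Set ℕ) := by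
    intro d hd d' hd' he
    simp only at he
    rw [← hdec d hd, ← hdec d' hd', he]
  have hsum := inv_sq_sum (z / g) (by positivity) (t.image (fun d => d / g)) (by
    intro j hj
    rw [Finset.mem_image] at hj
    obtain ⟨d, hd, rfl⟩ := hj
    have e := hdec d hd
    rw [ht, Finset.mem_filter] at hd
    have hzd := (h d hd.1).1
    rw [div_lt_iff₀ hgr]
    rw [← e] at hzd
    push_cast at hzd
    linarith)
  rw [Finset.sum_image hinj] at hsum
  calc ∑ d ∈ t, (G d : ℝ) * ((d : ℝ) ^ 2)⁻¹
      = ∑ d ∈ t, (g : ℝ)⁻¹ * (((d / g : ℕ) : ℝ) ^ 2)⁻¹ := by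
        apply Finset.sum_congr rfl
        intro d hd
        have e := hdec d hd
        rw [ht, Finset.mem_filter] at hd
        rw [hd.2]
        conv_lhs => rw [← e]
        push_cast [Nat.cast_mul]
        rw [mul_pow, mul_inv, ← mul_assoc]
        congr 1
        field_simp
    _ = (g : ℝ)⁻¹ * ∑ d ∈ t, (((d / g : ℕ) : ℝ) ^ 2)⁻¹ := by rw [Finset.mul_sum]
    _ ≤ (g : ℝ)⁻¹ * (2 / (z / g)) := by gcongr
    _ = 2 / z := by field_simp

lemma ap_count (r M : ℕ) (hr : 1 ≤ r) (s : Finset ℕ) (hM : ∀ e ∈ s, e ≤ M)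
    (hs : ∀ e ∈ s, ∀ e' ∈ s, (r : ℤ) ∣ (e : ℤ) - e') : s.card ≤ M / r + 1 := by
  calc s.card ≤ (Finset.range (M / r + 1)).card := by
        apply Finset.card_le_card_of_injOn (fun e => e / r)
        · intro e he
          simp only [Finset.coe_range, Set.mem_Iio]
          exact Nat.lt_succ_of_le (Nat.div_le_div_right (hM e he))
        · intro e he e' he' h
          simp only at h
          have h1 := hs e he e' he'
          have h2 : e % r = e' % r := by
            have : (e' : ℤ) ≡ e [ZMOD r] := Int.modEq_iff_dvd.mpr h1
            exact ((Int.natCast_modEq_iff).mp this).symm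
          rw [← Nat.div_add_mod e r, ← Nat.div_add_mod e' r, h, h2]
    _ = _ := by simp

lemma card_multiples_le (X d : ℕ) (hd : 1 ≤ d) :
    (((Finset.Icc 1 X).filter (fun n => d ∣ n)).card : ℝ) ≤ X / d := by
  have : (Finset.Icc 1 X) = Finset.Ioc 0 X := rfl
  rw [this, Nat.Ioc_filter_dvd_card_eq_div]
  exact Nat.cast_div_le

lemma exists_unitary (n : ℕ) (hn : 1 ≤ n) (z : ℝ) (hz : 1 ≤ z) (hzn : z ^ 2 < n)
    (hpp : ∀ p : ℕ, p.Prime → p ∣ n → ((p ^ n.factorization p : ℕ) : ℝ) ≤ z ^ 2) :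
    ∃ d e : ℕ, n = d * e ∧ d.Coprime e ∧ z < d ∧ (d : ℝ) ≤ z ^ 2 := by
  classical
  have hex : ∃ d : ℕ, z < (d : ℝ) ∧ ∃ e, n = d * e ∧ d.Coprime e :=
    ⟨n, by nlinarith, 1, by simp, by simp⟩
  set d := Nat.find hex with hd
  obtain ⟨hzd, e, hne, hcop⟩ := Nat.find_spec hex
  rw [← hd] at hzd hne hcop
  by_cases hle : (d : ℝ) ≤ z ^ 2
  · exact ⟨d, e, hne, hcop, hzd, hle⟩
  push Not at hle
  have hd1 : d ≠ 1 := by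
    intro h; rw [h] at hzd; norm_num at hzd; linarith
  have hd0 : d ≠ 0 := by
    intro h; rw [h] at hzd; norm_num at hzd; linarith
  have hp : d.minFac.Prime := Nat.minFac_prime hd1
  set p := d.minFac with hpdef
  have hpd : p ∣ d := Nat.minFac_dvd d
  have hpn : p ∣ n := hne ▸ hpd.mul_right e
  have hn0 : n ≠ 0 := by omega
  set P := p ^ n.factorization p with hP
  have hPm : P * (n / P) = n := Nat.ordProj_mul_ordCompl_eq_self n p
  have hPcop : P.Coprime (n / P) := (Nat.coprime_ordCompl hp hn0).pow_left _
  have hP2 : 2 ≤ P := hp.two_le.trans (Nat.le_self_pow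
    (by have := hp.factorization_pos_of_dvd hn0 hpn; omega) p)
  have hpe : p.Coprime e := Nat.Coprime.coprime_dvd_left hpd hcop
  have hPd : P ∣ d := by
    have h1 : P ∣ d * e := hne ▸ Nat.ordProj_dvd n p
    exact Nat.Coprime.dvd_of_dvd_mul_right (hpe.pow_left _) h1
  obtain ⟨d', hd'⟩ := hPd
  have hd'lt : d' < d := by
    rw [hd']
    have : 0 < d' := by
      rcases Nat.eq_zero_or_pos d' with h | h
      · rw [h] at hd'; omega
      · exact h
    nlinarith
  have hnP : n / P = d' * e := by
    apply Nat.eq_of_mul_eq_mul_left (show 0 < P by omega)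
    rw [hPm, hne]; conv_lhs => rw [hd']
    ring
  have hd'z : (d' : ℝ) ≤ z := by
    by_contra hcon
    push Not at hcon
    refine Nat.find_min hex (by rw [← hd]; exact hd'lt) ⟨hcon, P * e, ?_, ?_⟩
    · rw [← hPm, hnP]; ring
    · apply Nat.Coprime.mul_right
      · rw [hnP] at hPcop
        exact hPcop.coprime_mul_right_right.symm
      · exact Nat.Coprime.coprime_dvd_left ⟨P, by rw [hd']; ring⟩ hcop
  have hPz : (P : ℝ) ≤ z ^ 2 := hpp p hp hpn
  refine ⟨P, n / P, hPm.symm, hPcop, ?_, hPz⟩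
  have e1 : (d : ℝ) = P * d' := by exact_mod_cast hd'
  have hP0 : (0 : ℝ) < P := by exact_mod_cast (by omega : 0 < P)
  nlinarith

/-- numbers divisible by the square of a large number -/
lemma count_sq (x z : ℝ) (hz : 1 ≤ z) (hx : x = z ^ 3) (s : Finset ℕ)
    (hs : ∀ n ∈ s, 1 ≤ n ∧ (n : ℝ) ≤ x ∧ ∃ p : ℕ, z < p ∧ p ^ 2 ∣ n) :
    (s.card : ℝ) ≤ 2 * z ^ 2 := by
  classical
  have hx0 : 0 < x := by rw [hx]; positivity
  set X := ⌊x⌋₊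
  have hXx : (X : ℝ) ≤ x := Nat.floor_le hx0.le
  set I := (Finset.Icc 1 X).filter (fun p : ℕ => z < (p : ℝ))
  have hcover : s ⊆ I.biUnion (fun p => (Finset.Icc 1 X).filter (fun n => p ^ 2 ∣ n)) := by
    intro n hn
    obtain ⟨h1, h2, p, hp, hpn⟩ := hs n hn
    have hnX : n ≤ X := Nat.le_floor h2
    have hp1 : 1 ≤ p := by
      have : (1 : ℝ) < p := by linarith
      exact_mod_cast this.le
    have hpn' : p ≤ n := (Nat.le_self_pow (by norm_num) p).trans (Nat.le_of_dvd h1 hpn)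
    simp only [I, Finset.mem_biUnion, Finset.mem_filter, Finset.mem_Icc]
    exact ⟨p, ⟨⟨hp1, by omega⟩, hp⟩, ⟨h1, hnX⟩, hpn⟩
  calc (s.card : ℝ) ≤ ((I.biUnion (fun p => (Finset.Icc 1 X).filter (fun n => p ^ 2 ∣ n))).card : ℝ) := by
        exact_mod_cast Finset.card_le_card hcover
    _ ≤ ∑ p ∈ I, (((Finset.Icc 1 X).filter (fun n => p ^ 2 ∣ n)).card : ℝ) := by
        exact_mod_cast Finset.card_biUnion_le
    _ ≤ ∑ p ∈ I, x * ((p : ℝ) ^ 2)⁻¹ := by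
        apply Finset.sum_le_sum
        intro p hp
        simp only [I, Finset.mem_filter, Finset.mem_Icc] at hp
        refine (card_multiples_le X (p ^ 2) (Nat.one_le_pow _ _ hp.1.1)).trans ?_
        rw [← div_eq_mul_inv]
        push_cast
        gcongr
    _ = x * ∑ p ∈ I, ((p : ℝ) ^ 2)⁻¹ := by rw [Finset.mul_sum]
    _ ≤ x * (2 / z) := by
        gcongr
        apply inv_sq_sum z (by linarith)
        intro p hp
        simp only [I, Finset.mem_filter] at hp
        exact hp.2
    _ = 2 * z ^ 2 := by rw [hx]; field_simp

lemma count_pp (x z : ℝ) (hz : 1 ≤ z) (hx : x = z ^ 3) (s : Finset ℕ)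
    (hs : ∀ n ∈ s, 1 ≤ n ∧ (n : ℝ) ≤ x ∧
      ∃ p a : ℕ, 2 ≤ p ∧ (p : ℝ) ≤ z ∧ p ^ a ∣ n ∧ z ^ 2 < ((p ^ a : ℕ) : ℝ)) :
    (s.card : ℝ) ≤ z ^ 2 := by
  classical
  have hx0 : 0 < x := by rw [hx]; positivity
  set X := ⌊x⌋₊
  have hXx : (X : ℝ) ≤ x := Nat.floor_le hx0.le
  set f : ℕ → ℕ := fun p => p ^ (Nat.log p ⌊z ^ 2⌋₊ + 1) with hf
  set I := (Finset.Icc 1 ⌊z⌋₊).filter (fun p : ℕ => 2 ≤ p)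
  have hcover : s ⊆ I.biUnion (fun p => (Finset.Icc 1 X).filter (fun n => f p ∣ n)) := by
    intro n hn
    obtain ⟨h1, h2, p, a, hp2, hpz, hpn, hlt⟩ := hs n hn
    have hnX : n ≤ X := Nat.le_floor h2
    simp only [I, Finset.mem_biUnion, Finset.mem_filter, Finset.mem_Icc]
    refine ⟨p, ⟨⟨by omega, Nat.le_floor hpz⟩, hp2⟩, ⟨h1, hnX⟩, ?_⟩
    refine dvd_trans (pow_dvd_pow p ?_) hpn
    have h3 : ⌊z ^ 2⌋₊ < p ^ a := (Nat.floor_lt (by positivity)).mpr hlt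
    exact Nat.log_lt_of_lt_pow (by
      have : 1 ≤ ⌊z ^ 2⌋₊ := (Nat.one_le_floor_iff _).mpr (one_le_pow₀ hz)
      omega) h3
  calc (s.card : ℝ) ≤ ((I.biUnion (fun p => (Finset.Icc 1 X).filter (fun n => f p ∣ n))).card : ℝ) := by
        exact_mod_cast Finset.card_le_card hcover
    _ ≤ ∑ p ∈ I, (((Finset.Icc 1 X).filter (fun n => f p ∣ n)).card : ℝ) := by
        exact_mod_cast Finset.card_biUnion_le
    _ ≤ ∑ p ∈ I, z := by
        apply Finset.sum_le_sum
        intro p hp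
        simp only [I, Finset.mem_filter, Finset.mem_Icc] at hp
        have hfz : z ^ 2 < (f p : ℝ) :=
          (Nat.floor_lt (by positivity)).mp (Nat.lt_pow_succ_log_self (by omega) _)
        have hf0 : 0 < f p := Nat.pow_pos (by omega)
        refine (card_multiples_le X (f p) hf0).trans ?_
        rw [div_le_iff₀ (by exact_mod_cast hf0)]
        calc (X : ℝ) ≤ z * z ^ 2 := by rw [hx] at hXx; linarith
          _ ≤ _ := by gcongr
    _ = I.card * z := by simp
    _ ≤ z * z := by
        gcongr
        calc (I.card : ℝ) ≤ ((Finset.Icc 1 ⌊z⌋₊).card : ℝ) := by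
              exact_mod_cast Finset.card_le_card (Finset.filter_subset _ _)
          _ = ⌊z⌋₊ := by simp
          _ ≤ z := Nat.floor_le (by linarith)
    _ = z ^ 2 := by ring

lemma count_prime (b : ℕ) (k : ℤ) (x z T : ℝ) (hz : 1 ≤ z) (hx : x = z ^ 3)
    (hbx : (b : ℝ) ≤ x) (hk : (|k| : ℝ) < b * z ^ 2)
    (hT : ∀ m : ℕ, 1 ≤ m → (m : ℝ) ≤ 2 * x ^ 3 → (m.divisors.card : ℝ) ≤ T) (hT1 : 1 ≤ T)
    (s : Finset ℕ)
    (hs : ∀ n ∈ s, 1 ≤ n ∧ (n : ℝ) ≤ x ∧ IsSporadicSolution b k n ∧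
      ∃ p : ℕ, p.Prime ∧ z < p ∧ p ∣ n ∧ ¬ p ^ 2 ∣ n) :
    (s.card : ℝ) ≤ z ^ 2 * T := by
  classical
  have hx0 : 0 < x := by rw [hx]; positivity
  have hx1 : 1 ≤ x := by rw [hx]; exact one_le_pow₀ hz
  have hzx : z ^ 2 ≤ x := by rw [hx]; exact pow_le_pow_right₀ hz (by norm_num)
  set Y := ⌊z ^ 2⌋₊
  have hYz : (Y : ℝ) ≤ z ^ 2 := Nat.floor_le (by positivity)
  let F : ℕ → Finset ℕ := fun m => ((b : ℤ) * (sigma1 m : ℤ) - k).natAbs.divisors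
  have hcover : s ⊆ (Finset.Icc 1 Y).biUnion (fun m => (F m).image (fun p => p * m)) := by
    intro n hn
    obtain ⟨h1, h2, ⟨hsol, hnreg⟩, p, hp, hzp, ⟨m, hm⟩, hp2⟩ := hs n hn
    have hpm : ¬ p ∣ m := by
      rintro ⟨j, rfl⟩
      exact hp2 ⟨j, by rw [hm]; ring⟩
    have hm1 : 1 ≤ m := by
      rcases Nat.eq_zero_or_pos m with h | h
      · rw [h] at hm; omega
      · exact h
    have hmY : m ≤ Y := by
      apply Nat.le_floor
      have e1 : (p : ℝ) * m ≤ z * z ^ 2 := by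
        have : ((p * m : ℕ) : ℝ) ≤ x := hm ▸ h2
        push_cast at this
        rw [hx] at this; linarith
      have hm0 : (0 : ℝ) < m := by exact_mod_cast hm1
      have e2 : z * m ≤ z * z ^ 2 := le_trans (by gcongr) e1
      exact le_of_mul_le_mul_left e2 (by linarith)
    have hcop : p.Coprime m := (Nat.Prime.coprime_iff_not_dvd hp).mpr hpm
    have hsp : sigma1 p = p + 1 := by
      have := ArithmeticFunction.sigma_one_apply_prime_pow (p := p) (i := 1) hp
      rw [pow_one] at this
      rw [sigma1, this]
      simp [Finset.sum_range_succ]; ring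
    rw [IsCongSolution, hm, sigma1_mul hcop, hsp] at hsol
    push_cast at hsol
    have hpd : (p : ℤ) ∣ (b : ℤ) * (sigma1 m : ℤ) - k := by
      have h3 : (p : ℤ) ∣ (b : ℤ) * (((p : ℤ) + 1) * sigma1 m) - k := (Dvd.intro _ rfl).trans hsol
      have h4 : (b : ℤ) * (sigma1 m : ℤ) - k =
          ((b : ℤ) * (((p : ℤ) + 1) * sigma1 m) - k) - p * (b * sigma1 m) := by ring
      rw [h4]
      exact dvd_sub h3 (Dvd.intro _ rfl)
    have hne : (b : ℤ) * (sigma1 m : ℤ) - k ≠ 0 := by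
      intro h0
      have hk' : (b : ℤ) * (sigma1 m : ℤ) = k := by linarith
      apply hnreg
      refine ⟨⟨_, hk'.symm⟩, p, m, hp, hm, hpm, ?_, hk'⟩
      have h3 : (m : ℤ) ∣ (b : ℤ) * (((p : ℤ) + 1) * sigma1 m) - k := (Dvd.intro_left _ rfl).trans hsol
      have h4 : (b : ℤ) * (((p : ℤ) + 1) * sigma1 m) - k = ((p * (b * sigma1 m) : ℕ) : ℤ) := by
        push_cast; rw [← hk']; ring
      rw [h4] at h3
      have h5 : m ∣ p * (b * sigma1 m) := by exact_mod_cast h3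
      exact hcop.symm.dvd_of_dvd_mul_left h5
    simp only [Finset.mem_biUnion, Finset.mem_Icc, Finset.mem_image, F, Nat.mem_divisors]
    refine ⟨m, ⟨hm1, hmY⟩, p, ⟨?_, ?_⟩, hm.symm⟩
    · exact Int.natCast_dvd.mp hpd
    · exact Int.natAbs_ne_zero.mpr hne
  calc (s.card : ℝ) ≤ (((Finset.Icc 1 Y).biUnion (fun m => (F m).image (fun p => p * m))).card : ℝ) := by
        exact_mod_cast Finset.card_le_card hcover
    _ ≤ ∑ m ∈ Finset.Icc 1 Y, (((F m).image (fun p => p * m)).card : ℝ) := by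
        exact_mod_cast Finset.card_biUnion_le
    _ ≤ ∑ m ∈ Finset.Icc 1 Y, T := by
        apply Finset.sum_le_sum
        intro m hm
        rw [Finset.mem_Icc] at hm
        refine le_trans (by exact_mod_cast Finset.card_image_le) (?_ : ((F m).card : ℝ) ≤ T)
        by_cases h0 : ((b : ℤ) * (sigma1 m : ℤ) - k).natAbs = 0
        · simp only [F, h0]; simp; linarith
        · apply hT _ (Nat.one_le_iff_ne_zero.mpr h0)
          have hmx : (m : ℝ) ≤ x := le_trans (by exact_mod_cast hm.2) (hYz.trans hzx)
          have hsx : (sigma1 m : ℝ) ≤ x ^ 2 := by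
            calc (sigma1 m : ℝ) ≤ (m : ℝ) ^ 2 := by
                  exact_mod_cast ArithmeticFunction.sigma_le_pow_succ 1 m
              _ ≤ x ^ 2 := by gcongr
          rw [Nat.cast_natAbs]
          push_cast
          calc |(b : ℝ) * (sigma1 m : ℝ) - k| ≤ |(b : ℝ) * (sigma1 m : ℝ)| + |(k : ℝ)| := abs_sub _ _
            _ = (b : ℝ) * (sigma1 m : ℝ) + |(k : ℝ)| := by rw [abs_of_nonneg (by positivity)]
            _ ≤ x * x ^ 2 + x * x ^ 2 := by
                gcongr
                refine hk.le.trans ?_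
                calc (b : ℝ) * z ^ 2 ≤ x * x := by gcongr
                  _ ≤ x * x ^ 2 := by gcongr; nlinarith
            _ = 2 * x ^ 3 := by ring
    _ = Y * T := by simp
    _ ≤ z ^ 2 * T := by gcongr

lemma count_e (d q M : ℕ) (k : ℤ) (hd : 1 ≤ d) (hq : 1 ≤ q) (s : Finset ℕ)
    (hs : ∀ e ∈ s, e ≤ M ∧ (sigma1 d : ℤ) ∣ (d : ℤ) * q * e + k) :
    (s.card : ℝ) ≤ M * (q * Nat.gcd d (sigma1 d)) / d + 1 := by
  have hσ : 0 < sigma1 d := sigma1_pos hd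
  set h := Nat.gcd (d * q) (sigma1 d) with hh
  have hh0 : 0 < h := Nat.gcd_pos_of_pos_right _ hσ
  set r := sigma1 d / h with hr
  have hrh : r * h = sigma1 d := Nat.div_mul_cancel (Nat.gcd_dvd_right _ _)
  set c := d * q / h with hc
  have hch : c * h = d * q := Nat.div_mul_cancel (Nat.gcd_dvd_left _ _)
  have hr1 : 1 ≤ r := by
    rcases Nat.eq_zero_or_pos r with h | h
    · rw [h] at hrh; omega
    · exact h
  have hcr : c.Coprime r := Nat.coprime_div_gcd_div_gcd hh0
  have hcard := ap_count r M hr1 s (fun e he => (hs e he).1) (by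
    intro e he e' he'
    have h1 := dvd_sub (hs e he).2 (hs e' he').2
    have h2 : (d : ℤ) * q * e + k - ((d : ℤ) * q * e' + k) = (h : ℤ) * (c * ((e : ℤ) - e')) := by
      have : (d : ℤ) * q = c * h := by exact_mod_cast hch.symm
      rw [this]; ring
    rw [h2, ← hrh] at h1
    push_cast at h1
    rw [mul_comm (r : ℤ) h] at h1
    have h3 := Int.dvd_of_mul_dvd_mul_left (by exact_mod_cast hh0.ne') h1
    have hco : IsCoprime (r : ℤ) (c : ℤ) := Nat.isCoprime_iff_coprime.mpr hcr.symm
    exact hco.dvd_of_dvd_mul_left h3)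
  have hhle : h ≤ q * Nat.gcd d (sigma1 d) := by
    apply Nat.le_of_dvd (Nat.mul_pos hq (Nat.gcd_pos_of_pos_left _ hd))
    have h1 : h ∣ Nat.gcd (sigma1 d) d * Nat.gcd (sigma1 d) q := by
      rw [hh, Nat.gcd_comm]; exact Nat.gcd_mul_right_dvd_mul_gcd _ _ _
    rw [Nat.gcd_comm d, mul_comm]
    exact h1.trans (Nat.mul_dvd_mul_left _ (Nat.gcd_dvd_right _ _))
  have hd0 : (0 : ℝ) < d := by exact_mod_cast hd
  have hr0 : (0 : ℝ) < r := by exact_mod_cast hr1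
  have e2 : (d : ℝ) ≤ r * (q * Nat.gcd d (sigma1 d)) := by
    have : d ≤ r * (q * Nat.gcd d (sigma1 d)) :=
      (le_sigma1 hd).trans (hrh.symm.le.trans (Nat.mul_le_mul_left r hhle))
    exact_mod_cast this
  calc (s.card : ℝ) ≤ ((M / r : ℕ) : ℝ) + 1 := by exact_mod_cast hcard
    _ ≤ (M : ℝ) / r + 1 := by gcongr; exact Nat.cast_div_le
    _ ≤ _ := by
        apply add_le_add_left
        rw [div_le_div_iff₀ hr0 hd0]
        calc (M : ℝ) * d ≤ M * (r * (q * Nat.gcd d (sigma1 d))) := by gcongr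
          _ = _ := by ring

lemma count_unitary (b : ℕ) (hb : 1 ≤ b) (k : ℤ) (hk0 : k ≠ 0) (x z T : ℝ) (hz : 1 ≤ z)
    (hx : x = z ^ 3) (hbx : (b : ℝ) ≤ x) (hk : (|k| : ℝ) < b * z ^ 2)
    (hT : ∀ m : ℕ, 1 ≤ m → (m : ℝ) ≤ 2 * x ^ 3 → (m.divisors.card : ℝ) ≤ T) (hT1 : 1 ≤ T)
    (s : Finset ℕ)
    (hs : ∀ n ∈ s, 1 ≤ n ∧ (n : ℝ) ≤ x ∧ IsCongSolution b k n ∧ z ^ 2 < n ∧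
      ∃ d e : ℕ, n = d * e ∧ d.Coprime e ∧ z < d ∧ (d : ℝ) ≤ z ^ 2) :
    (s.card : ℝ) ≤ z ^ 2 * (2 * b * T + 8 * b ^ 2 * T ^ 3) := by
  classical
  have hx0 : 0 < x := by rw [hx]; positivity
  have hx1 : 1 ≤ x := by rw [hx]; exact one_le_pow₀ hz
  have hzx : z ^ 2 ≤ x := by rw [hx]; exact pow_le_pow_right₀ hz (by norm_num)
  have hb1 : (1 : ℝ) ≤ b := by exact_mod_cast hb
  set Q : ℕ := ⌊2 * (b : ℝ) * T⌋₊
  have hQ : (Q : ℝ) ≤ 2 * b * T := Nat.floor_le (by positivity)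
  set G : ℕ → ℕ := fun d => Nat.gcd d (sigma1 d) with hG
  set D := (Finset.Icc 1 ⌊z ^ 2⌋₊).filter
    (fun d : ℕ => z < (d : ℝ) ∧ G d ∈ k.natAbs.divisors) with hD
  let E : ℕ → ℕ → Finset ℕ := fun d q => (Finset.Icc 1 ⌊x / d⌋₊).filter
    (fun e : ℕ => (sigma1 d : ℤ) ∣ (d : ℤ) * q * e + k)
  have hcover : s ⊆ D.biUnion (fun d => (Finset.Icc 1 Q).biUnion
      (fun q => (E d q).image (fun e => d * e))) := by
    intro n hn
    obtain ⟨h1, h2, ⟨q, hq⟩, hzn, d, e, hde, hcop, hzd, hdz⟩ := hs n hn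
    have hn0 : (0 : ℝ) < n := by exact_mod_cast h1
    have hd1 : 1 ≤ d := by
      rcases Nat.eq_zero_or_pos d with h | h
      · rw [h] at hde; omega
      · exact h
    have he1 : 1 ≤ e := by
      rcases Nat.eq_zero_or_pos e with h | h
      · rw [h] at hde; omega
      · exact h
    have hkabs := abs_lt.mp hk
    have hqr : (b : ℝ) * sigma1 n - k = n * q := by exact_mod_cast hq
    have hsn : (n : ℝ) ≤ sigma1 n := by exact_mod_cast le_sigma1 h1
    have hqpos : 0 < q := by
      have h3 : (0 : ℝ) < n * q := by
        rw [← hqr]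
        have : (b : ℝ) * z ^ 2 ≤ b * sigma1 n := by gcongr; linarith
        linarith
      have h4 : (0 : ℝ) < q := by
        by_contra hc
        push Not at hc
        nlinarith
      exact_mod_cast h4
    lift q to ℕ using hqpos.le
    have hq1 : 1 ≤ q := by exact_mod_cast hqpos
    have hqQ : q ≤ Q := by
      apply Nat.le_floor
      have hτ : (n.divisors.card : ℝ) ≤ T := hT n h1 (by nlinarith [one_le_pow₀ (n := 2) hx1])
      have h3 : (sigma1 n : ℝ) ≤ n * T := by
        calc (sigma1 n : ℝ) ≤ n * (n.divisors.card : ℝ) := by exact_mod_cast sigma1_le n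
          _ ≤ n * T := by gcongr
      have h4 : (n : ℝ) * q ≤ n * (2 * b * T) := by
        have e1 : (n : ℝ) * q = b * sigma1 n - k := by rw [hqr]; simp
        rw [e1]
        have e2 : (b : ℝ) * sigma1 n ≤ b * (n * T) := by gcongr
        have e3 : (b : ℝ) * z ^ 2 ≤ b * (n * T) := by
          gcongr
          nlinarith
        linarith
      exact le_of_mul_le_mul_left h4 hn0
    rw [hde, sigma1_mul hcop] at hq
    push_cast at hq
    have hk' : k = (b : ℤ) * (sigma1 d * sigma1 e) - d * e * q := by linarith
    have hGk : G d ∣ k.natAbs := by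
      apply Int.natCast_dvd.mp
      rw [hk']
      apply dvd_sub
      · apply Dvd.dvd.mul_left
        apply Dvd.dvd.mul_right
        exact_mod_cast Nat.gcd_dvd_right d (sigma1 d)
      · rw [mul_assoc]
        apply Dvd.dvd.mul_right
        exact_mod_cast Nat.gcd_dvd_left d (sigma1 d)
    simp only [Finset.mem_biUnion, Finset.mem_image, hD, E, Finset.mem_filter, Finset.mem_Icc,
      Nat.mem_divisors]
    refine ⟨d, ⟨⟨hd1, Nat.le_floor hdz⟩, hzd, hGk, Int.natAbs_ne_zero.mpr hk0⟩, q, ⟨hq1, hqQ⟩,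
      e, ⟨⟨he1, ?_⟩, ?_⟩, hde.symm⟩
    · apply Nat.le_floor
      rw [le_div_iff₀ (by exact_mod_cast hd1)]
      rw [hde] at h2
      push_cast at h2
      linarith
    · rw [hk']
      exact ⟨b * sigma1 e, by ring⟩
  have hE : ∀ d ∈ D, ∀ q ∈ Finset.Icc 1 Q,
      (((E d q).image (fun e => d * e)).card : ℝ) ≤ x * Q * ((G d : ℝ) * ((d : ℝ) ^ 2)⁻¹) + 1 := by
    intro d hd q hq
    simp only [hD, Finset.mem_filter, Finset.mem_Icc] at hd hq
    have hd0 : (0 : ℝ) < d := by exact_mod_cast hd.1.1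
    have h1 := count_e d q ⌊x / d⌋₊ k hd.1.1 hq.1 (E d q) (by
      intro e he
      simp only [E, Finset.mem_filter, Finset.mem_Icc] at he
      exact ⟨he.1.2, he.2⟩)
    have hqQ : (q : ℝ) ≤ Q := by exact_mod_cast hq.2
    calc (((E d q).image (fun e => d * e)).card : ℝ) ≤ (E d q).card := by
          exact_mod_cast Finset.card_image_le
      _ ≤ _ := h1
      _ ≤ (x / d) * (Q * (G d : ℝ)) / d + 1 := by
          have : (⌊x / d⌋₊ : ℝ) ≤ x / d := Nat.floor_le (by positivity)
          gcongr
      _ = _ := by field_simp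
  have hτk : (k.natAbs.divisors.card : ℝ) ≤ T := by
    apply hT _ (Nat.one_le_iff_ne_zero.mpr (Int.natAbs_ne_zero.mpr hk0))
    rw [Nat.cast_natAbs]
    push_cast
    refine hk.le.trans ?_
    calc (b : ℝ) * z ^ 2 ≤ x * x := by gcongr
      _ ≤ 2 * x ^ 3 := by nlinarith [sq_nonneg x]
  have hsumG : ∑ d ∈ D, (G d : ℝ) * ((d : ℝ) ^ 2)⁻¹ ≤ T * (2 / z) := by
    refine (gcd_sum z (by linarith) D k.natAbs.divisors G ?_).trans (by gcongr)
    intro d hd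
    simp only [hD, Finset.mem_filter] at hd
    exact ⟨hd.2.1, Nat.gcd_dvd_left _ _, hd.2.2⟩
  have hDcard : (D.card : ℝ) ≤ z ^ 2 := by
    calc (D.card : ℝ) ≤ ((Finset.Icc 1 ⌊z ^ 2⌋₊).card : ℝ) := by
          exact_mod_cast Finset.card_le_card (Finset.filter_subset _ _)
      _ = ⌊z ^ 2⌋₊ := by simp
      _ ≤ z ^ 2 := Nat.floor_le (by positivity)
  calc (s.card : ℝ) ≤ ((D.biUnion (fun d => (Finset.Icc 1 Q).biUnion
      (fun q => (E d q).image (fun e => d * e)))).card : ℝ) := by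
        exact_mod_cast Finset.card_le_card hcover
    _ ≤ ∑ d ∈ D, (((Finset.Icc 1 Q).biUnion
      (fun q => (E d q).image (fun e => d * e))).card : ℝ) := by
        exact_mod_cast Finset.card_biUnion_le
    _ ≤ ∑ d ∈ D, ∑ q ∈ Finset.Icc 1 Q, (((E d q).image (fun e => d * e)).card : ℝ) := by
        apply Finset.sum_le_sum
        intro d _
        exact_mod_cast Finset.card_biUnion_le
    _ ≤ ∑ d ∈ D, ∑ q ∈ Finset.Icc 1 Q, (x * Q * ((G d : ℝ) * ((d : ℝ) ^ 2)⁻¹) + 1) :=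
        Finset.sum_le_sum (fun d hd => Finset.sum_le_sum (fun q hq => hE d hd q hq))
    _ = x * Q ^ 2 * ∑ d ∈ D, (G d : ℝ) * ((d : ℝ) ^ 2)⁻¹ + D.card * Q := by
        simp only [Finset.sum_const, Nat.card_Icc, Nat.add_sub_cancel, nsmul_eq_mul]
        rw [Finset.mul_sum, ← nsmul_eq_mul, ← Finset.sum_const, ← Finset.sum_add_distrib]
        apply Finset.sum_congr rfl
        intro d _
        ring
    _ ≤ x * (2 * b * T) ^ 2 * (T * (2 / z)) + z ^ 2 * (2 * b * T) := by
        gcongr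
    _ = _ := by rw [hx]; field_simp; ring

lemma nonzero_case (b : ℕ) (hb : 1 ≤ b) (k : ℤ) (hk0 : k ≠ 0) (x z T : ℝ) (hz : 1 ≤ z)
    (hx : x = z ^ 3) (hbx : (b : ℝ) ≤ x) (hk : (|k| : ℝ) < b * z ^ 2)
    (hT : ∀ m : ℕ, 1 ≤ m → (m : ℝ) ≤ 2 * x ^ 3 → (m.divisors.card : ℝ) ≤ T) (hT1 : 1 ≤ T)
    (s : Finset ℕ)
    (hs : ∀ n ∈ s, 1 ≤ n ∧ (n : ℝ) ≤ x ∧ IsSporadicSolution b k n) :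
    (s.card : ℝ) ≤ 15 * b ^ 2 * T ^ 3 * z ^ 2 := by
  classical
  have hb1 : (1 : ℝ) ≤ b := by exact_mod_cast hb
  set P1 : ℕ → Prop := fun n => ∃ p : ℕ, z < p ∧ p ^ 2 ∣ n with hP1
  set P2 : ℕ → Prop := fun n =>
    ∃ p a : ℕ, 2 ≤ p ∧ (p : ℝ) ≤ z ∧ p ^ a ∣ n ∧ z ^ 2 < ((p ^ a : ℕ) : ℝ) with hP2
  set P3 : ℕ → Prop := fun n => ∃ p : ℕ, p.Prime ∧ z < p ∧ p ∣ n ∧ ¬ p ^ 2 ∣ n with hP3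
  set P4 : ℕ → Prop := fun n => z ^ 2 < n ∧
      ∃ d e : ℕ, n = d * e ∧ d.Coprime e ∧ z < d ∧ (d : ℝ) ≤ z ^ 2 with hP4
  have hcover : s ⊆ Finset.Icc 1 ⌊z ^ 2⌋₊ ∪ (s.filter P1 ∪ (s.filter P2 ∪
      (s.filter P3 ∪ s.filter P4))) := by
    intro n hn
    obtain ⟨h1, h2, h3⟩ := hs n hn
    simp only [Finset.mem_union, Finset.mem_filter, Finset.mem_Icc, hn, true_and]
    by_cases hnz : (n : ℝ) ≤ z ^ 2
    · left; exact ⟨h1, Nat.le_floor hnz⟩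
    right
    push Not at hnz
    by_cases h4 : P1 n
    · left; exact h4
    right
    by_cases h5 : P2 n
    · left; exact h5
    right
    by_cases h6 : P3 n
    · left; exact h6
    right
    refine ⟨hnz, exists_unitary n h1 z hz hnz ?_⟩
    intro p hp hpn
    by_contra hcon
    push Not at hcon
    by_cases hpz : (p : ℝ) ≤ z
    · exact h5 ⟨p, n.factorization p, hp.two_le, hpz, Nat.ordProj_dvd n p, hcon⟩
    · push Not at hpz
      by_cases hp2 : p ^ 2 ∣ n
      · exact h4 ⟨p, hpz, hp2⟩
      · exact h6 ⟨p, hp, hpz, hpn, hp2⟩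
  have c0 : ((Finset.Icc 1 ⌊z ^ 2⌋₊).card : ℝ) ≤ z ^ 2 := by
    rw [Nat.card_Icc]; simp only [Nat.add_sub_cancel]
    exact Nat.floor_le (by positivity)
  have c1 := count_sq x z hz hx (s.filter P1) (by
    intro n hn
    rw [Finset.mem_filter] at hn
    exact ⟨(hs n hn.1).1, (hs n hn.1).2.1, hn.2⟩)
  have c2 := count_pp x z hz hx (s.filter P2) (by
    intro n hn
    rw [Finset.mem_filter] at hn
    exact ⟨(hs n hn.1).1, (hs n hn.1).2.1, hn.2⟩)
  have c3 := count_prime b k x z T hz hx hbx hk hT hT1 (s.filter P3) (by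
    intro n hn
    rw [Finset.mem_filter] at hn
    exact ⟨(hs n hn.1).1, (hs n hn.1).2.1, (hs n hn.1).2.2, hn.2⟩)
  have c4 := count_unitary b hb k hk0 x z T hz hx hbx hk hT hT1 (s.filter P4) (by
    intro n hn
    rw [Finset.mem_filter] at hn
    exact ⟨(hs n hn.1).1, (hs n hn.1).2.1, (hs n hn.1).2.2.1, hn.2⟩)
  have hcard : (s.card : ℝ) ≤ ((Finset.Icc 1 ⌊z ^ 2⌋₊).card : ℝ) + ((s.filter P1).card +
      ((s.filter P2).card + ((s.filter P3).card + (s.filter P4).card))) := by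
    have h := Finset.card_le_card hcover
    have h1 := Finset.card_union_le (Finset.Icc 1 ⌊z ^ 2⌋₊) (s.filter P1 ∪ (s.filter P2 ∪
      (s.filter P3 ∪ s.filter P4)))
    have h2 := Finset.card_union_le (s.filter P1) (s.filter P2 ∪ (s.filter P3 ∪ s.filter P4))
    have h3 := Finset.card_union_le (s.filter P2) (s.filter P3 ∪ s.filter P4)
    have h4 := Finset.card_union_le (s.filter P3) (s.filter P4)
    exact_mod_cast (by omega : s.card ≤ (Finset.Icc 1 ⌊z ^ 2⌋₊).card + ((s.filter P1).card +
      ((s.filter P2).card + ((s.filter P3).card + (s.filter P4).card))))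
  have hT3 : T ≤ T ^ 3 := le_self_pow₀ hT1 (by norm_num)
  have hb2 : (b : ℝ) ≤ b ^ 2 := le_self_pow₀ hb1 (by norm_num)
  have hbT : (b : ℝ) * T ≤ b ^ 2 * T ^ 3 := by gcongr
  have hTb : T ≤ b * T := le_mul_of_one_le_left (by linarith) hb1
  have key : 4 + T + (2 * b * T + 8 * b ^ 2 * T ^ 3) ≤ 15 * (b ^ 2 * T ^ 3) := by linarith
  calc (s.card : ℝ) ≤ z ^ 2 * (4 + T + (2 * b * T + 8 * b ^ 2 * T ^ 3)) := by linarith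
    _ ≤ z ^ 2 * (15 * (b ^ 2 * T ^ 3)) := by gcongr
    _ = _ := by ring

theorem stmt_6 :
    ∀ ε > (0 : ℝ), ∃ C > (0 : ℝ), ∀ b : ℕ, 1 ≤ b → ∀ k : ℤ, ∀ x : ℝ, 1 ≤ x →
      (|k| : ℝ) < (b : ℝ) * x ^ ((2 : ℝ) / 3) →
      ({n : ℕ | 1 ≤ n ∧ (n : ℝ) ≤ x ∧ IsSporadicSolution b k n}.ncard : ℝ)
        ≤ C * b ^ 2 * x ^ ((2 : ℝ) / 3 + ε) := by
  intro ε hε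
  obtain ⟨C0, hC0, hzero⟩ := zero_case ε hε
  obtain ⟨C1, hC1, hdiv⟩ := divisor_bound (ε / 9) (by positivity)
  set C2 : ℝ := C1 * 2 ^ (ε / 9) with hC2
  have hC2pos : 0 < C2 := by positivity
  have h21 : (1 : ℝ) ≤ 2 ^ (ε / 9) := Real.one_le_rpow (by norm_num) (by positivity)
  have hC21 : 1 ≤ C2 := one_le_mul_of_one_le_of_one_le hC1 h21
  refine ⟨C0 + 15 * C2 ^ 3 + 1, by positivity, ?_⟩
  intro b hb k x hx hk
  classical
  have hx0 : 0 < x := by linarith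
  have hb1 : (1 : ℝ) ≤ b := by exact_mod_cast hb
  have hb2 : (b : ℝ) ≤ b ^ 2 := le_self_pow₀ hb1 (by norm_num)
  set s := (Finset.Icc 1 ⌊x⌋₊).filter (fun n => IsSporadicSolution b k n) with hs
  have hset : {n : ℕ | 1 ≤ n ∧ (n : ℝ) ≤ x ∧ IsSporadicSolution b k n} = (s : Set ℕ) := by
    ext n
    simp only [Set.mem_setOf_eq, hs, Finset.coe_filter, Finset.mem_Icc, Nat.le_floor_iff hx0.le]
    tauto
  rw [hset, Set.ncard_coe_finset]
  have hsm : ∀ n ∈ s, 1 ≤ n ∧ (n : ℝ) ≤ x ∧ IsSporadicSolution b k n := by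
    intro n hn
    have : n ∈ (s : Set ℕ) := hn
    rw [← hset] at this
    exact this
  have hxp : 0 < x ^ ((2 : ℝ) / 3 + ε) := by positivity
  have hx23 : 1 ≤ x ^ ((2 : ℝ) / 3 + ε) := Real.one_le_rpow hx (by positivity)
  have main : (s.card : ℝ) ≤ C0 * b ^ 2 * x ^ ((2 : ℝ) / 3 + ε) ∨
      (s.card : ℝ) ≤ 15 * C2 ^ 3 * b ^ 2 * x ^ ((2 : ℝ) / 3 + ε) ∨
      (s.card : ℝ) ≤ 1 * b ^ 2 * x ^ ((2 : ℝ) / 3 + ε) := by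
    by_cases hbx : (b : ℝ) ≤ x
    · by_cases hk0 : k = 0
      · left
        refine (hzero b hb x hx s ?_).trans (by gcongr)
        intro n hn
        obtain ⟨h1, h2, h3, _⟩ := hsm n hn
        refine ⟨h1, h2, ?_⟩
        rw [IsCongSolution, hk0, sub_zero] at h3
        exact_mod_cast h3
      · right; left
        set z : ℝ := x ^ ((1 : ℝ) / 3) with hz
        have hz3 : x = z ^ 3 := by
          rw [hz, ← Real.rpow_natCast, ← Real.rpow_mul hx0.le]; norm_num
        have hz2 : x ^ ((2 : ℝ) / 3) = z ^ 2 := by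
          rw [hz, ← Real.rpow_natCast, ← Real.rpow_mul hx0.le]; norm_num
        have hz1 : 1 ≤ z := Real.one_le_rpow hx (by norm_num)
        rw [hz2] at hk
        have hxe : 1 ≤ x ^ (ε / 3) := Real.one_le_rpow hx (by positivity)
        have h := nonzero_case b hb k hk0 x z (C2 * x ^ (ε / 3)) hz1 hz3 hbx hk (by
          intro m hm hmx
          calc (m.divisors.card : ℝ) ≤ C1 * (m : ℝ) ^ (ε / 9) := hdiv m hm
            _ ≤ C1 * (2 * x ^ 3) ^ (ε / 9) := by gcongr
            _ = C2 * x ^ (ε / 3) := by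
                rw [Real.mul_rpow (by norm_num) (by positivity), hC2, mul_assoc,
                  ← Real.rpow_natCast x 3, ← Real.rpow_mul hx0.le]
                congr 3
                push_cast; ring) (one_le_mul_of_one_le_of_one_le hC21 hxe) s hsm
        refine h.trans (le_of_eq ?_)
        rw [Real.rpow_add hx0, hz2, mul_pow, ← Real.rpow_natCast (x ^ (ε / 3)) 3,
          ← Real.rpow_mul hx0.le]
        have : ε / 3 * ((3 : ℕ) : ℝ) = ε := by push_cast; ring
        rw [this]; ring
    · right; right
      push Not at hbx
      have h1 : (s.card : ℝ) ≤ x := by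
        calc (s.card : ℝ) ≤ ((Finset.Icc 1 ⌊x⌋₊).card : ℝ) := by
              exact_mod_cast Finset.card_le_card (Finset.filter_subset _ _)
          _ = ⌊x⌋₊ := by simp
          _ ≤ x := Nat.floor_le hx0.le
      have h2 : (b : ℝ) ^ 2 ≤ b ^ 2 * x ^ ((2 : ℝ) / 3 + ε) :=
        le_mul_of_one_le_right (by positivity) hx23
      linarith
  have hA : 0 ≤ (b : ℝ) ^ 2 * x ^ ((2 : ℝ) / 3 + ε) := by positivity
  have hA1 : 0 ≤ C0 * ((b : ℝ) ^ 2 * x ^ ((2 : ℝ) / 3 + ε)) := by positivity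
  have hA2 : 0 ≤ 15 * C2 ^ 3 * ((b : ℝ) ^ 2 * x ^ ((2 : ℝ) / 3 + ε)) := by positivity
  rcases main with h | h | h <;> nlinarith
end

section
/- Let a > b ≥ 1 be coprime integers and let k ≥ 1 be an integer such that ab divides k and σ(k/a) = k/b. Then, as x → ∞, #S(a,b;k;x) ∼ (a/k) · x / log(a·x/k), where S(a,b;k;x) is the set of positive integers n ≤ x with b·σ(n) = a·n + k. -/
open MeasureTheory Filter Topology Complex in
/-- Fubini identity. -/
lemma wi_fubini (E : ℝ → ℝ) (M : ℝ) (hEm : Measurable E) (hEb : ∀ u, |E u| ≤ M)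
    (hE0 : ∀ u ≤ 0, E u = 0) (g : ℝ → ℂ) (hgc : Continuous g) (hgs : HasCompactSupport g)
    (k : ℝ → ℂ) (hk : ∀ v, k v = ∫ t : ℝ, g t * exp (I * t * v))
    (G : ℂ → ℂ) (hEG : ∀ z : ℂ, 0 < z.re → ∫ u : ℝ, (E u : ℂ) * exp (-z * u) = G z)
    (y δ : ℝ) (hδ : 0 < δ) :
    ∫ t : ℝ, g t * exp (I * t * y) * G (δ + I * t) =
      ∫ u : ℝ, (E u : ℂ) * exp (-δ * u) * k (y - u) := by
  have hgi : Integrable g := hgc.integrable_of_hasCompactSupport hgs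
  have hEi : Integrable (fun u : ℝ => (E u : ℂ) * exp (-δ * u)) := by
    have h1 : IntegrableOn (fun u : ℝ => M * Real.exp (-δ * u)) (Set.Ioi 0) :=
      (exp_neg_integrableOn_Ioi 0 hδ).const_mul M
    have h2 : IntegrableOn (fun u : ℝ => (E u : ℂ) * exp (-δ * u)) (Set.Ioi 0) := by
      refine Integrable.mono' h1 ?_ ?_
      · apply Measurable.aestronglyMeasurable
        fun_prop
      · refine ae_of_all _ fun u => ?_
        rw [norm_mul, Complex.norm_exp, Complex.norm_real, Real.norm_eq_abs]
        have : (-(δ:ℂ) * u).re = -δ * u := by simp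
        rw [this]
        gcongr
        exact hEb u
    refine (integrableOn_iff_integrable_of_support_subset ?_).1 h2
    intro u hu
    by_contra h
    apply hu
    simp [hE0 u (not_lt.1 h)]
  have hInteg : Integrable (fun p : ℝ × ℝ => (g p.1 * exp (I * p.1 * (y - p.2))) *
      ((E p.2 : ℂ) * exp (-δ * p.2))) (volume.prod volume) := by
    have h := hgi.mul_prod hEi
    refine Integrable.mono' h.norm ?_ ?_
    · apply Measurable.aestronglyMeasurable
      have := hgc.measurable
      fun_prop
    · refine ae_of_all _ fun p => le_of_eq ?_
      have : (I * p.1 * (y - p.2)).re = 0 := by simp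
      simp only [norm_mul, Complex.norm_exp, this, Real.exp_zero, mul_one]
  have hswap := integral_integral_swap (f := fun t u : ℝ => (g t * exp (I * t * (y - u))) *
      ((E u : ℂ) * exp (-δ * u))) hInteg
  have hL : ∀ t : ℝ, g t * exp (I * t * y) * G (δ + I * t) =
      ∫ u : ℝ, (g t * exp (I * t * (y - u))) * ((E u : ℂ) * exp (-δ * u)) := by
    intro t
    rw [← hEG _ (by simp [hδ]), ← integral_const_mul]
    congr 1; ext u
    have : exp (I * t * (y - u)) * exp (-δ * u) = exp (I * t * y) * exp (-(δ + I * t) * u) := by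
      rw [← exp_add, ← exp_add]; congr 1; ring
    linear_combination (-(g t * E u)) * this
  simp_rw [hL]
  rw [hswap]
  congr 1; ext u
  rw [hk, ← integral_const_mul]
  congr 1; ext t
  push_cast
  ring

open MeasureTheory Filter Topology Complex in
lemma wi_smoothed (E : ℝ → ℝ) (M : ℝ) (hEm : Measurable E) (hEb : ∀ u, |E u| ≤ M)
    (hE0 : ∀ u ≤ 0, E u = 0) (g : ℝ → ℂ) (hgc : Continuous g) (hgs : HasCompactSupport g)
    (k : ℝ → ℂ) (hk : ∀ v, k v = ∫ t : ℝ, g t * exp (I * t * v)) (hki : Integrable k)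
    (G : ℂ → ℂ) (hG : ContinuousOn G {z | 0 ≤ z.re})
    (hEG : ∀ z : ℂ, 0 < z.re → ∫ u : ℝ, (E u : ℂ) * exp (-z * u) = G z) (y : ℝ) :
    ∫ t : ℝ, g t * exp (I * t * y) * G (I * t) = ∫ u : ℝ, (E u : ℂ) * k (y - u) := by
  have hM : 0 ≤ M := (abs_nonneg _).trans (hEb 0)
  -- bound for G on compact
  obtain ⟨R, hR⟩ : ∃ R : ℝ, ∀ t, R < |t| → g t = 0 := by
    obtain ⟨R, hR⟩ := hgs.isCompact.isBounded.subset_closedBall (0:ℝ)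
    refine ⟨R, fun t ht => ?_⟩
    by_contra h
    have := hR (subset_tsupport _ h)
    rw [Metric.mem_closedBall, dist_zero_right, Real.norm_eq_abs] at this
    linarith
  have hGI : ∀ δ : ℝ, 0 ≤ δ → Continuous (fun t : ℝ => G (δ + I * t)) := by
    intro δ hδ
    refine hG.comp_continuous (by fun_prop) (fun t => by simp [hδ])
  obtain ⟨B, hB⟩ : ∃ B : ℝ, ∀ δ ∈ Set.Icc (0:ℝ) 1, ∀ t ∈ Set.Icc (-R) R, ‖G (δ + I * t)‖ ≤ B := by
    have hc : IsCompact ((fun p : ℝ × ℝ => (p.1 + I * p.2 : ℂ)) '' (Set.Icc 0 1 ×ˢ Set.Icc (-R) R)) :=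
      (isCompact_Icc.prod isCompact_Icc).image (by fun_prop)
    have hs : ((fun p : ℝ × ℝ => (p.1 + I * p.2 : ℂ)) '' (Set.Icc 0 1 ×ˢ Set.Icc (-R) R)) ⊆
        {z : ℂ | 0 ≤ z.re} := by
      rintro _ ⟨p, hp, rfl⟩
      simpa using hp.1.1
    obtain ⟨B, hB⟩ := hc.exists_bound_of_continuousOn (hG.mono hs)
    exact ⟨B, fun δ hδ t ht => hB _ ⟨(δ, t), ⟨hδ, ht⟩, rfl⟩⟩
  have hIoo : ∀ᶠ δ : ℝ in 𝓝[>] 0, δ ∈ Set.Ioo (0:ℝ) 1 := Ioo_mem_nhdsGT one_pos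
  have hl : Tendsto (fun δ : ℝ => ∫ t : ℝ, g t * exp (I * t * y) * G (δ + I * t)) (𝓝[>] 0)
      (𝓝 (∫ t : ℝ, g t * exp (I * t * y) * G (I * t))) := by
    refine tendsto_integral_filter_of_dominated_convergence (fun t => ‖g t‖ * B) ?_ ?_ ?_ ?_
    · filter_upwards [hIoo] with δ hδ
      exact ((hgc.mul (by fun_prop)).mul (hGI δ hδ.1.le)).aestronglyMeasurable
    · filter_upwards [hIoo] with δ hδ
      refine ae_of_all _ fun t => ?_
      by_cases ht : R < |t|
      · simp [hR t ht]
      · have h0 : (I * t * y).re = 0 := by simp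
        rw [norm_mul, norm_mul, Complex.norm_exp, h0, Real.exp_zero, mul_one]
        gcongr
        exact hB δ ⟨hδ.1.le, hδ.2.le⟩ t (by rw [Set.mem_Icc, ← abs_le]; exact not_lt.1 ht)
    · exact (hgc.integrable_of_hasCompactSupport hgs).norm.mul_const B
    · refine ae_of_all _ fun t => ?_
      refine Tendsto.const_mul _ ?_
      have h1 : ContinuousWithinAt G {z | 0 ≤ z.re} (I * t) := hG _ (by simp)
      refine h1.tendsto.comp ?_
      rw [tendsto_nhdsWithin_iff]
      constructor
      · have : Tendsto (fun δ : ℝ => (δ + I * t : ℂ)) (𝓝 0) (𝓝 ((0:ℝ) + I * t)) := by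
          apply Continuous.tendsto
          fun_prop
        simp only [ofReal_zero, zero_add] at this
        exact this.mono_left nhdsWithin_le_nhds
      · filter_upwards [hIoo] with δ hδ
        simp [hδ.1.le]
  have hr : Tendsto (fun δ : ℝ => ∫ u : ℝ, (E u : ℂ) * exp (-δ * u) * k (y - u)) (𝓝[>] 0)
      (𝓝 (∫ u : ℝ, (E u : ℂ) * k (y - u))) := by
    have hkY : Integrable (fun u => k (y - u)) := hki.comp_sub_left y
    refine tendsto_integral_filter_of_dominated_convergence (fun u => M * ‖k (y - u)‖) ?_ ?_ ?_ ?_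
    · filter_upwards with δ
      refine AEStronglyMeasurable.mul ?_ hkY.aestronglyMeasurable
      apply Measurable.aestronglyMeasurable
      fun_prop
    · filter_upwards [hIoo] with δ hδ
      refine ae_of_all _ fun u => ?_
      rw [norm_mul]
      gcongr
      by_cases hu : u ≤ 0
      · simp [hE0 u hu, hM]
      · rw [norm_mul, Complex.norm_exp, Complex.norm_real, Real.norm_eq_abs]
        have : (-(δ:ℂ) * u).re = -δ * u := by simp
        rw [this]
        have h2 : Real.exp (-δ * u) ≤ 1 := by
          rw [Real.exp_le_one_iff]
          have := mul_pos hδ.1 (not_le.1 hu)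
          linarith
        calc |E u| * Real.exp (-δ * u) ≤ M * 1 := by gcongr; exact hEb u
          _ = M := mul_one M
    · exact hkY.norm.const_mul M
    · refine ae_of_all _ fun u => ?_
      have : Tendsto (fun δ : ℝ => (E u : ℂ) * exp (-δ * u) * k (y - u)) (𝓝 0)
          (𝓝 ((E u : ℂ) * exp (-(0:ℝ) * u) * k (y - u))) := by
        apply Continuous.tendsto
        fun_prop
      simp only [ofReal_zero, neg_zero, zero_mul, exp_zero, mul_one] at this
      exact this.mono_left nhdsWithin_le_nhds
  refine tendsto_nhds_unique hl (hr.congr' ?_)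
  filter_upwards [hIoo] with δ hδ
  exact (wi_fubini E M hEm hEb hE0 g hgc hgs k hk G hEG y δ hδ.1).symm

open MeasureTheory Filter Topology Complex in
lemma wi_limit (E : ℝ → ℝ) (M : ℝ) (hEm : Measurable E) (hEb : ∀ u, |E u| ≤ M)
    (hE0 : ∀ u ≤ 0, E u = 0) (g : ℝ → ℂ) (hgc : Continuous g) (hgs : HasCompactSupport g)
    (k : ℝ → ℂ) (hk : ∀ v, k v = ∫ t : ℝ, g t * exp (I * t * v)) (hki : Integrable k)
    (G : ℂ → ℂ) (hG : ContinuousOn G {z | 0 ≤ z.re})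
    (hEG : ∀ z : ℂ, 0 < z.re → ∫ u : ℝ, (E u : ℂ) * exp (-z * u) = G z) :
    Tendsto (fun y : ℝ => ∫ u : ℝ, (E u : ℂ) * k (y - u)) atTop (𝓝 0) := by
  have h1 := Real.tendsto_integral_exp_smul_cocompact (fun t : ℝ => g t * G (I * t))
  have h2 : Tendsto (fun y : ℝ => -y / (2 * Real.pi)) atTop (cocompact ℝ) := by
    rw [cocompact_eq_atBot_atTop]
    refine Tendsto.mono_right ?_ le_sup_left
    exact (tendsto_neg_atTop_atBot).atBot_div_const (by positivity)
  refine (h1.comp h2).congr fun y => ?_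
  rw [← wi_smoothed E M hEm hEb hE0 g hgc hgs k hk hki G hG hEG y]
  simp only [Function.comp]
  congr 1; ext t
  rw [Circle.smul_def, Real.fourierChar_apply, smul_eq_mul]
  have : ((2 * Real.pi * -(t * (-y / (2 * Real.pi))) : ℝ) : ℂ) * I = I * t * y := by
    have : (2 * Real.pi * -(t * (-y / (2 * Real.pi))) : ℝ) = t * y := by
      have := Real.pi_pos.ne'
      field_simp
    rw [this]; push_cast; ring
  rw [this]
  ring

/-- Fejer kernel. -/
noncomputable def fejK (v : ℝ) : ℝ := 2 * (1 - Real.cos v) / v ^ 2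

/-- Its compactly supported transform. -/
noncomputable def fejG (t : ℝ) : ℝ := max 0 (1 - |t|)

lemma fejK_nonneg (v : ℝ) : 0 ≤ fejK v := by
  unfold fejK
  have := Real.cos_le_one v
  have : 0 ≤ 1 - Real.cos v := by linarith
  positivity

lemma fejK_le (v : ℝ) : fejK v ≤ 5 * (1 + v ^ 2)⁻¹ := by
  unfold fejK
  have h1 := Real.neg_one_le_cos v
  have h2 := Real.one_sub_sq_div_two_le_cos (x := v)
  by_cases hv : v = 0
  · simp [hv]
  · have : 0 < v ^ 2 := by positivity
    rw [← div_eq_mul_inv, div_le_div_iff₀ this (by positivity)]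
    nlinarith

lemma fejK_meas : Measurable fejK := by
  unfold fejK
  fun_prop

open MeasureTheory in
lemma fejK_int : Integrable fejK := by
  refine Integrable.mono' (integrable_inv_one_add_sq.const_mul 5) fejK_meas.aestronglyMeasurable ?_
  refine ae_of_all _ fun v => ?_
  rw [Real.norm_eq_abs, abs_of_nonneg (fejK_nonneg v)]
  exact fejK_le v

open MeasureTheory in
lemma fejK_pos : 0 < ∫ v, fejK v := by
  rw [integral_pos_iff_support_of_nonneg fejK_nonneg fejK_int]
  have : Set.Ioo (0:ℝ) 1 ⊆ Function.support fejK := by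
    intro v hv
    have h1 : Real.cos v < 1 := by
      rw [← Real.cos_zero]
      exact Real.cos_lt_cos_of_nonneg_of_le_pi le_rfl (by linarith [Real.pi_gt_three, hv.2]) hv.1
    have h0 := hv.1
    have : 0 < fejK v := by
      unfold fejK
      have : 0 < 1 - Real.cos v := by linarith
      positivity
    exact this.ne'
  refine lt_of_lt_of_le ?_ (measure_mono this)
  simp

lemma fejG_cont : Continuous fejG := by
  unfold fejG; fun_prop

lemma fejG_zero {t : ℝ} (ht : 1 ≤ |t|) : fejG t = 0 := by
  unfold fejG
  exact max_eq_left (by linarith)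

open MeasureTheory Complex in
lemma fejG_transform (v : ℝ) (hv : v ≠ 0) :
    ∫ t : ℝ, (fejG t : ℂ) * exp (I * t * v) = fejK v := by
  have hsupp : Function.support (fun t : ℝ => (fejG t : ℂ) * exp (I * t * v)) ⊆ Set.Ioc (-1) 1 := by
    intro t ht
    by_contra h
    apply ht
    have : 1 ≤ |t| := by
      rw [Set.mem_Ioc, not_and_or] at h
      rcases h with h | h
      · rw [le_abs]; right; linarith
      · rw [le_abs]; left; linarith
    simp [fejG_zero this]
  rw [← setIntegral_eq_integral_of_forall_compl_eq_zero (s := Set.Ioc (-1) 1)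
    (fun t ht => by by_contra h; exact ht (hsupp h)), ← intervalIntegral.integral_of_le (by norm_num)]
  have hcont : Continuous (fun t : ℝ => (fejG t : ℂ) * exp (I * t * v)) := by
    have := fejG_cont
    fun_prop
  rw [← intervalIntegral.integral_add_adjacent_intervals (b := 0)
    (hcont.intervalIntegrable _ _) (hcont.intervalIntegrable _ _)]
  have hvc : (v : ℂ) ≠ 0 := by exact_mod_cast hv
  have hiv : I * v ≠ 0 := mul_ne_zero I_ne_zero hvc
  have hd : ∀ t : ℝ, HasDerivAt (fun t : ℝ => exp (I * t * v)) (exp (I * t * v) * (I * v)) t := by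
    intro t
    have h1 : HasDerivAt (fun t : ℝ => (I * t * v : ℂ)) (I * 1 * v) t :=
      ((Complex.ofRealCLM.hasDerivAt (x := t)).const_mul I).mul_const (v : ℂ)
    rw [mul_one] at h1
    exact h1.cexp
  have hid : ∀ t : ℝ, HasDerivAt (fun t : ℝ => (t : ℂ)) 1 t := fun t =>
    Complex.ofRealCLM.hasDerivAt (x := t)
  have e1 : ∫ t in (-1:ℝ)..0, (fejG t : ℂ) * exp (I * t * v) =
      ((1 + (0:ℝ)) * exp (I * (0:ℝ) * v) / (I * v) - exp (I * (0:ℝ) * v) / (I * v) ^ 2) -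
      ((1 + (-1:ℝ)) * exp (I * (-1:ℝ) * v) / (I * v) - exp (I * (-1:ℝ) * v) / (I * v) ^ 2) := by
    rw [intervalIntegral.integral_congr (g := fun t : ℝ => (1 + t) * exp (I * t * v))]
    · refine intervalIntegral.integral_eq_sub_of_hasDerivAt
        (f := fun t : ℝ => (1 + t) * exp (I * t * v) / (I * v) - exp (I * t * v) / (I * v) ^ 2) ?_ ?_
      · intro t _
        have := (((hid t).const_add 1).mul (hd t)).div_const (I * v) |>.sub ((hd t).div_const ((I * v) ^ 2))
        refine this.congr_deriv ?_
        field_simp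
        ring
      · apply Continuous.intervalIntegrable
        fun_prop
    · intro t ht
      rw [Set.uIcc_of_le (by norm_num)] at ht
      have : fejG t = 1 + t := by
        unfold fejG
        rw [abs_of_nonpos ht.2, max_eq_right] <;> linarith [ht.1]
      simp [this]
  have e2 : ∫ t in (0:ℝ)..1, (fejG t : ℂ) * exp (I * t * v) =
      ((1 - (1:ℝ)) * exp (I * (1:ℝ) * v) / (I * v) + exp (I * (1:ℝ) * v) / (I * v) ^ 2) -
      ((1 - (0:ℝ)) * exp (I * (0:ℝ) * v) / (I * v) + exp (I * (0:ℝ) * v) / (I * v) ^ 2) := by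
    rw [intervalIntegral.integral_congr (g := fun t : ℝ => (1 - t) * exp (I * t * v))]
    · refine intervalIntegral.integral_eq_sub_of_hasDerivAt
        (f := fun t : ℝ => (1 - t) * exp (I * t * v) / (I * v) + exp (I * t * v) / (I * v) ^ 2) ?_ ?_
      · intro t _
        have := (((hid t).const_sub 1).mul (hd t)).div_const (I * v) |>.add ((hd t).div_const ((I * v) ^ 2))
        refine this.congr_deriv ?_
        field_simp
        ring
      · apply Continuous.intervalIntegrable
        fun_prop
    · intro t ht
      rw [Set.uIcc_of_le (by norm_num)] at ht
      have : fejG t = 1 - t := by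
        unfold fejG
        rw [abs_of_nonneg ht.1, max_eq_right] ; linarith [ht.2]
      simp [this]
  rw [e1, e2]
  unfold fejK
  push_cast
  rw [Complex.cos]
  have a1 : I * -1 * (v:ℂ) = -v * I := by ring
  have a2 : I * 1 * (v:ℂ) = v * I := by ring
  have a3 : (I * (v:ℂ)) ^ 2 = - v ^ 2 := by rw [mul_pow, I_sq]; ring
  rw [a1, a2, a3]
  simp only [mul_zero, zero_mul, exp_zero]
  field_simp
  ring

open MeasureTheory Filter Topology Complex in
lemma wi_conv (E : ℝ → ℝ) (M : ℝ) (hEm : Measurable E) (hEb : ∀ u, |E u| ≤ M)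
    (hE0 : ∀ u ≤ 0, E u = 0)
    (G : ℂ → ℂ) (hG : ContinuousOn G {z | 0 ≤ z.re})
    (hEG : ∀ z : ℂ, 0 < z.re → ∫ u : ℝ, (E u : ℂ) * exp (-z * u) = G z)
    (l : ℝ) (hl : 0 < l) :
    Tendsto (fun y : ℝ => ∫ w : ℝ, E (y - w / l) * fejK w) atTop (𝓝 0) := by
  set k : ℝ → ℂ := fun v => ∫ t : ℝ, (fejG (t / l) : ℂ) * exp (I * t * v) with hk
  have hk1 : ∀ v, v ≠ 0 → k v = ((l * fejK (l * v) : ℝ) : ℂ) := by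
    intro v hv
    have := Measure.integral_comp_div (fun s : ℝ => (fejG s : ℂ) * exp (I * s * (l * v : ℝ))) l
    rw [fejG_transform _ (mul_ne_zero hl.ne' hv)] at this
    rw [abs_of_pos hl, real_smul, ← ofReal_mul] at this
    rw [← this]
    refine integral_congr_ae (ae_of_all _ fun t => ?_)
    simp only
    congr 2
    have : (l : ℂ) ≠ 0 := by exact_mod_cast hl.ne'
    push_cast
    field_simp
  have hkae : (fun v => ((l * fejK (l * v) : ℝ) : ℂ)) =ᵐ[volume] k := by
    have : ∀ᵐ v : ℝ, v ≠ 0 := by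
      simp [ae_iff]
    filter_upwards [this] with v hv using (hk1 v hv).symm
  have hki : Integrable k := by
    refine Integrable.congr ?_ hkae
    exact ((fejK_int.comp_mul_left' hl.ne').const_mul l).ofReal
  have hgs : HasCompactSupport (fun t : ℝ => (fejG (t / l) : ℂ)) := by
    refine HasCompactSupport.of_support_subset_isCompact (isCompact_Icc (a := -l) (b := l)) ?_
    intro t ht
    by_contra h
    apply ht
    have h1 : l ≤ |t| := by
      by_contra h2
      exact h (abs_le.1 (not_le.1 h2).le)
    have h2 : 1 ≤ |t / l| := by
      rw [abs_div, abs_of_pos hl, le_div_iff₀ hl]; linarith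
    simp [fejG_zero h2]
  have hgc : Continuous (fun t : ℝ => (fejG (t / l) : ℂ)) := by
    have := fejG_cont
    fun_prop
  have := wi_limit E M hEm hEb hE0 _ hgc hgs k (fun v => rfl) hki G hG hEG
  rw [← tendsto_ofReal_iff]
  rw [show ((0:ℝ) : ℂ) = 0 from rfl]
  refine this.congr fun y => ?_
  have e1 : ∫ u : ℝ, (E u : ℂ) * k (y - u) = ∫ u : ℝ, ((E u * (l * fejK (l * (y - u))) : ℝ) : ℂ) := by
    apply integral_congr_ae
    have : ∀ᵐ v : ℝ, v ≠ y := by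
      simp [ae_iff]
    filter_upwards [this] with u hu
    rw [hk1 _ (sub_ne_zero.2 hu.symm)]
    push_cast
    ring
  rw [e1, integral_complex_ofReal]
  congr 1
  have e2 := integral_sub_left_eq_self (fun x : ℝ => E (y - x) * (l * fejK (l * x))) volume y
  have e3 := Measure.integral_comp_mul_left (fun w : ℝ => E (y - w / l) * fejK w) l
  simp only [sub_sub_cancel] at e2
  rw [e2]
  rw [abs_of_pos (inv_pos.2 hl), smul_eq_mul] at e3
  have e4 : ∫ w : ℝ, E (y - w / l) * fejK w = l * ∫ (x : ℝ), E (y - l * x / l) * fejK (l * x) := by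
    rw [e3]; field_simp
  rw [e4, ← integral_const_mul]
  congr 1; ext x
  rw [mul_div_cancel_left₀ _ hl.ne']
  ring

open MeasureTheory Filter Topology in
lemma wi_conv' (H : ℝ → ℝ) (M : ℝ) (hHm : Measurable H) (hH0 : ∀ u, 0 ≤ H u) (hHb : ∀ u, H u ≤ M)
    (hHz : ∀ u ≤ 0, H u = 0)
    (G : ℂ → ℂ) (hG : ContinuousOn G {z | 0 ≤ z.re})
    (hEG : ∀ z : ℂ, 0 < z.re → ∫ u in Set.Ioi (0:ℝ), ((H u - 1 : ℝ) : ℂ) * Complex.exp (-z * u) = G z)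
    (l : ℝ) (hl : 0 < l) :
    Tendsto (fun y : ℝ => ∫ w : ℝ, H (y - w / l) * fejK w) atTop (𝓝 (∫ w, fejK w)) := by
  set E : ℝ → ℝ := (Set.Ioi 0).indicator (fun u => H u - 1) with hE
  have hEm : Measurable E := (hHm.sub_const 1).indicator measurableSet_Ioi
  have hM : 0 ≤ M := (hH0 0).trans (hHb 0)
  have hEb : ∀ u, |E u| ≤ M + 1 := by
    intro u
    rw [hE, Set.indicator_apply]
    split_ifs
    · have := hH0 u; have := hHb u
      rw [abs_le]; constructor <;> linarith
    · simp; linarith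
  have hE0 : ∀ u ≤ 0, E u = 0 := by
    intro u hu
    rw [hE, Set.indicator_of_notMem]
    simpa using hu
  have hEG' : ∀ z : ℂ, 0 < z.re → ∫ u : ℝ, (E u : ℂ) * Complex.exp (-z * u) = G z := by
    intro z hz
    rw [← hEG z hz, ← integral_indicator measurableSet_Ioi]
    congr 1; ext u
    rw [hE, Set.indicator_apply, Set.indicator_apply]
    split_ifs <;> simp
  have h1 := wi_conv E (M+1) hEm hEb hE0 G hG hEG' l hl
  have h2 : Tendsto (fun y : ℝ => ∫ w : ℝ, (Set.Ioi (0:ℝ)).indicator 1 (y - w / l) * fejK w) atTop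
      (𝓝 (∫ w, fejK w)) := by
    refine tendsto_integral_filter_of_dominated_convergence fejK ?_ ?_ fejK_int ?_
    · refine Eventually.of_forall fun y => Measurable.aestronglyMeasurable ?_
      refine Measurable.mul ?_ fejK_meas
      exact (measurable_one.indicator measurableSet_Ioi).comp (by fun_prop)
    · refine Eventually.of_forall fun y => ae_of_all _ fun w => ?_
      rw [Set.indicator_apply]
      have := fejK_nonneg w
      split_ifs
      · simp [abs_of_nonneg this]
      · simpa
    · refine ae_of_all _ fun w => ?_
      apply tendsto_const_nhds.congr'
      filter_upwards [eventually_gt_atTop (w / l)] with y hy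
      rw [Set.indicator_of_mem (by simpa using hy)]
      simp
  have h3 := h1.add h2
  rw [zero_add] at h3
  refine h3.congr fun y => ?_
  rw [← integral_add]
  · congr 1; ext w
    rw [← add_mul]
    congr 1
    rw [hE, Set.indicator_apply, Set.indicator_apply]
    split_ifs with h
    · simp
    · simp [hHz (y - w / l) (by simpa using h)]
  · refine fejK_int.bdd_mul (c := M+1) (Measurable.aestronglyMeasurable ?_) ?_
    · exact hEm.comp (by fun_prop)
    · exact ae_of_all _ fun w => by simpa using hEb _
  · refine fejK_int.bdd_mul (c := 1) (Measurable.aestronglyMeasurable ?_) ?_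
    · exact (measurable_one.indicator measurableSet_Ioi).comp (by fun_prop)
    · refine ae_of_all _ fun w => ?_
      rw [Set.indicator_apply]; split_ifs <;> simp

open MeasureTheory Filter Topology in
/-- There is a window capturing nearly all the mass of the Fejer kernel. -/
lemma fej_window (ε : ℝ) (hε : 0 < ε) :
    ∃ W : ℝ, 0 < W ∧ (1 - ε) * (∫ w, fejK w) ≤ ∫ w in Set.Icc (-W) W, fejK w := by
  have h : Tendsto (fun n : ℕ => ∫ w in Set.Icc (-(n:ℝ)) n, fejK w) atTop
      (𝓝 (∫ w in ⋃ n : ℕ, Set.Icc (-(n:ℝ)) n, fejK w)) := by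
    apply tendsto_setIntegral_of_monotone
    · exact fun n => measurableSet_Icc
    · intro m n hmn
      have : (m:ℝ) ≤ n := by exact_mod_cast hmn
      exact Set.Icc_subset_Icc (by linarith) this
    · exact fejK_int.integrableOn
  have hU : (⋃ n : ℕ, Set.Icc (-(n:ℝ)) n) = Set.univ := by
    rw [Set.eq_univ_iff_forall]
    intro x
    obtain ⟨n, hn⟩ := exists_nat_ge |x|
    exact Set.mem_iUnion.2 ⟨n, abs_le.1 hn⟩
  rw [hU, setIntegral_univ] at h
  have hc := fejK_pos
  have hlt : (1 - ε) * (∫ w, fejK w) < ∫ w, fejK w := by nlinarith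
  obtain ⟨n, hn, hn0⟩ := ((h.eventually (lt_mem_nhds hlt)).and (eventually_gt_atTop 0)).exists
  exact ⟨n, by exact_mod_cast hn0, hn.le⟩

open MeasureTheory Filter Topology in
lemma wi_tauber (H : ℝ → ℝ) (M : ℝ) (hHm : Measurable H) (hH0 : ∀ u, 0 ≤ H u) (hHb : ∀ u, H u ≤ M)
    (hmono : ∀ u v, u ≤ v → Real.exp u * H u ≤ Real.exp v * H v)
    (hconv : ∀ l : ℝ, 0 < l → Tendsto (fun y : ℝ => ∫ w : ℝ, H (y - w / l) * fejK w) atTop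
      (𝓝 (∫ w, fejK w))) :
    Tendsto H atTop (𝓝 1) := by
  have hc := fejK_pos
  set c := ∫ w, fejK w with hcdef
  have hM : 0 ≤ M := (hH0 0).trans (hHb 0)
  have hmono' : ∀ u v h, u ≤ v → v ≤ u + 2 * h → H u ≤ Real.exp (2 * h) * H v := by
    intro u v h huv hvu
    have h1 := hmono u v huv
    have h2 : Real.exp v ≤ Real.exp u * Real.exp (2 * h) := by
      rw [← Real.exp_add]; exact Real.exp_le_exp.2 hvu
    have h3 : Real.exp u * H u ≤ Real.exp u * (Real.exp (2 * h) * H v) := by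
      calc _ ≤ _ := h1
        _ ≤ Real.exp u * Real.exp (2 * h) * H v := by gcongr; exact hH0 v
        _ = _ := by ring
    exact le_of_mul_le_mul_left h3 (Real.exp_pos u)
  have hInteg : ∀ y l : ℝ, Integrable (fun w => H (y - w / l) * fejK w) := by
    intro y l
    refine fejK_int.bdd_mul (c := M) (Measurable.aestronglyMeasurable ?_) ?_
    · exact hHm.comp (by fun_prop)
    · exact ae_of_all _ fun w => by simpa [abs_of_nonneg (hH0 _)] using hHb _
  -- the two eventual bounds
  have hup : ∀ ε h : ℝ, 0 < ε → ε < 1 → 0 < h →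
      ∀ᶠ y in atTop, (1 - ε) * H y ≤ Real.exp (2 * h) * (1 + ε) := by
    intro ε h hε hε1 hh
    obtain ⟨W, hW, hWc⟩ := fej_window ε hε
    have hl : 0 < W / h := by positivity
    have hev := (hconv (W / h) hl).eventually (gt_mem_nhds (show c < (1 + ε) * c by nlinarith))
    have hev2 := (tendsto_atTop_add_const_right atTop h tendsto_id).eventually hev
    filter_upwards [hev2] with y hy
    simp only [id] at hy
    have h1 : ∫ w in Set.Icc (-W) W, H y * fejK w ≤
        ∫ w in Set.Icc (-W) W, Real.exp (2 * h) * (H (y + h - w / (W / h)) * fejK w) := by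
      refine setIntegral_mono_on (fejK_int.const_mul _).integrableOn
        ((hInteg _ _).const_mul _).integrableOn measurableSet_Icc fun w hw => ?_
      rw [← mul_assoc]
      refine mul_le_mul_of_nonneg_right ?_ (fejK_nonneg w)
      have ha : |w / (W / h)| ≤ h := by
        rw [abs_div, abs_of_pos hl, div_le_iff₀ hl]
        have : |w| ≤ W := abs_le.2 hw
        have e : h * (W / h) = W := by field_simp
        rw [e]; exact this
      rw [abs_le] at ha
      apply hmono' <;> linarith [ha.1, ha.2]
    have h2 : ∫ w in Set.Icc (-W) W, Real.exp (2 * h) * (H (y + h - w / (W / h)) * fejK w) ≤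
        Real.exp (2 * h) * ∫ w, H (y + h - w / (W / h)) * fejK w := by
      rw [integral_const_mul]
      refine mul_le_mul_of_nonneg_left ?_ (Real.exp_pos _).le
      refine setIntegral_le_integral (hInteg _ _) (ae_of_all _ fun w => ?_)
      exact mul_nonneg (hH0 _) (fejK_nonneg w)
    rw [integral_const_mul] at h1
    have h3 : H y * ((1 - ε) * c) ≤ Real.exp (2 * h) * ((1 + ε) * c) := by
      calc _ ≤ H y * ∫ w in Set.Icc (-W) W, fejK w := by gcongr; exact hH0 y
        _ ≤ _ := h1
        _ ≤ _ := h2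
        _ ≤ _ := by gcongr
    have h4 : ((1 - ε) * H y) * c ≤ (Real.exp (2 * h) * (1 + ε)) * c := by linarith
    exact le_of_mul_le_mul_right h4 hc
  have hlo : ∀ ε h : ℝ, 0 < ε → ε < 1 → 0 < h →
      ∀ᶠ y in atTop, 1 - ε - M * ε ≤ Real.exp (2 * h) * H y := by
    intro ε h hε hε1 hh
    obtain ⟨W, hW, hWc⟩ := fej_window ε hε
    have hl : 0 < W / h := by positivity
    have hev := (hconv (W / h) hl).eventually (lt_mem_nhds (show (1 - ε) * c < c by nlinarith))
    have hev2 := (tendsto_atTop_add_const_right atTop (-h) tendsto_id).eventually hev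
    filter_upwards [hev2] with y hy
    simp only [id] at hy
    have h1 : ∫ w in Set.Icc (-W) W, H (y + -h - w / (W / h)) * fejK w ≤
        ∫ w in Set.Icc (-W) W, (Real.exp (2 * h) * H y) * fejK w := by
      refine setIntegral_mono_on (hInteg _ _).integrableOn
        (fejK_int.const_mul _).integrableOn measurableSet_Icc fun w hw => ?_
      refine mul_le_mul_of_nonneg_right ?_ (fejK_nonneg w)
      have ha : |w / (W / h)| ≤ h := by
        rw [abs_div, abs_of_pos hl, div_le_iff₀ hl]
        have : |w| ≤ W := abs_le.2 hw
        have e : h * (W / h) = W := by field_simp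
        rw [e]; exact this
      rw [abs_le] at ha
      apply hmono' <;> linarith [ha.1, ha.2]
    have h2 : ∫ w in (Set.Icc (-W) W)ᶜ, H (y + -h - w / (W / h)) * fejK w ≤
        ∫ w in (Set.Icc (-W) W)ᶜ, M * fejK w := by
      refine setIntegral_mono_on (hInteg _ _).integrableOn
        (fejK_int.const_mul _).integrableOn measurableSet_Icc.compl fun w hw => ?_
      exact mul_le_mul_of_nonneg_right (hHb _) (fejK_nonneg w)
    rw [integral_const_mul] at h1 h2
    have h3 := integral_add_compl (measurableSet_Icc (a := -W) (b := W)) (hInteg (y + -h) (W / h))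
    have h4 := integral_add_compl (measurableSet_Icc (a := -W) (b := W)) fejK_int
    have h5 : ∫ w in Set.Icc (-W) W, fejK w ≤ c :=
      setIntegral_le_integral fejK_int (ae_of_all _ fejK_nonneg)
    have h6 : Real.exp (2 * h) * H y * ∫ w in Set.Icc (-W) W, fejK w ≤ Real.exp (2 * h) * H y * c := by
      gcongr
      have := hH0 y
      positivity
    have h7 : M * ∫ w in (Set.Icc (-W) W)ᶜ, fejK w ≤ M * (ε * c) := by
      gcongr
      rw [← hcdef] at h4
      linarith
    have h8 : (1 - ε - M * ε) * c ≤ (Real.exp (2 * h) * H y) * c := by linarith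
    exact le_of_mul_le_mul_right h8 hc
  -- combine
  have hlim : ∀ F : ℝ → ℝ, Continuous F → ∀ η : ℝ, 0 < η → ∃ ε : ℝ, 0 < ε ∧ ε < 1 ∧ |F ε - F 0| < η := by
    intro F hF η hη
    have h1 : Tendsto F (𝓝[>] 0) (𝓝 (F 0)) := hF.continuousAt.continuousWithinAt
    have h2 := (Metric.tendsto_nhds.1 h1 η hη).and (Ioo_mem_nhdsGT (one_pos : (0:ℝ) < 1))
    obtain ⟨ε, he, h3⟩ := h2.exists
    exact ⟨ε, h3.1, h3.2, by simpa [Real.dist_eq] using he⟩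
  refine tendsto_order.2 ⟨fun a ha => ?_, fun a ha => ?_⟩
  · obtain ⟨ε, he0, he1, he⟩ := hlim (fun ε => 1 - ε - M * ε - Real.exp (2 * ε) * a) (by fun_prop) (1 - a) (by linarith)
    filter_upwards [hlo ε ε he0 he1 he0] with y hy
    simp only [sub_zero, mul_zero, Real.exp_zero, one_mul] at he
    rw [abs_lt] at he
    have : Real.exp (2 * ε) * a < Real.exp (2 * ε) * H y := by linarith [he.1]
    exact lt_of_mul_lt_mul_left this (Real.exp_pos _).le
  · obtain ⟨ε, he0, he1, he⟩ := hlim (fun ε => (1 - ε) * a - Real.exp (2 * ε) * (1 + ε)) (by fun_prop) (a - 1) (by linarith)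
    filter_upwards [hup ε ε he0 he1 he0] with y hy
    simp only [sub_zero, mul_zero, Real.exp_zero, one_mul, add_zero] at he
    rw [abs_lt] at he
    have : (1 - ε) * H y < (1 - ε) * a := by linarith [he.1]
    exact lt_of_mul_lt_mul_left this (by linarith)

/-- Normalised Chebyshev function in logarithmic scale. -/
noncomputable def psiH (u : ℝ) : ℝ := Real.exp (-u) * Chebyshev.psi (Real.exp u)

lemma psiH_meas : Measurable psiH := by
  unfold psiH
  have := Chebyshev.psi_mono.measurable
  fun_prop

lemma psiH_nonneg (u : ℝ) : 0 ≤ psiH u :=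
  mul_nonneg (Real.exp_pos _).le (Chebyshev.psi_nonneg _)

lemma psiH_le (u : ℝ) : psiH u ≤ Real.log 4 + 4 := by
  unfold psiH
  have h := Chebyshev.psi_le_const_mul_self (Real.exp_pos u).le
  calc _ ≤ Real.exp (-u) * ((Real.log 4 + 4) * Real.exp u) := by gcongr
    _ = (Real.log 4 + 4) * (Real.exp (-u) * Real.exp u) := by ring
    _ = _ := by rw [← Real.exp_add]; simp

lemma psiH_zero (u : ℝ) (hu : u ≤ 0) : psiH u = 0 := by
  unfold psiH
  rw [Chebyshev.psi_eq_zero_of_le_one (Real.exp_le_one_iff.2 hu), mul_zero]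

lemma psiH_mono (u v : ℝ) (h : u ≤ v) : Real.exp u * psiH u ≤ Real.exp v * psiH v := by
  have : ∀ w, Real.exp w * psiH w = Chebyshev.psi (Real.exp w) := by
    intro w
    unfold psiH
    rw [← mul_assoc, ← Real.exp_add]; simp
  rw [this, this]
  exact Chebyshev.psi_mono (Real.exp_le_exp.2 h)

open ArithmeticFunction.vonMangoldt in
/-- The boundary function. -/
noncomputable def psiG (z : ℂ) : ℂ :=
  (LFunctionResidueClassAux (q := 1) 1 (1 + z) - 1) / (1 + z)

lemma psiG_cont : ContinuousOn psiG {z | 0 ≤ z.re} := by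
  unfold psiG
  refine ContinuousOn.div ?_ (by fun_prop) ?_
  · refine ContinuousOn.sub ?_ continuousOn_const
    refine (ArithmeticFunction.vonMangoldt.continuousOn_LFunctionResidueClassAux (q := 1) 1).comp
      (by fun_prop) ?_
    intro z hz
    simpa using hz
  · intro z hz h
    have := congrArg Complex.re h
    simp at this
    have hz' : 0 ≤ z.re := hz
    linarith

open MeasureTheory Complex Asymptotics Filter in
lemma psi_laplace (z : ℂ) (hz : 0 < z.re) :
    ∫ u in Set.Ioi (0:ℝ), (psiH u : ℂ) * exp (-z * u) =
      LSeries (fun n => (ArithmeticFunction.vonMangoldt n : ℂ)) (1 + z) / (1 + z) := by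
  have hs : (1 : ℝ) < (1 + z).re := by simpa using hz
  have hne : (1 + z) ≠ 0 := by
    intro h
    rw [h] at hs
    simp at hs
    linarith
  have hsum : ∀ t : ℝ, ∑ k ∈ Finset.Icc 1 ⌊t⌋₊, ArithmeticFunction.vonMangoldt k = Chebyshev.psi t := by
    intro t
    rw [Chebyshev.psi]
    rfl
  have hO : (fun n : ℕ => ∑ k ∈ Finset.Icc 1 n, ArithmeticFunction.vonMangoldt k)
      =O[atTop] fun n : ℕ => (n : ℝ) ^ (1:ℝ) := by
    refine IsBigO.of_bound (Real.log 4 + 4) (Eventually.of_forall fun n => ?_)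
    have h1 := hsum n
    rw [Nat.floor_natCast] at h1
    rw [h1, Real.rpow_one, Real.norm_of_nonneg (Chebyshev.psi_nonneg _),
      Real.norm_of_nonneg (Nat.cast_nonneg n)]
    exact Chebyshev.psi_le_const_mul_self (Nat.cast_nonneg n)
  have := LSeries_eq_mul_integral_of_nonneg (fun n => ArithmeticFunction.vonMangoldt n) zero_le_one
    hs hO (fun n => ArithmeticFunction.vonMangoldt_nonneg)
  rw [this, mul_div_cancel_left₀ _ hne]
  have him : Real.exp '' Set.Ioi 0 = Set.Ioi 1 := by
    ext x
    constructor
    · rintro ⟨u, hu, rfl⟩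
      exact Real.one_lt_exp_iff.2 hu
    · intro hx
      exact ⟨Real.log x, Real.log_pos hx, Real.exp_log (one_pos.trans hx)⟩
  rw [← him, integral_image_eq_integral_abs_deriv_smul measurableSet_Ioi
    (fun x _ => (Real.hasDerivAt_exp x).hasDerivWithinAt) Real.exp_injective.injOn]
  refine setIntegral_congr_fun measurableSet_Ioi fun u _ => ?_
  rw [← ofReal_sum, hsum, abs_of_pos (Real.exp_pos u), real_smul, psiH]
  have e : ((Real.exp u : ℝ) : ℂ) ^ (-(1 + z + 1)) = exp (-(1 + z + 1) * u) := by
    rw [ofReal_exp, cpow_def_of_ne_zero (exp_ne_zero _), ← ofReal_exp, ← ofReal_log (Real.exp_pos u).le, Real.log_exp]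
    ring_nf
  rw [e]
  push_cast
  have e2 : exp (-u) * exp (-z * u) = exp u * exp (-(1 + z + 1) * u) := by
    rw [← exp_add, ← exp_add]; ring_nf
  linear_combination (Chebyshev.psi (Real.exp u) : ℂ) * e2

open MeasureTheory Complex Filter in
lemma psi_laplace' (z : ℂ) (hz : 0 < z.re) :
    ∫ u in Set.Ioi (0:ℝ), ((psiH u - 1 : ℝ) : ℂ) * exp (-z * u) = psiG z := by
  have hz0 : z ≠ 0 := by rintro rfl; simp at hz
  have hne : (1 + z) ≠ 0 := by
    intro h
    have := congrArg Complex.re h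
    simp at this
    linarith
  have hi1 : IntegrableOn (fun u : ℝ => exp (-z * u)) (Set.Ioi 0) :=
    integrableOn_exp_mul_complex_Ioi (by simpa using hz) 0
  have hi2 : IntegrableOn (fun u : ℝ => (psiH u : ℂ) * exp (-z * u)) (Set.Ioi 0) := by
    refine Integrable.bdd_mul (c := Real.log 4 + 4) hi1 ?_ ?_
    · exact (measurable_ofReal.comp psiH_meas).aestronglyMeasurable
    · refine ae_of_all _ fun u => ?_
      rw [norm_real, Real.norm_of_nonneg (psiH_nonneg u)]
      exact psiH_le u
  have h1 : ∫ u in Set.Ioi (0:ℝ), ((psiH u - 1 : ℝ) : ℂ) * exp (-z * u) =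
      (∫ u in Set.Ioi (0:ℝ), (psiH u : ℂ) * exp (-z * u)) - ∫ u in Set.Ioi (0:ℝ), exp (-z * u) := by
    rw [← integral_sub hi2 hi1]
    congr 1; ext u
    push_cast; ring
  rw [h1, psi_laplace z hz, integral_exp_mul_complex_Ioi (by simpa using hz) 0, psiG]
  have h2 := ArithmeticFunction.vonMangoldt.eqOn_LFunctionResidueClassAux (q := 1) (a := 1) isUnit_one
    (show (1 + z) ∈ {s : ℂ | 1 < s.re} by simpa using hz)
  rw [h2]
  have h3 : (fun n : ℕ => ((ArithmeticFunction.vonMangoldt.residueClass (1 : ZMod 1) n : ℝ) : ℂ)) =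
      fun n => (ArithmeticFunction.vonMangoldt n : ℂ) := by
    ext n
    have : (n : ZMod 1) = 1 := Subsingleton.elim _ _
    simp [ArithmeticFunction.vonMangoldt.residueClass, this]
  simp only [h3]
  simp
  field_simp
  ring

open Filter Topology in
/-- The prime number theorem for `ψ`. -/
theorem pnt_psiH : Tendsto psiH atTop (𝓝 1) :=
  wi_tauber psiH _ psiH_meas psiH_nonneg psiH_le psiH_mono
    (fun l hl => wi_conv' psiH _ psiH_meas psiH_nonneg psiH_le psiH_zero psiG psiG_cont psi_laplace' l hl)

open Filter Topology in
theorem pnt_psi : Tendsto (fun x : ℝ => Chebyshev.psi x / x) atTop (𝓝 1) := by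
  refine (pnt_psiH.comp Real.tendsto_log_atTop).congr' ?_
  filter_upwards [eventually_gt_atTop 0] with x hx
  simp only [Function.comp, psiH]
  rw [Real.exp_neg, Real.exp_log hx]
  field_simp

open Filter Topology Asymptotics in
theorem pnt_pi : Tendsto (fun x : ℝ => (Nat.primeCounting ⌊x⌋₊ : ℝ) / (x / Real.log x)) atTop (𝓝 1) := by
  obtain ⟨C, hC⟩ := Chebyshev.psi_sub_theta_le_mul_sqrt
  have h1 : Tendsto (fun x : ℝ => (Chebyshev.psi x - Chebyshev.theta x) / x) atTop (𝓝 0) := by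
    have h0 : Tendsto (fun x : ℝ => C * (Real.sqrt x)⁻¹) atTop (𝓝 (C * 0)) :=
      (Real.tendsto_sqrt_atTop.inv_tendsto_atTop).const_mul C
    rw [mul_zero] at h0
    refine squeeze_zero' ?_ ?_ h0
    · filter_upwards [eventually_gt_atTop 0] with x hx
      have := Chebyshev.theta_le_psi x
      exact div_nonneg (by linarith) hx.le
    · filter_upwards [eventually_gt_atTop 0] with x hx
      have h2 : Real.sqrt x * Real.sqrt x = x := Real.mul_self_sqrt hx.le
      have h3 : 0 < Real.sqrt x := Real.sqrt_pos.2 hx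
      rw [div_le_iff₀ hx]
      calc _ ≤ C * Real.sqrt x := hC x
        _ = C * (Real.sqrt x)⁻¹ * (Real.sqrt x * Real.sqrt x) := by field_simp
        _ = _ := by rw [h2]
  have h2 := (pnt_psi.sub h1).add
    (Chebyshev.integral_theta_div_log_sq_isLittleO.tendsto_div_nhds_zero)
  simp only [sub_zero, add_zero] at h2
  refine h2.congr' ?_
  filter_upwards [eventually_ge_atTop 2] with x hx
  rw [Chebyshev.primeCounting_eq_theta_div_log_add_integral hx]
  have : 0 < Real.log x := Real.log_pos (by linarith)
  field_simp
  ring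

lemma sigma1_prime_mul {p m : ℕ} (hp : p.Prime) (hpm : ¬ p ∣ m) :
    sigma1 (p * m) = (p + 1) * sigma1 m := by
  unfold sigma1
  rw [ArithmeticFunction.isMultiplicative_sigma.map_mul_of_coprime ((Nat.Prime.coprime_iff_not_dvd hp).2 hpm)]
  congr 1
  rw [ArithmeticFunction.sigma_one_apply, hp.divisors, Finset.sum_pair hp.one_lt.ne]
  ring

/-- Regular solutions are solutions. -/
lemma regular_sol {a b k m p : ℕ} (ham : a * m = k) (hbm : b * sigma1 m = k) (hp : p.Prime)
    (hpm : ¬ p ∣ m) : b * sigma1 (p * m) = a * (p * m) + k := by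
  rw [sigma1_prime_mul hp hpm]
  nlinarith

/-- The complementary factor determines the prime in an irregular solution. -/
lemma irregular_inj {a b k m p q c : ℕ} (ha : 0 < a) (ham : a * m = k)
    (hp : p.Prime) (hq : q.Prime) (hpc : ¬ p ∣ c) (hqc : ¬ q ∣ c)
    (h1 : b * sigma1 (p * c) = a * (p * c) + k) (h2 : b * sigma1 (q * c) = a * (q * c) + k)
    (hirr : ¬ ∃ r : ℕ, r.Prime ∧ ¬ r ∣ m ∧ p * c = r * m) : p = q := by
  rw [sigma1_prime_mul hp hpc] at h1
  rw [sigma1_prime_mul hq hqc] at h2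
  zify at h1 h2 ham
  have h3 : ((p:ℤ) - q) * (b * sigma1 c - a * c) = 0 := by linear_combination h1 - h2
  rcases mul_eq_zero.1 h3 with h | h
  · have : (p:ℤ) = q := by linarith
    exact_mod_cast this
  · exfalso
    have h4 : (a:ℤ) * c = a * m := by
      rw [ham]; linear_combination h1 - (p + 1) * h
    have ha' : (a:ℤ) ≠ 0 := by exact_mod_cast ha.ne'
    have h5 : c = m := by exact_mod_cast mul_left_cancel₀ ha' h4
    subst h5
    exact hirr ⟨p, hp, hpc, rfl⟩

open Classical in
/-- Finset of irregular solutions. -/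
noncomputable def irr (a b k m N : ℕ) : Finset ℕ :=
  (Finset.Icc 1 N).filter (fun n => b * sigma1 n = a * n + k ∧
    ¬ ∃ r : ℕ, r.Prime ∧ ¬ r ∣ m ∧ n = r * m)

open Classical in
lemma irr_card {a b k m : ℕ} (N Y : ℕ) (ha : 0 < a) (ham : a * m = k) (hY : 1 ≤ Y) :
    ((irr a b k m N).card : ℝ) ≤ 2 ^ Y.primesBelow.card * Real.sqrt N + 3 * (N / Y) := by
  set T2 : Finset ℕ := (Finset.Ioo (Y - 1) (N + 1)).biUnion
    (fun d => (Finset.Icc 1 N).filter (fun n => d ^ 2 ∣ n)) with hT2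
  set T3 : Finset ℕ := (irr a b k m N).filter (fun n => ∃ p : ℕ, p.Prime ∧ Y ≤ p ∧ p ∣ n ∧ ¬ p ^ 2 ∣ n)
    with hT3
  have hsub : irr a b k m N ⊆ Nat.smoothNumbersUpTo N Y ∪ (T2 ∪ T3) := by
    intro n hn
    have hn' := hn
    simp only [irr, Finset.mem_filter, Finset.mem_Icc] at hn'
    rw [Finset.mem_union, Finset.mem_union, Nat.mem_smoothNumbersUpTo]
    by_cases hs : ∀ p : ℕ, p.Prime → p ∣ n → p < Y
    · left
      refine ⟨hn'.1.2, ?_⟩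
      exact Nat.mem_smoothNumbers'.2 hs
    · right
      push Not at hs
      obtain ⟨p, hp, hpn, hYp⟩ := hs
      by_cases hp2 : p ^ 2 ∣ n
      · left
        rw [hT2, Finset.mem_biUnion]
        have hle : p ≤ n := Nat.le_of_dvd (by omega) hpn
        refine ⟨p, Finset.mem_Ioo.2 ⟨by omega, by omega⟩, ?_⟩
        rw [Finset.mem_filter, Finset.mem_Icc]
        exact ⟨hn'.1, hp2⟩
      · right
        rw [hT3, Finset.mem_filter]
        exact ⟨hn, p, hp, hYp, hpn, hp2⟩
  have c1 : ((Nat.smoothNumbersUpTo N Y).card : ℝ) ≤ 2 ^ Y.primesBelow.card * Real.sqrt N := by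
    have h := Nat.smoothNumbersUpTo_card_le N Y
    have h' : ((Nat.smoothNumbersUpTo N Y).card : ℝ) ≤ 2 ^ Y.primesBelow.card * (N.sqrt : ℝ) := by
      exact_mod_cast h
    refine h'.trans ?_
    gcongr
    exact Real.nat_sqrt_le_real_sqrt
  have c2 : (T2.card : ℝ) ≤ 2 * (N / Y) := by
    have h : (T2.card : ℝ) ≤ ∑ d ∈ Finset.Ioo (Y - 1) (N + 1), (N : ℝ) * ((d : ℝ) ^ 2)⁻¹ := by
      calc (T2.card : ℝ) ≤ ∑ d ∈ Finset.Ioo (Y - 1) (N + 1),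
            (((Finset.Icc 1 N).filter (fun n => d ^ 2 ∣ n)).card : ℝ) := by
              exact_mod_cast Finset.card_biUnion_le
        _ ≤ _ := by
              refine Finset.sum_le_sum fun d hd => ?_
              have e : (Finset.Icc 1 N) = Finset.Ioc 0 N := rfl
              rw [e, Nat.Ioc_filter_dvd_card_eq_div]
              refine Nat.cast_div_le.trans (le_of_eq ?_)
              push_cast
              rw [div_eq_mul_inv]
    rw [← Finset.mul_sum] at h
    have h2 := sum_Ioo_inv_sq_le (α := ℝ) (Y - 1) (N + 1)
    have e : ((Y - 1 : ℕ) : ℝ) + 1 = Y := by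
      rw [Nat.cast_sub hY]; simp
    rw [e] at h2
    calc _ ≤ _ := h
      _ ≤ (N : ℝ) * (2 / Y) := by gcongr
      _ = _ := by ring
  have c3 : (T3.card : ℝ) ≤ N / Y := by
    have hch : ∀ n ∈ T3, ∃ p : ℕ, p.Prime ∧ Y ≤ p ∧ p ∣ n ∧ ¬ p ^ 2 ∣ n := by
      intro n hn
      exact (Finset.mem_filter.1 hn).2
    choose! P hP using hch
    have hinj : T3.card ≤ (Finset.Icc 1 (N / Y)).card := by
      refine Finset.card_le_card_of_injOn (fun n => n / P n) ?_ ?_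
      · intro n hn
        obtain ⟨hp, hYp, hpn, hp2⟩ := hP n hn
        have hn1 := (Finset.mem_filter.1 hn).1
        simp only [irr, Finset.mem_filter, Finset.mem_Icc] at hn1
        simp only [Finset.coe_Icc, Set.mem_Icc]
        constructor
        · exact Nat.div_pos (Nat.le_of_dvd (by omega) hpn) hp.pos
        · exact Nat.div_le_div hn1.1.2 hYp (by omega)
      · intro n hn n' hn' heq
        obtain ⟨hp, hYp, hpn, hp2⟩ := hP n hn
        obtain ⟨hq, hYq, hqn, hq2⟩ := hP n' hn'
        have hn1 := (Finset.mem_filter.1 hn).1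
        have hn1' := (Finset.mem_filter.1 hn').1
        simp only [irr, Finset.mem_filter, Finset.mem_Icc] at hn1 hn1'
        simp only at heq
        obtain ⟨c, hc⟩ := hpn
        obtain ⟨c', hc'⟩ := hqn
        have e1 : n / P n = c := by
          conv_lhs => arg 1; rw [hc]
          exact Nat.mul_div_cancel_left c hp.pos
        have e2 : n' / P n' = c' := by
          conv_lhs => arg 1; rw [hc']
          exact Nat.mul_div_cancel_left c' hq.pos
        rw [e1, e2] at heq
        rw [← heq] at hc'
        have d1 : ¬ P n ∣ c := by
          intro h
          apply hp2
          rw [hc, pow_two]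
          have hh := Nat.mul_dvd_mul_left (P n) h
          rw [← hc] at hh ⊢
          exact hh
        have d2 : ¬ P n' ∣ c := by
          intro h
          apply hq2
          have hh := Nat.mul_dvd_mul_left (P n') h
          rw [← hc'] at hh
          rw [pow_two]
          exact hh
        have s1 := hn1.2.1
        have s2 := hn1'.2.1
        have s3 := hn1.2.2
        have := irregular_inj (a := a) (b := b) (k := k) (m := m) ha ham hp hq d1 d2
          (by rw [← hc]; exact s1) (by rw [← hc']; exact s2) (by rw [← hc]; exact s3)
        rw [hc, hc', this]
    rw [Nat.card_Icc, Nat.add_sub_cancel] at hinj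
    calc (T3.card : ℝ) ≤ ((N / Y : ℕ) : ℝ) := by exact_mod_cast hinj
      _ ≤ _ := Nat.cast_div_le
  have c0 : ((irr a b k m N).card : ℝ) ≤
      (Nat.smoothNumbersUpTo N Y).card + (T2.card + T3.card) := by
    have h1 := Finset.card_le_card hsub
    have h2 := Finset.card_union_le (Nat.smoothNumbersUpTo N Y) (T2 ∪ T3)
    have h3 := Finset.card_union_le T2 T3
    exact_mod_cast h1.trans (h2.trans (by omega))
  linarith

open Classical in
/-- Comparison of the solution count with the prime counting function. -/
lemma sol_card {a b k m : ℕ} (hm : 1 ≤ m) (ham : a * m = k) (hbm : b * sigma1 m = k)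
    (x : ℝ) (hx : 0 ≤ x) :
    ({n : ℕ | 1 ≤ n ∧ (n : ℝ) ≤ x ∧ b * sigma1 n = a * n + k}.ncard : ℝ) ≤
      Nat.primeCounting ⌊x / m⌋₊ + (irr a b k m ⌊x⌋₊).card ∧
    (Nat.primeCounting ⌊x / m⌋₊ : ℝ) ≤
      {n : ℕ | 1 ≤ n ∧ (n : ℝ) ≤ x ∧ b * sigma1 n = a * n + k}.ncard + m := by
  set S : Finset ℕ := (Finset.Icc 1 ⌊x⌋₊).filter (fun n => b * sigma1 n = a * n + k) with hS
  have hSe : {n : ℕ | 1 ≤ n ∧ (n : ℝ) ≤ x ∧ b * sigma1 n = a * n + k} = (S : Set ℕ) := by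
    ext n
    simp only [hS, Set.mem_ofPred_eq, Finset.coe_filter, Finset.mem_Icc, Nat.le_floor_iff hx]
    tauto
  rw [hSe, Set.ncard_coe_finset]
  have hm0 : (0:ℝ) < m := by exact_mod_cast hm
  set Q : Finset ℕ := (⌊x / m⌋₊ + 1).primesBelow with hQ
  have hQc : Q.card = Nat.primeCounting ⌊x / m⌋₊ := by
    rw [hQ, Nat.primesBelow_card_eq_primeCounting']
    rfl
  have hQm : ∀ p, p ∈ Q ↔ p.Prime ∧ p * m ≤ ⌊x⌋₊ := by
    intro p
    rw [hQ, Nat.mem_primesBelow, Nat.lt_succ_iff, Nat.le_floor_iff (by positivity), le_div_iff₀ hm0,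
      Nat.le_floor_iff hx]
    push_cast
    tauto
  rw [← hQc]
  constructor
  · have hsub : S ⊆ Q.image (fun p => p * m) ∪ irr a b k m ⌊x⌋₊ := by
      intro n hn
      rw [hS, Finset.mem_filter] at hn
      rw [Finset.mem_union]
      by_cases hr : ∃ r : ℕ, r.Prime ∧ ¬ r ∣ m ∧ n = r * m
      · left
        obtain ⟨r, hr, hrm, rfl⟩ := hr
        rw [Finset.mem_image]
        refine ⟨r, (hQm r).2 ⟨hr, (Finset.mem_Icc.1 hn.1).2⟩, rfl⟩
      · right
        rw [irr, Finset.mem_filter]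
        exact ⟨hn.1, hn.2, hr⟩
    have h1 := Finset.card_le_card hsub
    have h2 := Finset.card_union_le (Q.image (fun p => p * m)) (irr a b k m ⌊x⌋₊)
    have h3 : (Q.image (fun p => p * m)).card ≤ Q.card := Finset.card_image_le
    exact_mod_cast h1.trans (h2.trans (by omega))
  · have hsub : Q ⊆ S.image (fun n => n / m) ∪ Finset.Icc 1 m := by
      intro p hp
      rw [hQm] at hp
      rw [Finset.mem_union]
      by_cases hpm : p ∣ m
      · right
        exact Finset.mem_Icc.2 ⟨hp.1.pos, Nat.le_of_dvd hm hpm⟩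
      · left
        rw [Finset.mem_image]
        refine ⟨p * m, ?_, Nat.mul_div_cancel p hm⟩
        rw [hS, Finset.mem_filter, Finset.mem_Icc]
        exact ⟨⟨Nat.mul_pos hp.1.pos hm, hp.2⟩, regular_sol ham hbm hp.1 hpm⟩
    have h1 := Finset.card_le_card hsub
    have h2 := Finset.card_union_le (S.image (fun n => n / m)) (Finset.Icc 1 m)
    have h3 : (S.image (fun n => n / m)).card ≤ S.card := Finset.card_image_le
    rw [Nat.card_Icc, Nat.add_sub_cancel] at h2
    exact_mod_cast h1.trans (h2.trans (by omega))

open Filter Topology in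
lemma pi_littleo : Tendsto (fun x : ℝ => (Nat.primeCounting ⌊x⌋₊ : ℝ) / x) atTop (𝓝 0) := by
  have h := pnt_pi.mul (Real.tendsto_log_atTop.inv_tendsto_atTop)
  rw [mul_zero] at h
  refine h.congr' ?_
  filter_upwards [eventually_gt_atTop 1] with x hx
  have : 0 < Real.log x := Real.log_pos hx
  simp only [Pi.inv_apply]
  field_simp

open Filter Topology in
lemma irr_small {a b k m : ℕ} (ha : 0 < a) (ham : a * m = k) :
    Tendsto (fun x : ℝ => ((irr a b k m ⌊x⌋₊).card : ℝ) / (x / Real.log x)) atTop (𝓝 0) := by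
  refine tendsto_order.2 ⟨fun c hc => ?_, fun ε hε => ?_⟩
  · filter_upwards [eventually_gt_atTop 1] with x hx
    have : 0 < Real.log x := Real.log_pos hx
    exact hc.trans_le (by positivity)
  set K : ℝ := 6 / ε with hK
  have hK0 : 0 < K := by positivity
  have hY : Tendsto (fun x : ℝ => ((⌈K * Real.log x⌉₊ : ℕ) : ℝ)) atTop atTop :=
    tendsto_natCast_atTop_atTop.comp (tendsto_nat_ceil_atTop.comp
      (Real.tendsto_log_atTop.const_mul_atTop hK0))
  have h1 := hY.eventually (pi_littleo.eventually (gt_mem_nhds (show (0:ℝ) < 1 / (8 * K) by positivity)))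
  have h2 : Tendsto (fun x : ℝ => Real.log x / x ^ (1 / 4 : ℝ)) atTop (𝓝 0) :=
    (isLittleO_log_rpow_atTop (by norm_num)).tendsto_div_nhds_zero
  have h3 := h2.eventually (gt_mem_nhds (show (0:ℝ) < ε / 2 by positivity))
  have h4 := (Real.tendsto_log_atTop.const_mul_atTop hK0).eventually (eventually_ge_atTop 1)
  filter_upwards [h1, h3, h4, eventually_gt_atTop 1] with x hx1 hx3 hx4 hx
  have hlog : 0 < Real.log x := Real.log_pos hx
  have hx0 : 0 < x := by linarith
  set Y := ⌈K * Real.log x⌉₊ with hYdef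
  have hYge : K * Real.log x ≤ Y := Nat.le_ceil _
  have hYle : (Y : ℝ) ≤ 2 * K * Real.log x := by
    have := Nat.ceil_lt_add_one (show 0 ≤ K * Real.log x by positivity)
    linarith
  have hY0 : (0:ℝ) < Y := by linarith
  have hY1 : 1 ≤ Y := by exact_mod_cast hY0
  rw [Nat.floor_natCast, div_lt_iff₀ hY0] at hx1
  have hpi : (Y.primesBelow.card : ℝ) ≤ 1 / 4 * Real.log x := by
    have e : Y.primesBelow.card ≤ Nat.primeCounting Y := by
      rw [Nat.primesBelow_card_eq_primeCounting']
      exact Nat.monotone_primeCounting' (Nat.le_succ Y)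
    have e' : (Y.primesBelow.card : ℝ) ≤ Nat.primeCounting Y := by exact_mod_cast e
    calc _ ≤ _ := e'
      _ ≤ _ := hx1.le
      _ ≤ 1 / (8 * K) * (2 * K * Real.log x) := by gcongr
      _ = _ := by field_simp; norm_num
  have hpow : (2:ℝ) ^ Y.primesBelow.card ≤ x ^ (1 / 4 : ℝ) := by
    rw [← Real.rpow_natCast, Real.rpow_def_of_pos two_pos, Real.rpow_def_of_pos hx0]
    apply Real.exp_le_exp.2
    have l2 : Real.log 2 ≤ 1 := by have := Real.log_two_lt_d9; linarith
    calc _ ≤ 1 * (Y.primesBelow.card : ℝ) := by gcongr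
      _ ≤ _ := by linarith
  have hfl : ((⌊x⌋₊ : ℕ) : ℝ) ≤ x := Nat.floor_le hx0.le
  have hb := irr_card (a := a) (b := b) (k := k) (m := m) ⌊x⌋₊ Y ha ham hY1
  have hb2 : ((irr a b k m ⌊x⌋₊).card : ℝ) ≤ x ^ (1/4:ℝ) * x ^ (1/2:ℝ) + 3 * (x / (K * Real.log x)) := by
    refine hb.trans ?_
    rw [← Real.sqrt_eq_rpow]
    gcongr
  rw [div_lt_iff₀ (by positivity)]
  refine lt_of_le_of_lt hb2 ?_
  have e1 : x = x ^ (1/4:ℝ) * x ^ (1/2:ℝ) * x ^ (1/4:ℝ) := by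
    rw [← Real.rpow_add hx0, ← Real.rpow_add hx0]; norm_num
  have e2 : 3 * (x / (K * Real.log x)) = ε / 2 * (x / Real.log x) := by
    rw [hK]; field_simp; norm_num
  have hq : 0 < x ^ (1/4:ℝ) := Real.rpow_pos_of_pos hx0 _
  have hh : 0 < x ^ (1/2:ℝ) := Real.rpow_pos_of_pos hx0 _
  have e3 : x ^ (1/4:ℝ) * x ^ (1/2:ℝ) < ε / 2 * (x / Real.log x) := by
    rw [div_lt_iff₀ hq] at hx3
    rw [← mul_div_assoc, lt_div_iff₀ hlog]
    calc _ < x ^ (1/4:ℝ) * x ^ (1/2:ℝ) * (ε / 2 * x ^ (1/4:ℝ)) := by gcongr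
      _ = ε / 2 * (x ^ (1/4:ℝ) * x ^ (1/2:ℝ) * x ^ (1/4:ℝ)) := by ring
      _ = _ := by rw [← e1]
  rw [e2]
  linarith

theorem stmt_7 (a b : ℕ) (hb : 1 ≤ b) (hba : b < a) (hab : Nat.Coprime a b)
    (k : ℕ) (hk : 1 ≤ k) (hdvd : a * b ∣ k) (hsig : sigma1 (k / a) = k / b) :
    Filter.Tendsto (fun x : ℝ =>
        ({n : ℕ | 1 ≤ n ∧ (n : ℝ) ≤ x ∧ b * sigma1 n = a * n + k}.ncard : ℝ) /
          (((a : ℝ) / k) * x / Real.log ((a : ℝ) * x / k)))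
      Filter.atTop (nhds 1) := by
  have ha : 0 < a := by omega
  have hak : a ∣ k := (Dvd.intro b rfl).trans hdvd
  have hbk : b ∣ k := (Dvd.intro_left a rfl).trans hdvd
  obtain ⟨m, hm⟩ := hak
  have ham : a * m = k := hm.symm
  have hkm : k / a = m := by rw [hm]; exact Nat.mul_div_cancel_left m ha
  rw [hkm] at hsig
  have hbm : b * sigma1 m = k := by rw [hsig]; exact Nat.mul_div_cancel' hbk
  have hm1 : 1 ≤ m := by
    rcases Nat.eq_zero_or_pos m with h | h
    · subst h; omega
    · exact h
  have hmR : (1:ℝ) ≤ m := by exact_mod_cast hm1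
  have hm0 : (0:ℝ) < m := by linarith
  have haR : (0:ℝ) < a := by exact_mod_cast ha
  have hden : ∀ x : ℝ, ((a : ℝ) / k) * x / Real.log ((a : ℝ) * x / k) =
      (x / m) / Real.log (x / m) := by
    intro x
    have hk' : (k:ℝ) = a * m := by rw [hm]; push_cast; ring
    have e1 : ((a : ℝ) / k) * x = x / m := by rw [hk']; field_simp
    have e2 : (a : ℝ) * x / k = x / m := by rw [hk']; field_simp
    rw [e1, e2]
  simp_rw [hden]
  have htm : Filter.Tendsto (fun x : ℝ => x / m) Filter.atTop Filter.atTop :=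
    Filter.tendsto_id.atTop_div_const hm0
  have hpi := pnt_pi.comp htm
  -- lower error
  have hlo : Filter.Tendsto (fun x : ℝ => (m:ℝ) / ((x / m) / Real.log (x / m))) Filter.atTop (nhds 0) := by
    have h : Filter.Tendsto (fun y : ℝ => (m:ℝ) * (Real.log y / y)) Filter.atTop (nhds (m * 0)) :=
      (Real.isLittleO_log_id_atTop.tendsto_div_nhds_zero).const_mul _
    rw [mul_zero] at h
    refine (h.comp htm).congr fun x => ?_
    show (m:ℝ) * (Real.log (x / m) / (x / m)) = _
    generalize x / (m:ℝ) = y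
    rw [div_div_eq_mul_div, mul_div_assoc]
  have hup := (irr_small (b := b) ha ham).const_mul (m:ℝ)
  rw [mul_zero] at hup
  have hL := hpi.sub hlo
  have hU := hpi.add hup
  rw [sub_zero] at hL
  rw [add_zero] at hU
  have hxm := htm.eventually (Filter.eventually_gt_atTop 1)
  refine tendsto_of_tendsto_of_tendsto_of_le_of_le' hL hU ?_ ?_
  · filter_upwards [hxm, Filter.eventually_gt_atTop 1] with x hx hx1
    have hlog := Real.log_pos hx
    have hD : 0 < (x / m) / Real.log (x / m) := div_pos (by linarith) hlog
    obtain ⟨-, h2⟩ := sol_card hm1 ham hbm x (by linarith)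
    simp only [Function.comp]
    rw [← sub_div]
    gcongr
    linarith
  · filter_upwards [hxm, Filter.eventually_gt_atTop 1] with x hx hx1
    have hlog := Real.log_pos hx
    have hD : 0 < (x / m) / Real.log (x / m) := div_pos (by linarith) hlog
    obtain ⟨h1, -⟩ := sol_card hm1 ham hbm x (by linarith)
    simp only [Function.comp]
    have hlx := Real.log_pos hx1
    have hx0 : 0 < x := by linarith
    have hle : Real.log (x / m) ≤ Real.log x :=
      Real.log_le_log (by positivity) (div_le_self hx0.le hmR)
    have h3 : ((irr a b k m ⌊x⌋₊).card : ℝ) / ((x / m) / Real.log (x / m)) ≤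
        m * (((irr a b k m ⌊x⌋₊).card : ℝ) / (x / Real.log x)) := by
      have e1 : ((irr a b k m ⌊x⌋₊).card : ℝ) / ((x / m) / Real.log (x / m)) =
        (irr a b k m ⌊x⌋₊).card * m / x * Real.log (x / m) := by field_simp
      have e2 : m * (((irr a b k m ⌊x⌋₊).card : ℝ) / (x / Real.log x)) =
        (irr a b k m ⌊x⌋₊).card * m / x * Real.log x := by field_simp
      rw [e1, e2]
      gcongr
    refine le_trans (div_le_div_of_nonneg_right h1 hD.le) ?_
    rw [add_div]
    linarith
end

section
/- For every ε > 0 there exists a constant C > 0 (independent of a, b, k, x) such that the following holds: for all coprime integers a > b ≥ 1 and every nonzero integer k for which it is NOT the case that (k ≥ 1 and ab | k and σ(k/a) = k/b), and for every real x ≥ 1 with |k| < b·x^{2/3}, one has #S(a,b;k;x) ≤ C · b² · x^{2/3 + ε}. In particular this bound is uniform in a. -/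
theorem dbound (δ : ℝ) (hδ : 0 < δ) : ∃ C : ℝ, 1 ≤ C ∧ ∀ n : ℕ, n ≠ 0 →
    (n.divisors.card : ℝ) ≤ C * (n : ℝ) ^ δ := by
  have hL : 0 < Real.log 2 := Real.log_pos (by norm_num)
  set K : ℝ := 1 + 1 / (δ * Real.log 2) with hK
  have hK1 : 1 ≤ K := by
    have : 0 < 1 / (δ * Real.log 2) := by positivity
    linarith
  set P : ℕ := ⌈(2:ℝ) ^ (1 / δ)⌉₊ with hP
  refine ⟨K ^ P, one_le_pow₀ hK1, fun n hn => ?_⟩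
  have hn' : ((n:ℝ)) ^ δ = ∏ p ∈ n.primeFactors, ((p:ℝ) ^ (n.factorization p)) ^ δ := by
    rw [Real.finsetProd_rpow _ _ (fun i _ => by positivity)]
    congr 1
    conv_lhs => rw [← Nat.prod_factorization_pow_eq_self hn]
    rw [Finsupp.prod]
    push_cast
    rfl
  rw [Nat.card_divisors hn, hn']
  push_cast
  have key : ∀ p ∈ n.primeFactors, ((n.factorization p : ℝ) + 1) ≤
      (if p < P then K else 1) * ((p:ℝ) ^ (n.factorization p)) ^ δ := by
    intro p hp
    have hpp := Nat.prime_of_mem_primeFactors hp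
    have hp2 : (2:ℝ) ≤ p := by exact_mod_cast hpp.two_le
    set e := n.factorization p
    have e0 : ((p:ℝ) ^ e) ^ δ = ((p:ℝ) ^ δ) ^ e := by
      rw [← Real.rpow_natCast, ← Real.rpow_mul (by positivity), mul_comm, Real.rpow_mul (by positivity), Real.rpow_natCast]
    split_ifs with h
    · have h1 : 1 + δ * Real.log 2 * e ≤ ((p:ℝ) ^ e) ^ δ := by
        calc 1 + δ * Real.log 2 * e ≤ Real.exp (δ * Real.log 2 * e) := by
              linarith [Real.add_one_le_exp (δ * Real.log 2 * e)]
          _ = ((2:ℝ) ^ e) ^ δ := by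
              rw [← Real.rpow_natCast, ← Real.rpow_mul (by positivity), Real.rpow_def_of_pos (by norm_num)]
              ring_nf
          _ ≤ _ := by gcongr
      calc (e:ℝ) + 1 ≤ K * (1 + δ * Real.log 2 * e) := by
            have : K * (1 + δ * Real.log 2 * e) = 1 + 1 / (δ * Real.log 2) + δ * Real.log 2 * e + e := by
              rw [hK]; field_simp; ring
            rw [this]
            have : 0 < 1 / (δ * Real.log 2) := by positivity
            have : 0 ≤ δ * Real.log 2 * e := by positivity
            linarith
        _ ≤ _ := by gcongr
    · have h2 : (2:ℝ) ≤ (p:ℝ) ^ δ := by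
        have : (2:ℝ) ^ (1/δ) ≤ p := (Nat.le_ceil _).trans (by exact_mod_cast not_lt.mp h)
        calc (2:ℝ) = ((2:ℝ) ^ (1/δ)) ^ δ := by
              rw [← Real.rpow_mul (by norm_num)]; field_simp; simp
          _ ≤ _ := by gcongr
      rw [e0, one_mul]
      calc (e:ℝ) + 1 ≤ (2:ℝ) ^ e := by exact_mod_cast Nat.lt_two_pow_self
        _ ≤ _ := by gcongr
  refine (Finset.prod_le_prod (fun _ _ => by positivity) key).trans ?_
  rw [Finset.prod_mul_distrib]
  gcongr
  rw [Finset.prod_ite]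
  simp only [Finset.prod_const, one_pow, mul_one]
  apply pow_le_pow_right₀ hK1
  calc _ ≤ (Finset.range P).card := Finset.card_le_card (by
        intro p; simp)
    _ = P := by simp

theorem structure_lemma (n : ℕ) (y : ℝ) (hn1 : y ^ 2 < n) (hn2 : (n:ℝ) ≤ y ^ 3) :
    (∃ m r : ℕ, n = m * r ∧ m.Coprime r ∧ y ≤ m ∧ (m:ℝ) ≤ y ^ 2) ∨
    (∃ p e m : ℕ, p.Prime ∧ 1 ≤ e ∧ ¬ p ∣ m ∧ (m:ℝ) ≤ y ∧ n = p ^ e * m) := by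
  have hy : 1 < y := by
    by_contra h
    push Not at h
    nlinarith [sq_nonneg y]
  have hn0 : 0 < n := by
    rcases Nat.eq_zero_or_pos n with h | h
    · subst h; push_cast at hn1; nlinarith [sq_nonneg y]
    · exact h
  have hn0' : (0:ℝ) < n := by exact_mod_cast hn0
  classical
  set U := n.divisors.filter (fun m : ℕ => m.Coprime (n / m) ∧ (m:ℝ) < y) with hU
  have hUne : U.Nonempty := ⟨1, by simp [hU, hn0.ne', hy]⟩
  obtain ⟨m0, hm0, hmax⟩ := U.exists_max_image id hUne
  simp only [hU, Finset.mem_filter, Nat.mem_divisors, id] at hm0 hmax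
  obtain ⟨⟨⟨r, hr⟩, -⟩, hcop, hlt⟩ := hm0
  have hm0pos : 0 < m0 := by
    rcases Nat.eq_zero_or_pos m0 with h | h
    · subst h; omega
    · exact h
  have hdiv : n / m0 = r := by rw [hr]; exact Nat.mul_div_cancel_left _ hm0pos
  rw [hdiv] at hcop
  have hr1 : r ≠ 1 := by
    rintro rfl
    rw [mul_one] at hr
    rw [hr] at hn1
    nlinarith
  have hr0 : r ≠ 0 := by rintro rfl; omega
  set p := r.minFac
  have hp : p.Prime := Nat.minFac_prime hr1
  obtain ⟨e, s, hps, hrs⟩ := Nat.exists_eq_pow_mul_and_not_dvd hr0 p hp.ne_one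
  have he : 1 ≤ e := by
    by_contra h
    have : e = 0 := by omega
    subst this
    apply hps
    have := Nat.minFac_dvd r
    rw [pow_zero, one_mul] at hrs
    rw [← hrs]; exact this
  have hqs : (p ^ e).Coprime s := Nat.Coprime.pow_left _ ((Nat.Prime.coprime_iff_not_dvd hp).2 hps)
  rw [hrs] at hcop
  have hcs : m0.Coprime s := Nat.Coprime.coprime_mul_left_right hcop
  have hcq : m0.Coprime (p ^ e) := Nat.Coprime.coprime_mul_right_right hcop
  have hs0 : 0 < s := by
    rcases Nat.eq_zero_or_pos s with h | h
    · subst h; simp at hps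
    · exact h
  have hq2 : 2 ≤ p ^ e := le_trans hp.two_le (Nat.le_self_pow (by omega) p)
  have hc1 : (m0 * p ^ e).Coprime s := Nat.Coprime.mul_left hcs hqs
  have hn3 : n = (m0 * p ^ e) * s := by rw [hr, hrs]; ring
  have hbig : y ≤ (m0 * p ^ e : ℕ) := by
    by_contra h
    push Not at h
    have := hmax (m0 * p ^ e) ⟨⟨⟨s, hn3⟩, by omega⟩, by
      rw [hn3, Nat.mul_div_cancel_left _ (by positivity)]; exact hc1, h⟩
    nlinarith
  by_cases h1 : ((m0 * p ^ e : ℕ) : ℝ) ≤ y ^ 2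
  · left; exact ⟨_, s, hn3, hc1, hbig, h1⟩
  push Not at h1
  have hqy : y < (p ^ e : ℕ) := by
    push_cast at h1 ⊢
    by_contra h
    push Not at h
    have : (m0:ℝ) * (p:ℝ)^e ≤ y * y := by gcongr
    nlinarith
  have hn4 : n = p ^ e * (m0 * s) := by rw [hn3]; ring
  have hc4 : (p ^ e).Coprime (m0 * s) := Nat.Coprime.mul_right hcq.symm hqs
  by_cases h2 : ((p ^ e : ℕ) : ℝ) ≤ y ^ 2
  · left; exact ⟨_, _, hn4, hc4, hqy.le, h2⟩
  push Not at h2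
  right
  refine ⟨p, e, m0 * s, hp, he, ?_, ?_, hn4⟩
  · intro h
    have := Nat.dvd_gcd (dvd_pow_self p (by omega : e ≠ 0)) h
    rw [hc4.gcd_eq_one] at this
    exact hp.one_lt.ne' (Nat.dvd_one.mp this)
  · by_contra h
    push Not at h
    rw [hn4] at hn2
    push_cast at *
    have : y ^ 2 * y < (p:ℝ)^e * (m0 * s) := by gcongr
    nlinarith

theorem ap_count_s8 (T : Finset ℕ) (a D L : ℕ) (ha : 0 < a) (hL : ∀ t ∈ T, t ≤ L)
    (hc : ∀ t ∈ T, ∀ u ∈ T, a * t ≡ a * u [MOD D]) : T.card ≤ 1 + a * L / D := by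
  have : T.card ≤ (Finset.range (1 + a * L / D)).card := by
    apply Finset.card_le_card_of_injOn (fun t => a * t / D)
    · intro t ht
      have := Nat.div_le_div_right (c := D) (Nat.mul_le_mul_left a (hL t ht))
      simp only [Finset.coe_range, Set.mem_Iio]
      omega
    · intro t ht u hu h
      have h1 := hc t ht u hu
      simp only at h
      have h2 : a * t = a * u := by
        rw [← Nat.div_add_mod (a * t) D, ← Nat.div_add_mod (a * u) D, h, h1]
      exact Nat.eq_of_mul_eq_mul_left ha h2
  simpa using this

theorem sum_inv (N : ℕ) : ∑ t ∈ Finset.Icc 1 N, (1:ℝ) / t ≤ 1 + Real.log N := by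
  have := harmonic_le_one_add_log N
  rw [harmonic_eq_sum_Icc] at this
  push_cast at this
  simpa using this

theorem sum_inv_sqrt (N : ℕ) : ∑ t ∈ Finset.Icc 1 N, (1:ℝ) / √t ≤ 2 * √N := by
  induction N with
  | zero => simp
  | succ n ih =>
    rw [Finset.sum_Icc_succ_top (by omega)]
    have h1 : (0:ℝ) < √((n+1 : ℕ):ℝ) := by positivity
    have h2 : √((n+1 : ℕ):ℝ) ^ 2 = n + 1 := by rw [Real.sq_sqrt (by positivity)]; push_cast; ring
    have h3 : √(n:ℝ) ^ 2 = n := Real.sq_sqrt (by positivity)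
    have : (1:ℝ) / √((n+1 : ℕ):ℝ) ≤ 2 * √((n+1 : ℕ):ℝ) - 2 * √(n:ℝ) := by
      rw [div_le_iff₀ h1]
      nlinarith [sq_nonneg (√((n+1 : ℕ):ℝ) - √(n:ℝ))]
    linarith

theorem sigma1_mul_s8 {m r : ℕ} (h : m.Coprime r) : sigma1 (m * r) = sigma1 m * sigma1 r :=
  ArithmeticFunction.isMultiplicative_sigma.map_mul_of_coprime h

theorem sigma1_ge {m : ℕ} (h : m ≠ 0) : m ≤ sigma1 m := by
  unfold sigma1
  rw [ArithmeticFunction.sigma_one_apply]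
  exact Finset.single_le_sum (f := fun d => d) (fun _ _ => Nat.zero_le _) (by simp [h])

theorem sigma1_le_s8 {m : ℕ} : sigma1 m ≤ m * m.divisors.card := by
  unfold sigma1
  rw [ArithmeticFunction.sigma_one_apply]
  calc _ ≤ ∑ d ∈ m.divisors, m := Finset.sum_le_sum (fun d hd => Nat.divisor_le hd)
    _ = _ := by simp [mul_comm]

theorem gcd_dvd_k (a b : ℕ) (k : ℤ) (m r : ℕ) (hc : m.Coprime r)
    (h : (b : ℤ) * (sigma1 (m * r) : ℤ) = (a : ℤ) * ((m * r : ℕ) : ℤ) + k) :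
    (Nat.gcd m (sigma1 m)) ∣ k.natAbs := by
  rw [← Int.natCast_dvd]
  rw [sigma1_mul_s8 hc] at h
  push_cast at h
  have h1 : ((Nat.gcd m (sigma1 m) : ℕ) : ℤ) ∣ (m : ℤ) := by exact_mod_cast Nat.gcd_dvd_left _ _
  have h2 : ((Nat.gcd m (sigma1 m) : ℕ) : ℤ) ∣ (sigma1 m : ℤ) := by exact_mod_cast Nat.gcd_dvd_right _ _
  have : k = (b:ℤ) * (sigma1 m * sigma1 r) - a * (m * r) := by linarith
  rw [this]
  exact dvd_sub (Dvd.dvd.mul_left (Dvd.dvd.mul_right h2 _) _) (Dvd.dvd.mul_left (Dvd.dvd.mul_right h1 _) _)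

theorem modeq_of (a b : ℕ) (k : ℤ) (m t u : ℕ) (hm : m ≠ 0) (hc : m.Coprime t) (hu : m.Coprime u)
    (h : (b : ℤ) * (sigma1 (m * t) : ℤ) = (a : ℤ) * ((m * t : ℕ) : ℤ) + k)
    (h' : (b : ℤ) * (sigma1 (m * u) : ℤ) = (a : ℤ) * ((m * u : ℕ) : ℤ) + k) :
    a * t ≡ a * u [MOD (sigma1 m / Nat.gcd m (sigma1 m))] := by
  rw [sigma1_mul_s8 hc] at h
  rw [sigma1_mul_s8 hu] at h'
  have h1 : m * (a * t) ≡ m * (a * u) [MOD (sigma1 m)] := by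
    rw [Nat.modEq_iff_dvd]
    refine ⟨b * sigma1 u - b * sigma1 t, ?_⟩
    push_cast at h h' ⊢
    linear_combination h - h'
  have := Nat.ModEq.cancel_left_div_gcd (Nat.pos_of_ne_zero (by
    have := sigma1_ge hm; omega)) h1
  rwa [Nat.gcd_comm] at this

open Classical in
theorem caseB_m (a b : ℕ) (ha : 0 < a) (k : ℤ) (x : ℝ) (hx : 0 ≤ x) (m : ℕ) (hm : m ≠ 0)
    (T : Finset ℕ) (hT : ∀ n ∈ T, (n:ℝ) ≤ x ∧ (b : ℤ) * (sigma1 n : ℤ) = (a : ℤ) * n + k ∧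
      ∃ r, n = m * r ∧ m.Coprime r) :
    (T.card : ℝ) ≤ 1 + a * x * (Nat.gcd m (sigma1 m)) / (m : ℝ) ^ 2 := by
  set g := Nat.gcd m (sigma1 m) with hg
  have hm0 : (0:ℝ) < m := by exact_mod_cast Nat.pos_of_ne_zero hm
  have hg0 : 0 < g := Nat.gcd_pos_of_pos_left _ (Nat.pos_of_ne_zero hm)
  have hcard : (T.image (fun n => n / m)).card = T.card := by
    apply Finset.card_image_of_injOn
    intro n hn n' hn' h
    obtain ⟨-, -, r, hr, -⟩ := hT n hn
    obtain ⟨-, -, r', hr', -⟩ := hT n' hn'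
    simp only [hr, hr', Nat.mul_div_cancel_left _ (Nat.pos_of_ne_zero hm)] at h
    rw [hr, hr', h]
  have hmem : ∀ t ∈ T.image (fun n => n / m), (m * t : ℕ) ∈ T ∧ m.Coprime t := by
    intro t ht
    obtain ⟨n, hn, hnt⟩ := Finset.mem_image.mp ht
    obtain ⟨-, -, r, hr, hc⟩ := hT n hn
    have : t = r := by rw [← hnt, hr, Nat.mul_div_cancel_left _ (Nat.pos_of_ne_zero hm)]
    subst this
    exact ⟨hr ▸ hn, hc⟩
  have := ap_count_s8 (T.image (fun n => n / m)) a (sigma1 m / g) ⌊x / m⌋₊ ha (by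
    intro t ht
    obtain ⟨h1, -⟩ := hmem t ht
    apply Nat.le_floor
    rw [le_div_iff₀ hm0]
    have := (hT _ h1).1
    push_cast at this
    linarith) (by
    intro t ht u hu
    obtain ⟨h1, h2⟩ := hmem t ht
    obtain ⟨h3, h4⟩ := hmem u hu
    exact modeq_of a b k m t u hm h2 h4 (hT _ h1).2.1 (hT _ h3).2.1)
  rw [hcard] at this
  have hD : (m:ℝ) / g ≤ ((sigma1 m / g : ℕ) : ℝ) := by
    rw [Nat.cast_div (Nat.gcd_dvd_right _ _) (by positivity)]
    gcongr
    exact sigma1_ge hm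
  have hD0 : 0 < (m:ℝ) / g := by positivity
  calc (T.card : ℝ) ≤ ((1 + a * ⌊x / m⌋₊ / (sigma1 m / g) : ℕ) : ℝ) := by exact_mod_cast this
    _ ≤ 1 + (a * (x / m)) / (m / g) := by
      push_cast
      gcongr
      refine Nat.cast_div_le.trans ?_
      push_cast
      gcongr
      exact Nat.floor_le (by positivity)
    _ = _ := by field_simp

open Classical in
theorem caseB (a b : ℕ) (ha : 0 < a) (k : ℤ) (hk : k ≠ 0) (x y : ℝ) (hy : 1 ≤ y) (hxy : x = y ^ 3)
    (T : Finset ℕ) (hT : ∀ n ∈ T, (n:ℝ) ≤ x ∧ (b : ℤ) * (sigma1 n : ℤ) = (a : ℤ) * n + k ∧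
      ∃ m r, n = m * r ∧ m.Coprime r ∧ y ≤ m ∧ (m:ℝ) ≤ y ^ 2) :
    (T.card : ℝ) ≤ y ^ 2 + a * y ^ 2 * (k.natAbs.divisors.card * (1 + Real.log x)) := by
  have hx1 : 1 ≤ x := by rw [hxy]; exact one_le_pow₀ hy
  set M := (Finset.Icc 1 ⌊y ^ 2⌋₊).filter (fun m : ℕ => y ≤ m ∧ Nat.gcd m (sigma1 m) ∣ k.natAbs) with hM
  have hsub : T ⊆ M.biUnion (fun m => T.filter (fun n => ∃ r, n = m * r ∧ m.Coprime r)) := by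
    intro n hn
    obtain ⟨h1, h2, m, r, h3, h4, h5, h6⟩ := hT n hn
    simp only [Finset.mem_biUnion, Finset.mem_filter, hM, Finset.mem_Icc]
    refine ⟨m, ⟨⟨?_, Nat.le_floor h6⟩, h5, ?_⟩, hn, r, h3, h4⟩
    · exact_mod_cast hy.trans h5
    · subst h3; exact gcd_dvd_k a b k m r h4 h2
  have h1 : (T.card : ℝ) ≤ ∑ m ∈ M, (1 + a * x * (Nat.gcd m (sigma1 m)) / (m : ℝ) ^ 2) := by
    calc (T.card : ℝ) ≤ ((∑ m ∈ M, (T.filter (fun n => ∃ r, n = m * r ∧ m.Coprime r)).card : ℕ) : ℝ) := by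
          exact_mod_cast (Finset.card_le_card hsub).trans Finset.card_biUnion_le
      _ ≤ _ := by
          push_cast
          apply Finset.sum_le_sum
          intro m hm
          simp only [hM, Finset.mem_filter, Finset.mem_Icc] at hm
          apply caseB_m a b ha k x (by linarith) m (by omega)
          intro n hn
          rw [Finset.mem_filter] at hn
          exact ⟨(hT n hn.1).1, (hT n hn.1).2.1, hn.2⟩
  have hMc : (M.card : ℝ) ≤ y ^ 2 := by
    have : M.card ≤ ⌊y ^ 2⌋₊ := (Finset.card_filter_le _ _).trans (by simp)
    exact (Nat.cast_le.mpr this).trans (Nat.floor_le (by positivity))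
  have h2 : ∑ m ∈ M, (a * x * (Nat.gcd m (sigma1 m)) / (m : ℝ) ^ 2) ≤
      ∑ m ∈ M, a * y ^ 2 * (1 / ((m / Nat.gcd m (sigma1 m) : ℕ) : ℝ)) := by
    apply Finset.sum_le_sum
    intro m hm
    simp only [hM, Finset.mem_filter, Finset.mem_Icc] at hm
    have hm0 : (0:ℝ) < m := by exact_mod_cast hm.1.1
    have hg0 : 0 < Nat.gcd m (sigma1 m) := Nat.gcd_pos_of_pos_left _ (by omega)
    rw [Nat.cast_div (Nat.gcd_dvd_left _ _) (by positivity), hxy]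
    rw [div_le_iff₀ (by positivity)]
    have : a * y ^ 2 * (1 / ((m:ℝ) / (Nat.gcd m (sigma1 m) : ℝ))) * (m:ℝ)^2 =
      a * (y ^ 2 * m) * (Nat.gcd m (sigma1 m) : ℝ) := by field_simp
    rw [this]
    gcongr
    have := hm.2.1
    calc y ^ 3 = y ^ 2 * y := by ring
      _ ≤ _ := by gcongr
  have h3 : ∑ m ∈ M, (1 / ((m / Nat.gcd m (sigma1 m) : ℕ) : ℝ)) ≤
      k.natAbs.divisors.card * (1 + Real.log x) := by
    have hinj : Set.InjOn (fun m => (Nat.gcd m (sigma1 m), m / Nat.gcd m (sigma1 m))) (M : Set ℕ) := by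
      intro m hm m' hm' h
      simp only [Prod.mk.injEq] at h
      rw [← Nat.mul_div_cancel' (Nat.gcd_dvd_left m (sigma1 m)), h.2, h.1,
        Nat.mul_div_cancel' (Nat.gcd_dvd_left m' (sigma1 m'))]
    calc _ = ∑ z ∈ M.image (fun m => (Nat.gcd m (sigma1 m), m / Nat.gcd m (sigma1 m))), (1 / (z.2 : ℝ)) := by
          rw [Finset.sum_image hinj]
      _ ≤ ∑ z ∈ k.natAbs.divisors ×ˢ Finset.Icc 1 ⌊y^2⌋₊, (1 / (z.2 : ℝ)) := by
          apply Finset.sum_le_sum_of_subset_of_nonneg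
          · intro z hz
            obtain ⟨m, hm, rfl⟩ := Finset.mem_image.mp hz
            simp only [hM, Finset.mem_filter, Finset.mem_Icc] at hm
            simp only [Finset.mem_product, Nat.mem_divisors, Finset.mem_Icc]
            refine ⟨⟨hm.2.2, by simpa using hk⟩, ?_, (Nat.div_le_self _ _).trans hm.1.2⟩
            exact Nat.div_pos (Nat.gcd_le_left _ (by omega)) (Nat.gcd_pos_of_pos_left _ (by omega))
          · intros; positivity
      _ = k.natAbs.divisors.card * ∑ t ∈ Finset.Icc 1 ⌊y^2⌋₊, (1 / (t : ℝ)) := by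
          rw [Finset.sum_product]; simp
      _ ≤ _ := by
          gcongr
          refine (sum_inv _).trans ?_
          have hpos : 0 < ⌊y^2⌋₊ := Nat.floor_pos.mpr (one_le_pow₀ hy)
          gcongr
          refine (Nat.floor_le (by positivity)).trans ?_
          rw [hxy]
          exact pow_le_pow_right₀ hy (by norm_num)
  rw [Finset.sum_add_distrib] at h1
  rw [← Finset.mul_sum] at h2
  simp only [Finset.sum_const, nsmul_eq_mul, mul_one] at h1
  have : a * y ^ 2 * ∑ m ∈ M, (1 / ((m / Nat.gcd m (sigma1 m) : ℕ) : ℝ)) ≤ a * y ^ 2 * (k.natAbs.divisors.card * (1 + Real.log x)) := by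
    gcongr
  linarith

theorem caseP (x y : ℝ) (hy : 1 ≤ y) (hxy : x = y ^ 3)
    (T : Finset ℕ) (hT : ∀ n ∈ T, (n:ℝ) ≤ x ∧ 1 ≤ n ∧
      ∃ p e m : ℕ, p.Prime ∧ 2 ≤ e ∧ (m:ℝ) ≤ y ∧ n = p ^ e * m) :
    (T.card : ℝ) ≤ 2 * y ^ 2 * (2 * Real.log x) := by
  have hx1 : 1 ≤ x := by rw [hxy]; exact one_le_pow₀ hy
  set E := Nat.log 2 ⌊x⌋₊ with hE
  have hsub : T ⊆ (Finset.Icc 1 ⌊y⌋₊).biUnion (fun m =>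
      (Finset.Icc 1 ⌊√(x / m)⌋₊ ×ˢ Finset.Icc 1 E).image (fun z => z.1 ^ z.2 * m)) := by
    intro n hn
    obtain ⟨h1, h2, p, e, m, hp, he, hm, rfl⟩ := hT n hn
    have hm1 : 1 ≤ m := by
      by_contra h
      have : m = 0 := by omega
      subst this; simp at h2
    have hm0 : (0:ℝ) < m := by exact_mod_cast hm1
    have hp2 := hp.two_le
    simp only [Finset.mem_biUnion, Finset.mem_image, Finset.mem_product, Finset.mem_Icc, Prod.exists]
    refine ⟨m, ⟨hm1, Nat.le_floor hm⟩, p, e, ⟨⟨by omega, ?_⟩, by omega, ?_⟩, rfl⟩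
    · apply Nat.le_floor
      apply Real.le_sqrt_of_sq_le
      rw [le_div_iff₀ hm0]
      push_cast at h1
      refine le_trans ?_ h1
      gcongr
      exact_mod_cast hp.one_le
    · apply Nat.le_log_of_pow_le (by norm_num)
      apply Nat.le_floor
      refine le_trans ?_ h1
      push_cast
      calc (2:ℝ) ^ e ≤ (p:ℝ) ^ e := by gcongr; exact_mod_cast hp2
        _ ≤ (p:ℝ)^e * m := le_mul_of_one_le_right (by positivity) (by exact_mod_cast hm1)
  have hElog : (E:ℝ) ≤ 2 * Real.log x := by
    have h2 : (2:ℝ) ^ E ≤ x := by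
      have : 2 ^ E ≤ ⌊x⌋₊ := Nat.pow_log_le_self 2 (Nat.floor_pos.mpr hx1).ne'
      calc (2:ℝ) ^ E ≤ (⌊x⌋₊ : ℝ) := by exact_mod_cast this
        _ ≤ x := Nat.floor_le (by linarith)
    have h3 := Real.log_le_log (by positivity) h2
    rw [Real.log_pow] at h3
    have := Real.log_two_gt_d9
    nlinarith [(Nat.cast_nonneg E : (0:ℝ) ≤ E)]
  have hlog0 : 0 ≤ Real.log x := Real.log_nonneg hx1
  calc (T.card : ℝ) ≤ ((∑ m ∈ Finset.Icc 1 ⌊y⌋₊, ⌊√(x / m)⌋₊ * E : ℕ) : ℝ) := by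
        norm_cast
        refine (Finset.card_le_card hsub).trans (Finset.card_biUnion_le.trans ?_)
        apply Finset.sum_le_sum
        intro m _
        refine Finset.card_image_le.trans ?_
        simp
    _ ≤ ∑ m ∈ Finset.Icc 1 ⌊y⌋₊, √x * (1 / √m) * (2 * Real.log x) := by
        push_cast
        apply Finset.sum_le_sum
        intro m _
        gcongr
        refine (Nat.floor_le (by positivity)).trans ?_
        rw [Real.sqrt_div (by linarith)]
        exact (mul_one_div _ _).ge
    _ = √x * (∑ m ∈ Finset.Icc 1 ⌊y⌋₊, (1 / √m)) * (2 * Real.log x) := by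
        rw [Finset.mul_sum, Finset.sum_mul]
    _ ≤ √x * (2 * √y) * (2 * Real.log x) := by
        gcongr
        refine (sum_inv_sqrt _).trans ?_
        gcongr
        exact Nat.floor_le (by linarith)
    _ = _ := by
        have : √x * √y = y ^ 2 := by
          rw [← Real.sqrt_mul (by linarith), hxy, show y ^ 3 * y = (y^2)^2 by ring, Real.sqrt_sq (by positivity)]
        rw [← this]; ring

theorem caseQ (a b : ℕ) (hb : 1 ≤ b) (hcop : Nat.Coprime a b) (k : ℤ)
    (hex : ¬ (∃ j : ℕ, 0 < j ∧ k = (a : ℤ) * b * j ∧ sigma1 (b * j) = a * j))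
    (y : ℝ) (hy : 0 ≤ y)
    (T : Finset ℕ) (hT : ∀ n ∈ T, 1 ≤ n ∧ (b : ℤ) * (sigma1 n : ℤ) = (a : ℤ) * n + k ∧
      ∃ p m : ℕ, p.Prime ∧ ¬ p ∣ m ∧ (m:ℝ) ≤ y ∧ n = p * m) :
    (T.card : ℝ) ≤ y := by
  have hsub : T ⊆ (Finset.Icc 1 ⌊y⌋₊).image (fun m : ℕ =>
      ((k - b * sigma1 m) / ((b:ℤ) * sigma1 m - a * m)).toNat * m) := by
    intro n hn
    obtain ⟨h1, h2, p, m, hp, hpm, hm, rfl⟩ := hT n hn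
    have hm1 : 1 ≤ m := by
      by_contra h
      have : m = 0 := by omega
      subst this; simp at hpm
    simp only [Finset.mem_image, Finset.mem_Icc]
    refine ⟨m, ⟨hm1, Nat.le_floor hm⟩, ?_⟩
    rw [sigma1_mul_s8 ((Nat.Prime.coprime_iff_not_dvd hp).2 hpm)] at h2
    have hsp : sigma1 p = p + 1 := by
      unfold sigma1
      rw [ArithmeticFunction.sigma_one_apply, hp.sum_divisors]
    rw [hsp] at h2
    push_cast at h2
    have h3 : (p:ℤ) * ((b:ℤ) * sigma1 m - a * m) = k - b * sigma1 m := by linear_combination h2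
    have h4 : (b:ℤ) * sigma1 m - a * m ≠ 0 := by
      intro h0
      rw [h0, mul_zero] at h3
      apply hex
      have h5 : b * sigma1 m = a * m := by
        have : (b:ℤ) * sigma1 m = a * m := by linarith
        exact_mod_cast this
      have h6 : b ∣ m := hcop.symm.dvd_of_dvd_mul_left (Dvd.intro _ h5)
      obtain ⟨j, rfl⟩ := h6
      refine ⟨j, ?_, ?_, ?_⟩
      · exact Nat.pos_of_mul_pos_left hm1
      · push_cast at h0; linarith
      · apply Nat.eq_of_mul_eq_mul_left hb
        rw [h5]; ring
    rw [← h3, Int.mul_ediv_cancel _ h4]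
    simp
  have : T.card ≤ ⌊y⌋₊ := (Finset.card_le_card hsub).trans (Finset.card_image_le.trans (by simp))
  exact (Nat.cast_le.mpr this).trans (Nat.floor_le hy)

theorem a_bound (a b : ℕ) (k : ℤ) (n : ℕ) (y : ℝ) (hn : y ^ 2 < n) (hk : (|k| : ℝ) < b * y ^ 2)
    (h : (b : ℤ) * (sigma1 n : ℤ) = (a : ℤ) * n + k) : (a:ℝ) ≤ b * (n.divisors.card + 1) := by
  have hn0 : (0:ℝ) < n := lt_of_le_of_lt (by positivity) hn
  have h1 : (b:ℝ) * sigma1 n = a * n + k := by exact_mod_cast h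
  have h2 : (sigma1 n : ℝ) ≤ n * n.divisors.card := by exact_mod_cast sigma1_le_s8
  have h3 : -(k:ℝ) ≤ b * n := by
    calc -(k:ℝ) ≤ |(k:ℝ)| := neg_le_abs _
      _ ≤ b * y ^ 2 := hk.le
      _ ≤ _ := by gcongr
  have h4 : (a:ℝ) * n ≤ b * (n.divisors.card + 1) * n := by
    have : (b:ℝ) * sigma1 n ≤ b * (n * n.divisors.card) := by gcongr
    nlinarith
  exact le_of_mul_le_mul_right h4 hn0

theorem stmt_8 :
    ∀ ε > (0 : ℝ), ∃ C > (0 : ℝ), ∀ a b : ℕ, 1 ≤ b → b < a → Nat.Coprime a b →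
      ∀ k : ℤ, k ≠ 0 →
      -- it is NOT the case that `k ≥ 1`, `ab ∣ k` and `σ(k/a) = k/b`
      -- (i.e. `k = a·b·j` with `σ(b·j) = a·j` for some positive integer `j`)
      ¬ (∃ j : ℕ, 0 < j ∧ k = (a : ℤ) * b * j ∧ sigma1 (b * j) = a * j) →
      ∀ x : ℝ, 1 ≤ x → (|k| : ℝ) < (b : ℝ) * x ^ ((2 : ℝ) / 3) →
      ({n : ℕ | 1 ≤ n ∧ (n : ℝ) ≤ x ∧
          (b : ℤ) * (sigma1 n : ℤ) = (a : ℤ) * n + k}.ncard : ℝ)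
        ≤ C * b ^ 2 * x ^ ((2 : ℝ) / 3 + ε) := by
  classical
  intro ε hε
  set δ : ℝ := min (ε / 3) 1 with hδdef
  have hδ : 0 < δ := by positivity
  have hδ1 : δ ≤ 1 := min_le_right _ _
  have hδε : δ * 3 ≤ ε := by
    have := min_le_left (ε / 3) 1
    rw [← hδdef] at this; linarith
  obtain ⟨C0, hC0, hd⟩ := dbound δ hδ
  refine ⟨3 + 2 * C0 * (C0 * (1 + 1 / δ)) + 4 * (1 / δ), by positivity, ?_⟩
  intro a b hb hab hcop k hk hex x hx hkx
  set y : ℝ := x ^ ((1:ℝ)/3) with hydef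
  have hy : 1 ≤ y := Real.one_le_rpow hx (by norm_num)
  have hxy : x = y ^ 3 := by
    rw [hydef, ← Real.rpow_natCast, ← Real.rpow_mul (by linarith)]; norm_num
  have hy2 : x ^ ((2:ℝ)/3) = y ^ 2 := by
    rw [hydef, ← Real.rpow_natCast, ← Real.rpow_mul (by linarith)]; norm_num
  rw [hy2] at hkx
  have hx0 : 0 < x := by linarith
  set z : ℝ := x ^ δ with hz
  have hz1 : 1 ≤ z := Real.one_le_rpow hx hδ.le
  have hlog : Real.log x ≤ z * (1 / δ) := by
    have := Real.log_le_rpow_div hx0.le hδ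
    rw [mul_one_div]; exact this
  have hlog0 : 0 ≤ Real.log x := Real.log_nonneg hx
  have hfin : x ^ ((2:ℝ)/3 + ε) ≥ y ^ 2 * z ^ 3 := by
    rw [Real.rpow_add hx0, hy2, hz]
    gcongr
    rw [← Real.rpow_natCast, ← Real.rpow_mul hx0.le]
    exact Real.rpow_le_rpow_of_exponent_le hx (by exact_mod_cast hδε)
  have hb1 : (1:ℝ) ≤ b := by exact_mod_cast hb
  have hdk : (k.natAbs.divisors.card : ℝ) ≤ C0 * (b * z) := by
    refine (hd _ (by simpa using hk)).trans ?_
    have hkk : (k.natAbs : ℝ) ≤ b * x := by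
      rw [Nat.cast_natAbs, Int.cast_abs]
      refine hkx.le.trans ?_
      gcongr
      rw [hxy]
      exact pow_le_pow_right₀ hy (by norm_num)
    gcongr
    calc (k.natAbs : ℝ) ^ δ ≤ (b * x) ^ δ := by gcongr
      _ = (b:ℝ) ^ δ * z := by rw [Real.mul_rpow (by positivity) hx0.le]
      _ ≤ (b:ℝ) ^ (1:ℝ) * z := by gcongr
      _ = _ := by rw [Real.rpow_one]
  set S : Finset ℕ := (Finset.Icc 1 ⌊x⌋₊).filter (fun n : ℕ => (b : ℤ) * (sigma1 n : ℤ) = (a : ℤ) * n + k) with hS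
  have hSmem : ∀ n ∈ S, 1 ≤ n ∧ (n:ℝ) ≤ x ∧ (b : ℤ) * (sigma1 n : ℤ) = (a : ℤ) * n + k := by
    intro n hn
    simp only [hS, Finset.mem_filter, Finset.mem_Icc] at hn
    exact ⟨hn.1.1, (Nat.le_floor_iff hx0.le).1 hn.1.2, hn.2⟩
  have hSeq : {n : ℕ | 1 ≤ n ∧ (n : ℝ) ≤ x ∧
          (b : ℤ) * (sigma1 n : ℤ) = (a : ℤ) * n + k} = (S : Set ℕ) := by
    ext n
    simp only [Set.mem_ofPred_eq, hS, Finset.coe_filter, Finset.mem_Icc, Nat.le_floor_iff hx0.le, and_assoc]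
  rw [hSeq, Set.ncard_coe_finset]
  set A := S.filter (fun n : ℕ => (n:ℝ) ≤ y ^ 2) with hA
  set B := S.filter (fun n : ℕ => y ^ 2 < n ∧ ∃ m r, n = m * r ∧ m.Coprime r ∧ y ≤ m ∧ (m:ℝ) ≤ y ^ 2) with hB
  set P := S.filter (fun n : ℕ => ∃ p e m : ℕ, p.Prime ∧ 2 ≤ e ∧ (m:ℝ) ≤ y ∧ n = p ^ e * m) with hP
  set Q := S.filter (fun n : ℕ => ∃ p m : ℕ, p.Prime ∧ ¬ p ∣ m ∧ (m:ℝ) ≤ y ∧ n = p * m) with hQ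
  have hcover : S ⊆ A ∪ (B ∪ (P ∪ Q)) := by
    intro n hn
    simp only [Finset.mem_union, hA, hB, hP, hQ, Finset.mem_filter, hn, true_and]
    by_cases h : (n:ℝ) ≤ y ^ 2
    · exact Or.inl h
    push Not at h
    right
    have h3 : (n:ℝ) ≤ y ^ 3 := by rw [← hxy]; exact (hSmem n hn).2.1
    rcases structure_lemma n y h h3 with h4 | ⟨p, e, m, h5, h6, h7, h8, h9⟩
    · exact Or.inl ⟨h, h4⟩
    · right
      rcases Nat.lt_or_ge e 2 with he | he
      · right
        have : e = 1 := by omega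
        subst this
        exact ⟨p, m, h5, h7, h8, by simpa using h9⟩
      · left; exact ⟨p, e, m, h5, he, h8, h9⟩
  have hcA : (A.card : ℝ) ≤ y ^ 2 := by
    have : A.card ≤ ⌊y^2⌋₊ := by
      have : A ⊆ Finset.Icc 1 ⌊y^2⌋₊ := by
        intro n hn
        simp only [hA, Finset.mem_filter] at hn
        simp only [Finset.mem_Icc]
        exact ⟨(hSmem n hn.1).1, Nat.le_floor hn.2⟩
      simpa using Finset.card_le_card this
    exact (Nat.cast_le.mpr this).trans (Nat.floor_le (by positivity))
  have hcB : (B.card : ℝ) ≤ y ^ 2 + y ^ 2 * ((b * (2 * C0 * z)) * (C0 * (b * z) * (z * (1 + 1 / δ)))) := by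
    rcases B.eq_empty_or_nonempty with h | ⟨n, hn⟩
    · rw [h]; simp only [Finset.card_empty, Nat.cast_zero]; positivity
    · have haB : (a:ℝ) ≤ b * (2 * C0 * z) := by
        simp only [hB, Finset.mem_filter] at hn
        obtain ⟨h1, h2, h3⟩ := hSmem n hn.1
        refine (a_bound a b k n y hn.2.1 hkx h3).trans ?_
        gcongr
        have h4 := hd n (by omega)
        have h5 : (n:ℝ) ^ δ ≤ z := by rw [hz]; gcongr
        have h6 : C0 * (n:ℝ) ^ δ ≤ C0 * z := by gcongr
        nlinarith
      have := caseB a b (by omega) k hk x y hy hxy B (by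
        intro n hn
        simp only [hB, Finset.mem_filter] at hn
        obtain ⟨h1, h2, h3⟩ := hSmem n hn.1
        exact ⟨h2, h3, hn.2.2⟩)
      refine this.trans ?_
      rw [mul_comm (a:ℝ), mul_assoc]
      have hl : 1 + Real.log x ≤ z * (1 + 1 / δ) := by
        rw [mul_add, mul_one]; linarith
      have hl0 : 0 ≤ 1 + Real.log x := by linarith
      have hp1 : (k.natAbs.divisors.card : ℝ) * (1 + Real.log x) ≤ C0 * (b * z) * (z * (1 + 1 / δ)) :=
        mul_le_mul hdk hl hl0 (by positivity)
      have hp2 := mul_le_mul haB hp1 (mul_nonneg (Nat.cast_nonneg _) hl0) (by positivity)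
      have hp3 := mul_le_mul_of_nonneg_left hp2 (sq_nonneg y)
      linarith
  have hcP : (P.card : ℝ) ≤ 2 * y ^ 2 * (2 * (z * (1 / δ))) := by
    refine (caseP x y hy hxy P (by
      intro n hn
      replace hn := Finset.mem_filter.mp hn
      obtain ⟨h1, h2, h3⟩ := hSmem n hn.1
      exact ⟨h2, h1, hn.2⟩)).trans ?_
    gcongr
  have hcQ : (Q.card : ℝ) ≤ y := caseQ a b hb hcop k hex y (by linarith) Q (by
      intro n hn
      replace hn := Finset.mem_filter.mp hn
      obtain ⟨h1, h2, h3⟩ := hSmem n hn.1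
      exact ⟨h1, h3, hn.2⟩)
  have hcard : (S.card : ℝ) ≤ A.card + (B.card + (P.card + Q.card)) := by
    have h1 := Finset.card_le_card hcover
    have h2 := Finset.card_union_le A (B ∪ (P ∪ Q))
    have h3 := Finset.card_union_le B (P ∪ Q)
    have h4 := Finset.card_union_le P Q
    have : S.card ≤ A.card + (B.card + (P.card + Q.card)) := by omega
    exact_mod_cast this
  have hW : (1:ℝ) ≤ b ^ 2 * z ^ 3 := one_le_mul_of_one_le_of_one_le (one_le_pow₀ hb1) (one_le_pow₀ hz1)
  have hW2 : z ≤ b ^ 2 * z ^ 3 := by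
    calc z = 1 * z ^ 1 := by ring
      _ ≤ b ^ 2 * z ^ 3 := by
        gcongr
        · exact one_le_pow₀ hb1
        · norm_num
  have hyy : y ≤ y ^ 2 := by nlinarith
  have e1 : y ^ 2 ≤ y ^ 2 * (b ^ 2 * z ^ 3) := le_mul_of_one_le_right (by positivity) hW
  have e2 : 2 * y ^ 2 * (2 * (z * (1 / δ))) ≤ 2 * y ^ 2 * (2 * (b ^ 2 * z ^ 3 * (1 / δ))) := by gcongr
  calc (S.card : ℝ) ≤ 3 * (y ^ 2 * (b ^ 2 * z ^ 3)) + y ^ 2 * ((b * (2 * C0 * z)) * (C0 * (b * z) * (z * (1 + 1 / δ))))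
        + 2 * y ^ 2 * (2 * (b ^ 2 * z ^ 3 * (1 / δ))) := by linarith
    _ = (3 + 2 * C0 * (C0 * (1 + 1 / δ)) + 4 * (1 / δ)) * b ^ 2 * (y ^ 2 * z ^ 3) := by ring
    _ ≤ _ := by gcongr
end
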